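/- There exist absolute constants c > 0 and C > 0 such that for all real x ≥ 16, |π(x) − li x| ≤ C · x · exp(−c·(log x)^{3/5}·(log log x)^{−1/5}), where π(x) is the number of primes not exceeding x. -/

import Mathlib

/-- The number of primes `p ≤ x`, for real `x`. -/
noncomputable def primePi (x : ℝ) : ℕ := {p : ℕ | p.Prime ∧ (p : ℝ) ≤ x}.ncard

/-- The logarithmic integral `li x = ∫₂ˣ dt / log t`. -/
noncomputable def li (x : ℝ) : ℝ := ∫ t in (2:ℝ)..x, 1 / Real.log t

namespace VinogradovKorobov

open Finset

section Counting

variable {ι κ β V : Type*} [DecidableEq V]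

/-- The number of pairs in `s` on which `v` takes equal values. -/
def energy (s : Finset ι) (v : ι → V) : ℕ := #{p ∈ s ×ˢ s | v p.1 = v p.2}

lemma card_filter_pair_eq_sum (s : Finset ι) (v w : ι → V) :
    #{p ∈ s ×ˢ s | w p.1 = v p.2} = ∑ j ∈ s, #{i ∈ s | w i = v j} := by
  classical
  rw [card_filter, sum_product_right]
  exact sum_congr rfl fun j _ => (card_filter _ _).symm

lemma energy_eq_sum_sq (s : Finset ι) (v : ι → V) {W : Finset V} (hW : ∀ i ∈ s, v i ∈ W) :
    energy s v = ∑ w ∈ W, #{i ∈ s | v i = w} ^ 2 := by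
  classical
  rw [energy, card_filter_pair_eq_sum, ← sum_fiberwise_of_maps_to hW]
  refine sum_congr rfl fun w _ => ?_
  rw [sum_congr rfl (g := fun _ => #{i ∈ s | v i = w})
    (fun j hj => by rw [(mem_filter.1 hj).2])]
  simp [sq]

lemma sum_sq_le_energy (s : Finset ι) (v : ι → V) (W : Finset V) :
    ∑ w ∈ W, #{i ∈ s | v i = w} ^ 2 ≤ energy s v := by
  classical
  rw [energy_eq_sum_sq s v (W := W ∪ s.image v)
    (fun i hi => mem_union_right _ (mem_image_of_mem v hi))]
  exact sum_le_sum_of_subset subset_union_left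

lemma energy_mono {s t : Finset ι} (h : s ⊆ t) (v : ι → V) : energy s v ≤ energy t v :=
  card_le_card (filter_subset_filter _ (product_subset_product h h))

lemma energy_biUnion_le [DecidableEq ι] (A : Finset β) (I : β → Finset ι) (v : ι → V) :
    energy (A.biUnion I) v ≤ #A * ∑ a ∈ A, energy (I a) v := by
  classical
  set W := (A.biUnion I).image v
  rw [energy_eq_sum_sq (A.biUnion I) v (W := W) (fun i hi => mem_image_of_mem v hi)]
  calc ∑ w ∈ W, #{i ∈ A.biUnion I | v i = w} ^ 2
      ≤ ∑ w ∈ W, (∑ a ∈ A, #{i ∈ I a | v i = w}) ^ 2 := by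
        gcongr with w _
        rw [filter_biUnion]
        exact card_biUnion_le
    _ ≤ ∑ w ∈ W, #A * ∑ a ∈ A, #{i ∈ I a | v i = w} ^ 2 := by
        gcongr with w _
        exact sq_sum_le_card_mul_sum_sq
    _ = #A * ∑ a ∈ A, ∑ w ∈ W, #{i ∈ I a | v i = w} ^ 2 := by
        rw [← mul_sum, sum_comm]
    _ ≤ _ := by
        gcongr with a _
        exact sum_sq_le_energy _ _ _

lemma energy_le_of_cover [DecidableEq ι] {s : Finset ι} (A : Finset β) (I : β → Finset ι)
    (v : ι → V) (h : s ⊆ A.biUnion I) {B : ℕ} (hB : ∀ a ∈ A, energy (I a) v ≤ B) :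
    energy s v ≤ #A ^ 2 * B := by
  refine (energy_mono h v).trans ((energy_biUnion_le A I v).trans ?_)
  rw [sq, mul_assoc]
  gcongr
  simpa using sum_le_card_nsmul A _ B hB

lemma card_shift_le_energy [AddCommGroup V] (s : Finset ι) (v : ι → V) (c : V) :
    #{p ∈ s ×ˢ s | v p.1 = v p.2 + c} ≤ energy s v := by
  classical
  rw [card_filter_pair_eq_sum s (fun i => v i + c) v]
  set W := s.image v
  have hW : ∀ i ∈ s, v i ∈ W := fun i hi => mem_image_of_mem v hi
  have h1 : ∑ j ∈ s, #{i ∈ s | v i = v j + c}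
      = ∑ w ∈ W, #{i ∈ s | v i = w} * #{i ∈ s | v i = w + c} := by
    rw [← sum_fiberwise_of_maps_to hW]
    refine sum_congr rfl fun w _ => ?_
    rw [sum_congr rfl (g := fun _ => #{i ∈ s | v i = w + c})
      (fun j hj => by rw [(mem_filter.1 hj).2])]
    simp
  rw [h1]
  have h2 : ∑ w ∈ W, #{i ∈ s | v i = w + c} ^ 2 ≤ energy s v := by
    have := sum_sq_le_energy s v (W.map (addRightEmbedding c))
    simpa using this
  have h3 := sum_sq_le_energy s v W
  have h4 : 2 * ∑ w ∈ W, #{i ∈ s | v i = w} * #{i ∈ s | v i = w + c} ≤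
      ∑ w ∈ W, #{i ∈ s | v i = w} ^ 2 + ∑ w ∈ W, #{i ∈ s | v i = w + c} ^ 2 := by
    rw [mul_sum, ← sum_add_distrib]
    refine sum_le_sum fun w _ => ?_
    rw [← mul_assoc]
    exact two_mul_le_add_sq _ _
  omega

lemma energy_prod_le [AddCommGroup V] (D : Finset ι) (E : Finset κ) (d : ι → V) (e : κ → V)
    (R : Finset (ι × ι))
    (hR : ∀ x ∈ D, ∀ y ∈ D, ∀ u ∈ E, ∀ w ∈ E, d x + e u = d y + e w → (x, y) ∈ R) :
    energy (D ×ˢ E) (fun q => d q.1 + e q.2) ≤ #R * energy E e := by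
  classical
  rw [energy]
  set S := {p ∈ (D ×ˢ E) ×ˢ (D ×ˢ E) | d p.1.1 + e p.1.2 = d p.2.1 + e p.2.2}
  have hmap : ∀ p ∈ S, (p.1.1, p.2.1) ∈ R := by
    intro p hp
    simp only [S, mem_filter, mem_product] at hp
    exact hR _ hp.1.1.1 _ hp.1.2.1 _ hp.1.1.2 _ hp.1.2.2 hp.2
  rw [mul_comm]
  refine card_le_mul_card_image_of_maps_to (f := fun p => (p.1.1, p.2.1)) hmap _ fun r _ => ?_
  refine le_trans ?_ (card_shift_le_energy E e (d r.2 - d r.1))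
  refine card_le_card_of_injOn (fun p => (p.1.2, p.2.2)) ?_ ?_
  · intro p hp
    simp only [S, mem_filter, mem_product, coe_filter, Set.mem_ofPred_eq] at hp ⊢
    obtain ⟨⟨h1, h2⟩, rfl⟩ := hp
    refine ⟨⟨h1.1.2, h1.2.2⟩, ?_⟩
    have : e p.1.2 = d p.2.1 + e p.2.2 - d p.1.1 := by rw [← h2]; abel
    rw [this]; abel
  · intro p hp q hq h
    simp only [S, mem_filter, mem_product, coe_filter, Set.mem_ofPred_eq] at hp hq
    simp only [Prod.mk.injEq] at h
    have h1 := hp.2.trans hq.2.symm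
    simp only [Prod.mk.injEq] at h1
    ext <;> simp [h.1, h.2, h1.1, h1.2]

lemma energy_equiv (s : Finset ι) (t : Finset κ) (v : ι → V) (w : κ → V) (f : ι → κ)
    (hf : ∀ i ∈ s, f i ∈ t) (hinj : Set.InjOn f s)
    (h : ∀ i ∈ s, ∀ j ∈ s, v i = v j → w (f i) = w (f j)) :
    energy s v ≤ energy t w := by
  refine card_le_card_of_injOn (fun p => (f p.1, f p.2)) ?_ ?_
  · intro p hp
    simp only [mem_product, coe_filter, Set.mem_ofPred_eq] at hp ⊢
    exact ⟨⟨hf _ hp.1.1, hf _ hp.1.2⟩, h _ hp.1.1 _ hp.1.2 hp.2⟩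
  · intro p hp q hq h
    simp only [mem_product, coe_filter, Set.mem_ofPred_eq, Prod.mk.injEq] at hp hq h
    exact Prod.ext (hinj hp.1.1 hq.1.1 h.1) (hinj hp.1.2 hq.1.2 h.2)

end Counting

section Fourier

variable {ι κ β : Type*} {k : ℕ}

lemma addChar_map_sum {A M : Type*} [AddCommMonoid A] [CommMonoid M] (ψ : AddChar A M)
    (s : Finset ι) (f : ι → A) : ψ (∑ i ∈ s, f i) = ∏ i ∈ s, ψ (f i) := by
  classical
  induction s using Finset.induction_on with
  | empty => simp
  | insert a s ha ih => rw [sum_insert ha, prod_insert ha, AddChar.map_add_eq_mul, ih]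

/-- The character `α ↦ e(α · v / Q)` sampled on `(ℤ/Q)^k`. -/
noncomputable def torusChar (Q : ℕ) [NeZero Q] (α : Fin k → ZMod Q) (v : Fin k → ℤ) : ℂ :=
  ZMod.stdAddChar (∑ j, α j * (v j : ZMod Q))

variable (Q : ℕ) [NeZero Q]

lemma torusChar_add (α : Fin k → ZMod Q) (v w : Fin k → ℤ) :
    torusChar Q α (v + w) = torusChar Q α v * torusChar Q α w := by
  simp [torusChar, ← AddChar.map_add_eq_mul, ← sum_add_distrib, mul_add]

lemma torusChar_zero (α : Fin k → ZMod Q) : torusChar Q α 0 = 1 := by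
  simp [torusChar]

lemma torusChar_sum (α : Fin k → ZMod Q) (s : Finset ι) (v : ι → Fin k → ℤ) :
    torusChar Q α (∑ i ∈ s, v i) = ∏ i ∈ s, torusChar Q α (v i) := by
  classical
  induction s using Finset.induction_on with
  | empty => simp [torusChar_zero]
  | insert a s ha ih => rw [sum_insert ha, prod_insert ha, torusChar_add, ih]

lemma torusChar_neg (α : Fin k → ZMod Q) (v : Fin k → ℤ) :
    torusChar Q α (-v) = (starRingEnd ℂ) (torusChar Q α v) := by
  simp [torusChar, ← AddChar.map_neg_eq_conj]

lemma sum_torusChar (v : Fin k → ℤ) :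
    ∑ α, torusChar Q α v = if ∀ j, (Q : ℤ) ∣ v j then (Q : ℂ) ^ k else 0 := by
  classical
  have h1 : ∑ α : Fin k → ZMod Q, torusChar Q α v
      = ∏ j : Fin k, ∑ a : ZMod Q, (ZMod.stdAddChar (a * (v j : ZMod Q)) : ℂ) := by
    rw [Finset.prod_univ_sum, Fintype.piFinset_univ]
    refine sum_congr rfl fun α _ => ?_
    exact addChar_map_sum _ _ _
  rw [h1]
  simp only [AddChar.sum_mulShift _ (ZMod.isPrimitive_stdAddChar Q), ZMod.card,
    ZMod.intCast_zmod_eq_zero_iff_dvd]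
  split_ifs with h
  · simp [h]
  · push Not at h
    obtain ⟨j, hj⟩ := h
    exact prod_eq_zero (mem_univ j) (by simp [hj])

lemma sum_norm_sq_torusChar (s : Finset ι) (v : ι → Fin k → ℤ)
    (hQ : ∀ i ∈ s, ∀ i' ∈ s, (∀ j, (Q : ℤ) ∣ v i j - v i' j) → v i = v i') :
    ∑ α, ‖∑ i ∈ s, torusChar Q α (v i)‖ ^ 2 = (Q : ℝ) ^ k * energy s v := by
  classical
  have h : ∀ α : Fin k → ZMod Q, ((‖∑ i ∈ s, torusChar Q α (v i)‖ ^ 2 : ℝ) : ℂ)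
      = ∑ p ∈ s ×ˢ s, torusChar Q α (v p.1 - v p.2) := by
    intro α
    rw [Complex.ofReal_pow, ← Complex.mul_conj', map_sum, sum_mul_sum, ← sum_product']
    refine sum_congr rfl fun p _ => ?_
    rw [sub_eq_add_neg, torusChar_add, torusChar_neg]
  apply Complex.ofReal_injective
  push_cast at h ⊢
  simp_rw [h]
  rw [sum_comm]
  simp_rw [sum_torusChar]
  rw [energy, card_filter, Nat.cast_sum, mul_sum]
  refine sum_congr rfl fun p hp => ?_
  rw [mem_product] at hp
  by_cases hv : v p.1 = v p.2
  · simp [hv]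
  · rw [if_neg, if_neg hv]
    · simp
    · exact fun h => hv (hQ _ hp.1 _ hp.2 (by simpa using h))

lemma exists_modulus (s : Finset ι) (v : ι → Fin k → ℤ) :
    ∃ Q : ℕ, Q ≠ 0 ∧ ∀ i ∈ s, ∀ i' ∈ s, (∀ j, (Q : ℤ) ∣ v i j - v i' j) → v i = v i' := by
  refine ⟨1 + ∑ i ∈ s, ∑ i' ∈ s, ∑ j, (v i j - v i' j).natAbs, by omega, ?_⟩
  intro i hi i' hi' h
  ext j
  have h1 : (v i j - v i' j).natAbs ≤ ∑ i ∈ s, ∑ i' ∈ s, ∑ j, (v i j - v i' j).natAbs :=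
    calc (v i j - v i' j).natAbs ≤ ∑ j, (v i j - v i' j).natAbs :=
          single_le_sum (f := fun j => (v i j - v i' j).natAbs) (fun _ _ => Nat.zero_le _)
            (mem_univ j)
      _ ≤ ∑ i' ∈ s, ∑ j, (v i j - v i' j).natAbs :=
          single_le_sum (f := fun i' => ∑ j, (v i j - v i' j).natAbs)
            (fun _ _ => Nat.zero_le _) hi'
      _ ≤ _ := single_le_sum (f := fun i => ∑ i' ∈ s, ∑ j, (v i j - v i' j).natAbs)
            (fun _ _ => Nat.zero_le _) hi
  have h2 := Int.eq_zero_of_dvd_of_natAbs_lt_natAbs (h j) (by rw [Int.natAbs_natCast]; omega)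
  omega

/-- The number of solutions of `d x + ∑ u (a i) = d y + ∑ u (b i)` with `x, y ∈ D` and
`a i, b i ∈ I` for `i < m`. -/
def solutions (m : ℕ) (D : Finset ι) (d : ι → Fin k → ℤ) (I : Finset κ) (u : κ → Fin k → ℤ) : ℕ :=
  energy (D ×ˢ Fintype.piFinset (fun _ : Fin m => I)) (fun q => d q.1 + ∑ i, u (q.2 i))

lemma sum_torusChar_prod (m : ℕ) (D : Finset ι) (d : ι → Fin k → ℤ) (I : Finset κ)
    (u : κ → Fin k → ℤ) (α : Fin k → ZMod Q) :
    ∑ q ∈ D ×ˢ Fintype.piFinset (fun _ : Fin m => I), torusChar Q α (d q.1 + ∑ i, u (q.2 i))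
      = (∑ x ∈ D, torusChar Q α (d x)) * (∑ x ∈ I, torusChar Q α (u x)) ^ m := by
  rw [Finset.sum_pow', sum_mul_sum, ← sum_product']
  simp [torusChar_add, torusChar_sum]

lemma solutions_holder [DecidableEq β] (m : ℕ) (D : Finset ι) (d : ι → Fin k → ℤ) (I : Finset κ)
    (u : κ → Fin k → ℤ) (A : Finset β) (f : κ → β) (hf : ∀ x ∈ I, f x ∈ A) (hm : m ≠ 0) (B : ℕ)
    (hB : ∀ a ∈ A, solutions m D d {x ∈ I | f x = a} u ≤ B) :
    solutions m D d I u ≤ #A ^ (2 * m) * B := by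
  classical
  obtain ⟨Q, hQ0, hQ⟩ := exists_modulus (D ×ˢ Fintype.piFinset (fun _ : Fin m => I))
    (fun q => d q.1 + ∑ i, u (q.2 i))
  have : NeZero Q := ⟨hQ0⟩
  have key := sum_norm_sq_torusChar Q _ _ hQ
  have keyA : ∀ a ∈ A, _ := fun a _ => sum_norm_sq_torusChar Q
    (D ×ˢ Fintype.piFinset (fun _ : Fin m => {x ∈ I | f x = a}))
    (fun q => d q.1 + ∑ i, u (q.2 i)) (by
      have hsub : (D ×ˢ Fintype.piFinset (fun _ : Fin m => {x ∈ I | f x = a})) ⊆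
        (D ×ˢ Fintype.piFinset (fun _ : Fin m => I)) :=
        product_subset_product_right (Fintype.piFinset_subset _ _ fun _ => filter_subset _ _)
      exact fun i hi i' hi' => hQ i (hsub hi) i' (hsub hi'))
  simp_rw [sum_torusChar_prod, norm_mul, mul_pow, norm_pow] at key keyA
  have hQpos : (0 : ℝ) < (Q : ℝ) ^ k := by positivity
  have hmain : (Q : ℝ) ^ k * solutions m D d I u
      ≤ (Q : ℝ) ^ k * ((#A : ℝ) ^ (2 * m - 1) * ∑ a ∈ A, (solutions m D d {x ∈ I | f x = a} u : ℝ)) := by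
    unfold solutions
    rw [← key, mul_left_comm, mul_sum]
    rw [← sum_congr rfl keyA, sum_comm, mul_sum]
    refine sum_le_sum fun α _ => ?_
    rw [← mul_sum, mul_left_comm]
    gcongr
    simp_rw [← pow_mul]
    rw [mul_comm m 2]
    have h1 : ‖∑ x ∈ I, torusChar Q α (u x)‖
        ≤ ∑ a ∈ A, ‖∑ x ∈ I with f x = a, torusChar Q α (u x)‖ := by
      rw [← sum_fiberwise_of_maps_to hf]
      exact norm_sum_le _ _
    have h3 : (∑ a ∈ A, ‖∑ x ∈ I with f x = a, torusChar Q α (u x)‖) ^ (2 * m - 1 + 1)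
      ≤ (#A : ℝ) ^ (2 * m - 1) *
        ∑ a ∈ A, ‖∑ x ∈ I with f x = a, torusChar Q α (u x)‖ ^ (2 * m - 1 + 1) := by
      rcases A.eq_empty_or_nonempty with rfl | hA
      · simp
      have := pow_sum_div_card_le_sum_pow (s := A)
        (f := fun a => ‖∑ x ∈ I with f x = a, torusChar Q α (u x)‖)
        (fun _ _ => norm_nonneg _) (2 * m - 1)
      rw [div_le_iff₀ (by have := hA.card_pos; positivity)] at this
      exact this.trans_eq (mul_comm _ _)
    rw [show 2 * m - 1 + 1 = 2 * m by omega] at h3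
    exact (pow_le_pow_left₀ (norm_nonneg _) h1 _).trans h3
  have h5 := le_of_mul_le_mul_left hmain hQpos
  have h6 : ∑ a ∈ A, (solutions m D d {x ∈ I | f x = a} u : ℝ) ≤ #A * B := by
    simpa using sum_le_card_nsmul A _ (B : ℝ) (fun a ha => by exact_mod_cast hB a ha)
  have h7 : (solutions m D d I u : ℝ) ≤ (#A : ℝ) ^ (2 * m - 1) * (#A * B) := h5.trans (by gcongr)
  rw [← mul_assoc, ← pow_succ, show 2 * m - 1 + 1 = 2 * m by omega] at h7
  exact_mod_cast h7

end Fourier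

end VinogradovKorobov

namespace VinogradovKorobov

open Finset

section Linnik

lemma aeval_esymm_eq_of_psum_eq {R : Type*} [CommRing R] {k : ℕ} (X Y : Fin k → R)
    (hu : ∀ j : ℕ, 1 ≤ j → j ≤ k → IsUnit (j : R))
    (h : ∀ j : ℕ, 1 ≤ j → j ≤ k → ∑ i, X i ^ j = ∑ i, Y i ^ j) (j : ℕ) (hj : j ≤ k) :
    MvPolynomial.aeval X (MvPolynomial.esymm (Fin k) R j)
      = MvPolynomial.aeval Y (MvPolynomial.esymm (Fin k) R j) := by
  induction j using Nat.strong_induction_on with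
  | _ j ih =>
    rcases Nat.eq_zero_or_pos j with rfl | hj0
    · simp
    have hN := MvPolynomial.mul_esymm_eq_sum (Fin k) R j
    have hX := congrArg (MvPolynomial.aeval X) hN
    have hY := congrArg (MvPolynomial.aeval Y) hN
    simp only [map_mul, map_sum, map_pow, map_neg, map_one, map_natCast] at hX hY
    refine (hu j hj0 hj).mul_left_cancel ?_
    rw [hX, hY]
    congr 1
    refine sum_congr rfl fun a ha => ?_
    rw [mem_filter, HasAntidiagonal.mem_antidiagonal] at ha
    rw [ih a.1 ha.2 (by omega)]
    congr 1
    simp only [MvPolynomial.psum, map_sum, map_pow, MvPolynomial.aeval_X]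
    exact h a.2 (by omega) (by omega)

lemma prod_sub_eq_of_psum_eq {R : Type*} [CommRing R] {k : ℕ} (X Y : Fin k → R)
    (hu : ∀ j : ℕ, 1 ≤ j → j ≤ k → IsUnit (j : R))
    (h : ∀ j : ℕ, 1 ≤ j → j ≤ k → ∑ i, X i ^ j = ∑ i, Y i ^ j) (r : R) :
    ∏ i, (r - X i) = ∏ i, (r - Y i) := by
  have key : ∀ Z : Fin k → R, ∏ i, (r - Z i) = ∑ j ∈ range (k + 1),
      (-1) ^ j * (MvPolynomial.aeval Z (MvPolynomial.esymm (Fin k) R j) * r ^ (k - j)) := by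
    intro Z
    have := congrArg (Polynomial.eval r)
      (Multiset.prod_X_sub_X_eq_sum_esymm (Multiset.map Z univ.val))
    simp only [Multiset.map_map, Function.comp_def, Multiset.card_map, card_val, card_univ,
      Fintype.card_fin, ← MvPolynomial.aeval_esymm_eq_multiset_esymm (Fin k) R] at this
    rw [Polynomial.eval_finsetSum] at this
    have h2 : (Multiset.map (fun x => Polynomial.X - Polynomial.C (Z x)) univ.val).prod
      = ∏ i, (Polynomial.X - Polynomial.C (Z i)) := rfl
    rw [h2, Polynomial.eval_prod] at this
    simpa using this
  rw [key X, key Y]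
  refine sum_congr rfl fun j hj => ?_
  rw [aeval_esymm_eq_of_psum_eq X Y hu h j (by simpa [Nat.lt_succ_iff] using hj)]

variable {p k n : ℕ}

lemma exists_perm_of_psum_congr (hp : p.Prime) (hk : k < p) (hn : n ≠ 0) (x y : Fin k → ℤ)
    (hx : ∀ i j, (p : ℤ) ∣ x i - x j → i = j) (hy : ∀ i j, (p : ℤ) ∣ y i - y j → i = j)
    (h : ∀ j : ℕ, 1 ≤ j → j ≤ k → ((p : ℤ) ^ n) ∣ ∑ i, x i ^ j - ∑ i, y i ^ j) :
    ∃ σ : Equiv.Perm (Fin k), ∀ i, ((p : ℤ) ^ n) ∣ x i - y (σ i) := by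
  have hpZ : Prime (p : ℤ) := Nat.prime_iff_prime_int.1 hp
  have hprod : ∀ i, ((p : ℤ) ^ n) ∣ ∏ j, (x i - y j) := by
    intro i
    have h1 := prod_sub_eq_of_psum_eq (R := ZMod (p ^ n)) (fun i => (x i : ZMod (p ^ n)))
      (fun i => (y i : ZMod (p ^ n))) (fun j hj hjk => by
        rw [ZMod.isUnit_iff_coprime]
        exact Nat.Coprime.pow_right _
          (Nat.coprime_of_lt_prime (by omega) (by omega) hp).symm)
      (fun j hj hjk => by
        have := (ZMod.intCast_zmod_eq_zero_iff_dvd _ (p ^ n)).2 (by exact_mod_cast h j hj hjk)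
        push_cast at this
        exact sub_eq_zero.1 this) (x i : ZMod (p ^ n))
    rw [prod_eq_zero (mem_univ i) (sub_self _)] at h1
    have := (ZMod.intCast_zmod_eq_zero_iff_dvd (∏ j, (x i - y j)) (p ^ n)).1 (by
      push_cast; exact h1.symm)
    exact_mod_cast this
  have hex : ∀ i, ∃ j, ((p : ℤ) ^ n) ∣ x i - y j := by
    intro i
    have h1 : (p : ℤ) ∣ ∏ j, (x i - y j) := (dvd_pow_self _ hn).trans (hprod i)
    obtain ⟨j, -, hj⟩ := (hpZ.dvd_finsetProd_iff _).1 h1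
    refine ⟨j, ?_⟩
    have h2 := hprod i
    rw [← mul_prod_erase univ _ (mem_univ j)] at h2
    refine (IsCoprime.pow_left ?_).dvd_of_dvd_mul_right h2
    refine IsCoprime.prod_right fun l hl => ?_
    refine (hpZ.coprime_iff_not_dvd).2 fun hd => ?_
    have := hy l j (by have := dvd_sub hj hd; simpa using this)
    exact (mem_erase.1 hl).1 this
  choose σ hσ using hex
  have hinj : Function.Injective σ := fun i i' hii => hx i i' (by
    have h1 := hσ i
    have h2 := hσ i'
    rw [hii] at h1
    have := (dvd_pow_self (p : ℤ) hn).trans (dvd_sub h1 h2)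
    simpa using this)
  exact ⟨Equiv.ofBijective σ (Finite.injective_iff_bijective.1 hinj), hσ⟩

lemma card_lift_le (hp : p.Prime) {j : ℕ} (hj : j ≤ n) (M : ℤ) :
    #{w ∈ Ico (0 : ℤ) (p ^ n) | (p : ℤ) ^ j ∣ w - M} ≤ p ^ (n - j) := by
  have hp0 : (0 : ℤ) < p := by exact_mod_cast hp.pos
  have hpj : (0 : ℤ) < (p : ℤ) ^ j := by positivity
  have : #(Ico (0 : ℤ) ((p : ℤ) ^ (n - j))) = p ^ (n - j) := by
    rw [Int.card_Ico, sub_zero]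
    exact_mod_cast Int.toNat_natCast (p ^ (n - j))
  rw [← this]
  refine card_le_card_of_injOn (fun w => w / (p : ℤ) ^ j) ?_ ?_
  · intro w hw
    simp only [coe_filter, mem_Ico, Set.mem_ofPred_eq, coe_Ico, Set.mem_Ico] at hw ⊢
    refine ⟨Int.ediv_nonneg hw.1.1 hpj.le, ?_⟩
    rw [Int.ediv_lt_iff_lt_mul hpj, ← pow_add, Nat.sub_add_cancel hj]
    exact hw.1.2
  · intro w hw w' hw' h
    simp only [coe_filter, mem_Ico, Set.mem_ofPred_eq] at hw hw'
    have h1 : (p : ℤ) ^ j ∣ w - w' := by have := dvd_sub hw.2 hw'.2; simpa using this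
    have h2 : w % (p : ℤ) ^ j = w' % (p : ℤ) ^ j := 
      Int.emod_eq_emod_iff_emod_sub_eq_zero.2 (Int.emod_eq_zero_of_dvd h1)
    rw [← Int.mul_ediv_add_emod w ((p : ℤ) ^ j), ← Int.mul_ediv_add_emod w' ((p : ℤ) ^ j), h2]
    simp only at h
    rw [h]

/-- Linnik's lemma: the number of solutions, distinct modulo `p`, of the congruences
`∑ x i ^ j ≡ M j (mod p ^ j)` for `1 ≤ j ≤ k`. -/
lemma linnik (hp : p.Prime) (hk : k < p) (hk0 : k ≠ 0) (D : Finset (Fin k → ℤ)) (M : Fin k → ℤ)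
    (hD : ∀ x ∈ D, ∀ i j, (p : ℤ) ∣ x i - x j → i = j)
    (hinj : ∀ x ∈ D, ∀ y ∈ D, (∀ i, (p : ℤ) ^ k ∣ x i - y i) → x = y)
    (hM : ∀ x ∈ D, ∀ j : Fin k, (p : ℤ) ^ (j + 1 : ℕ) ∣ ∑ i, x i ^ (j + 1 : ℕ) - M j) :
    #D ≤ k.factorial * p ^ (k * (k - 1) / 2) := by
  classical
  have hp0 : (0 : ℤ) < p := by exact_mod_cast hp.pos
  set g : (Fin k → ℤ) → (Fin k → ℤ) := fun x j => (∑ i, x i ^ (j + 1 : ℕ)) % (p : ℤ) ^ k with hg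
  set T : Finset (Fin k → ℤ) := Fintype.piFinset fun j : Fin k =>
    {w ∈ Ico (0 : ℤ) (p ^ k) | (p : ℤ) ^ (j + 1 : ℕ) ∣ w - M j}
  have hT : #T ≤ p ^ (k * (k - 1) / 2) := by
    rw [Fintype.card_piFinset]
    refine (prod_le_prod' (g := fun j : Fin k => p ^ (k - (j + 1 : ℕ)))
      fun (j : Fin k) _ => card_lift_le hp (by omega) (M j)).trans ?_
    rw [prod_pow_eq_pow_sum, Fin.sum_univ_eq_sum_range (fun j => k - (j + 1)) k,
      ← sum_range_reflect, ← sum_range_id]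
    refine le_of_eq (congrArg _ (sum_congr rfl fun j hj => ?_))
    rw [mem_range] at hj
    omega
  have hmaps : ∀ x ∈ D, g x ∈ T := by
    intro x hx
    rw [Fintype.mem_piFinset]
    intro j
    rw [mem_filter, mem_Ico]
    refine ⟨⟨Int.emod_nonneg _ (by positivity), Int.emod_lt_of_pos _ (by positivity)⟩, ?_⟩
    have h1 : (p : ℤ) ^ (j + 1 : ℕ) ∣ (∑ i, x i ^ (j + 1 : ℕ)) % (p : ℤ) ^ k
        - ∑ i, x i ^ (j + 1 : ℕ) := by
      refine (pow_dvd_pow (p : ℤ) (by omega : (j + 1 : ℕ) ≤ k)).trans ?_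
      rw [← dvd_neg, neg_sub]
      exact Int.dvd_self_sub_emod
    have := dvd_add h1 (hM x hx j)
    simpa using this
  have hfib : ∀ w ∈ T, #{x ∈ D | g x = w} ≤ k.factorial := by
    intro w _
    rcases ({x ∈ D | g x = w}).eq_empty_or_nonempty with h0 | ⟨y, hy⟩
    · rw [h0]; simp
    rw [mem_filter] at hy
    have hσ : ∀ x ∈ ({x ∈ D | g x = w} : Finset _), ∃ σ : Equiv.Perm (Fin k),
        ∀ i, ((p : ℤ) ^ k) ∣ x i - y (σ i) := by
      intro x hx
      rw [mem_filter] at hx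
      refine exists_perm_of_psum_congr hp hk hk0 x y (hD x hx.1) (hD y hy.1) fun j hj hjk => ?_
      have := congrFun (hx.2.trans hy.2.symm) ⟨j - 1, by omega⟩
      simp only [hg, Nat.sub_add_cancel hj] at this
      exact Int.ModEq.dvd (Eq.symm this)
    choose! σ hσ using hσ
    rw [show k.factorial = #(univ : Finset (Equiv.Perm (Fin k))) by
      rw [card_univ, Fintype.card_perm, Fintype.card_fin]]
    refine card_le_card_of_injOn σ (fun _ _ => mem_coe.2 (mem_univ _)) fun x hx x' hx' h => ?_
    have hxD := (mem_filter.1 (mem_coe.1 hx)).1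
    have hxD' := (mem_filter.1 (mem_coe.1 hx')).1
    refine hinj x hxD x' hxD' fun i => ?_
    have h1 := hσ x hx i
    have h2 := hσ x' hx' i
    rw [h] at h1
    have := dvd_sub h1 h2
    simpa using this
  calc #D ≤ k.factorial * #T := card_le_mul_card_image_of_maps_to hmaps _ hfib
    _ ≤ _ := by gcongr

end Linnik

end VinogradovKorobov

namespace VinogradovKorobov

open Finset

section MeanValue

/-- The vector `(x, x², …, x^k)`. -/
def powVec (k : ℕ) (x : ℤ) : Fin k → ℤ := fun j => x ^ (j + 1 : ℕ)

/-- The number of solutions of the Vinogradov system of degree `k` in `2 s` variables from `I`. -/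
def vmv (s k : ℕ) (I : Finset ℤ) : ℕ :=
  energy (Fintype.piFinset fun _ : Fin s => I) (fun x => ∑ i, powVec k (x i))

variable {k m s p : ℕ}

lemma sum_powVec_eq_iff {τ : Type*} [Fintype τ] (x y : τ → ℤ) :
    ∑ i, powVec k (x i) = ∑ i, powVec k (y i) ↔ ∀ j ≤ k, ∑ i, x i ^ j = ∑ i, y i ^ j := by
  constructor
  · intro h j hj
    rcases Nat.eq_zero_or_pos j with rfl | hj0
    · simp
    have := congrFun h ⟨j - 1, by omega⟩
    simpa [powVec, Finset.sum_apply, Nat.sub_add_cancel hj0] using this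
  · intro h
    ext j
    simpa [powVec, Finset.sum_apply] using h (j + 1) (by omega)

lemma psum_translate {τ : Type*} [Fintype τ] (x y : τ → ℤ) (c : ℤ)
    (h : ∀ j ≤ k, ∑ i, x i ^ j = ∑ i, y i ^ j) :
    ∀ j ≤ k, ∑ i, (x i + c) ^ j = ∑ i, (y i + c) ^ j := by
  intro j hj
  simp_rw [add_pow]
  rw [sum_comm, sum_comm (s := univ (α := τ))]
  refine sum_congr rfl fun l hl => ?_
  rw [mem_range] at hl
  simp_rw [← sum_mul]
  rw [h l (by omega)]

lemma vmv_le_of_affine (I J : Finset ℤ) (f : ℤ → ℤ) (b q : ℤ) (hq : q ≠ 0)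
    (hf : ∀ x ∈ I, f x ∈ J) (hx : ∀ x ∈ I, x = q * f x + b) : vmv s k I ≤ vmv s k J := by
  refine energy_equiv _ _ _ _ (fun x i => f (x i)) ?_ ?_ ?_
  · intro x h
    rw [Fintype.mem_piFinset] at h ⊢
    exact fun i => hf _ (h i)
  · intro x h y h' hxy
    rw [mem_coe, Fintype.mem_piFinset] at h h'
    ext i
    rw [hx _ (h i), hx _ (h' i), show f (x i) = f (y i) from congrFun hxy i]
  · intro x h y h' hxy
    rw [Fintype.mem_piFinset] at h h'
    rw [sum_powVec_eq_iff] at hxy ⊢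
    have := psum_translate x y (-b) hxy
    intro j hj
    have h1 := this j hj
    have h2 : ∀ z : Fin s → ℤ, (∀ i, z i ∈ I) →
        ∑ i, (z i + -b) ^ j = q ^ j * ∑ i, f (z i) ^ j := by
      intro z hz
      rw [mul_sum]
      refine sum_congr rfl fun i _ => ?_
      rw [← mul_pow]
      congr 1
      have := hx _ (hz i)
      linarith
    rw [h2 x h, h2 y h'] at h1
    exact mul_left_cancel₀ (pow_ne_zero _ hq) h1

lemma vmv_eq_solutions (I : Finset ℤ) :
    vmv s k I = solutions s {()} (fun _ => 0) I (powVec k) := by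
  apply le_antisymm
  · refine energy_equiv _ _ _ _ (fun x => ((), x)) ?_ ?_ ?_
    · intro x hx
      simpa using hx
    · intro x _ y _ h
      simpa using h
    · intro x _ y _ h
      simpa using h
  · refine energy_equiv _ _ _ _ (fun x => x.2) ?_ ?_ ?_
    · intro x hx
      simpa using hx
    · intro x _ y _ h
      exact Prod.ext rfl h
    · intro x _ y _ h
      simpa using h

lemma solutions_le {ι : Type*} (D : Finset ι) (d : ι → Fin k → ℤ) (I : Finset ℤ)
    (R : Finset (ι × ι))
    (hR : ∀ x ∈ D, ∀ y ∈ D, ∀ u ∈ Fintype.piFinset (fun _ : Fin m => I),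
      ∀ w ∈ Fintype.piFinset (fun _ : Fin m => I),
      d x + ∑ i, powVec k (u i) = d y + ∑ i, powVec k (w i) → (x, y) ∈ R) :
    solutions m D d I (powVec k) ≤ #R * vmv m k I :=
  energy_prod_le D (Fintype.piFinset fun _ : Fin m => I) d
    (fun u : Fin m → ℤ => ∑ i, powVec k (u i)) R hR

lemma exists_complement (σ : Fin k ↪ Fin (m + k)) :
    ∃ e : Fin k ⊕ Fin m ≃ Fin (m + k), ∀ i, e (Sum.inl i) = σ i := by
  classical
  have h1 : Fintype.card ↥(Set.range σ)ᶜ = m := by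
    rw [Fintype.card_compl_set, Fintype.card_fin, Set.card_range_of_injective σ.injective,
      Fintype.card_fin]
    omega
  refine ⟨(Equiv.sumCongr (Equiv.ofInjective σ σ.injective)
    (Fintype.equivFinOfCardEq h1).symm).trans (Equiv.Set.sumCompl _), fun i => ?_⟩
  simp

lemma energy_split (σ : Fin k ↪ Fin (m + k)) (I : Finset ℤ) (D : Finset (Fin k → ℤ))
    (S : Finset (Fin (m + k) → ℤ)) (hS : ∀ x ∈ S, (∀ i, x i ∈ I) ∧ (fun i => x (σ i)) ∈ D) :
    energy S (fun x => ∑ i, powVec k (x i))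
      ≤ solutions m D (fun x => ∑ i, powVec k (x i)) I (powVec k) := by
  obtain ⟨e, he⟩ := exists_complement σ
  have hsum : ∀ x : Fin (m + k) → ℤ, ∑ i, powVec k (x i)
      = ∑ i, powVec k (x (σ i)) + ∑ i, powVec k (x (e (Sum.inr i))) := by
    intro x
    rw [← e.sum_comp, Fintype.sum_sum_type]
    simp [he]
  refine energy_equiv _ _ _ _ (fun x => (fun i => x (σ i), fun i => x (e (Sum.inr i)))) ?_ ?_ ?_
  · intro x hx
    rw [mem_product, Fintype.mem_piFinset]
    exact ⟨(hS x hx).2, fun i => (hS x hx).1 _⟩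
  · intro x _ y _ h
    simp only [Prod.mk.injEq] at h
    ext i
    obtain ⟨j, rfl⟩ := e.surjective i
    rcases j with j | j
    · rw [he]; exact congrFun h.1 j
    · exact congrFun h.2 j
  · intro x _ y _ h
    simp only at h ⊢
    rw [← hsum, ← hsum, h]

/-- Tuples from `I` whose entries are pairwise incongruent modulo `p`. -/
def distinctTuples (p k : ℕ) (I : Finset ℤ) : Finset (Fin k → ℤ) :=
  {x ∈ Fintype.piFinset (fun _ : Fin k => I) | ∀ i j, (p : ℤ) ∣ x i - x j → i = j}

lemma vmv_residue_le (hp : p ≠ 0) {X X' : ℕ} (hX : X ≤ p * X') (a : ℤ) :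
    vmv s k {x ∈ Icc (1 : ℤ) X | (x - 1) % p = a} ≤ vmv s k (Icc (1 : ℤ) X') := by
  have hp0 : (0 : ℤ) < p := by positivity
  refine vmv_le_of_affine _ _ (fun x => (x - 1) / p + 1) (a + 1 - p) p hp0.ne' ?_ ?_
  · intro x hx
    rw [mem_filter, mem_Icc] at hx
    rw [mem_Icc]
    have h1 : 0 ≤ (x - 1) / (p : ℤ) := Int.ediv_nonneg (by omega) hp0.le
    have h2 : (x - 1) / (p : ℤ) < X' := by
      rw [Int.ediv_lt_iff_lt_mul hp0]
      have : (X : ℤ) ≤ p * X' := by exact_mod_cast hX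
      linarith
    omega
  · intro x hx
    rw [mem_filter] at hx
    have := Int.mul_ediv_add_emod (x - 1) p
    rw [hx.2] at this
    linarith

lemma solutions_distinct_le (hp : p.Prime) (hk : k < p) (hk0 : k ≠ 0) {X X' : ℕ}
    (hX : X ≤ p * X') (hXp : X ≤ p ^ k) (a : ℤ) :
    solutions m (distinctTuples p k (Icc (1 : ℤ) X)) (fun x => ∑ i, powVec k (x i))
      {x ∈ Icc (1 : ℤ) X | (x - 1) % p = a} (powVec k)
    ≤ X ^ k * (k.factorial * p ^ (k * (k - 1) / 2)) * vmv m k (Icc (1 : ℤ) X') := by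
  classical
  set D := distinctTuples p k (Icc (1 : ℤ) X) with hD
  set R := {q ∈ D ×ˢ D | ∀ j : Fin k, (p : ℤ) ^ (j + 1 : ℕ) ∣
    ∑ i, (q.1 i + -(a + 1)) ^ (j + 1 : ℕ) - ∑ i, (q.2 i + -(a + 1)) ^ (j + 1 : ℕ)} with hR
  have hRcard : #R ≤ X ^ k * (k.factorial * p ^ (k * (k - 1) / 2)) := by
    have h1 : ∀ q ∈ R, q.2 ∈ D := fun q hq => by
      rw [hR, mem_filter, mem_product] at hq
      exact hq.1.2
    have h2 : ∀ y ∈ D, #{q ∈ R | q.2 = y} ≤ k.factorial * p ^ (k * (k - 1) / 2) := by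
      intro y hy
      set F : Finset (Fin k → ℤ) := ({q ∈ R | q.2 = y}).image
        (fun q i => q.1 i + -(a + 1)) with hF
      have hcard : #F = #{q ∈ R | q.2 = y} := by
        refine card_image_of_injOn fun q hq q' hq' h => ?_
        rw [mem_coe, mem_filter] at hq hq'
        refine Prod.ext ?_ (hq.2.trans hq'.2.symm)
        ext i
        simpa using congrFun h i
      rw [← hcard]
      have hFD : ∀ z ∈ F, ∃ x ∈ D, (∀ i, z i = x i + -(a + 1)) ∧ (x, y) ∈ R := by
        intro z hz
        rw [hF, mem_image] at hz
        obtain ⟨q, hq, rfl⟩ := hz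
        rw [mem_filter] at hq
        have hq1 := hq.1
        rw [hR, mem_filter, mem_product] at hq1
        refine ⟨q.1, hq1.1.1, fun _ => rfl, ?_⟩
        rw [← hq.2]
        exact hq.1
      refine linnik hp hk hk0 F (fun j => ∑ i, (y i + -(a + 1)) ^ (j + 1 : ℕ)) ?_ ?_ ?_
      · intro z hz i j hij
        obtain ⟨x, hx, hzx, -⟩ := hFD z hz
        rw [hzx, hzx] at hij
        rw [hD, distinctTuples, mem_filter] at hx
        exact hx.2 i j (by simpa using hij)
      · intro z hz z' hz' h
        obtain ⟨x, hx, hzx, -⟩ := hFD z hz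
        obtain ⟨x', hx', hzx', -⟩ := hFD z' hz'
        ext i
        have h3 := h i
        rw [hzx, hzx'] at h3
        rw [hD, distinctTuples, mem_filter, Fintype.mem_piFinset] at hx hx'
        have h4 := mem_Icc.1 (hx.1 i)
        have h5 := mem_Icc.1 (hx'.1 i)
        have h6 : x i - x' i = 0 := by
          refine Int.eq_zero_of_abs_lt_dvd (m := (p : ℤ) ^ k) (by simpa using h3) ?_
          have : (X : ℤ) ≤ (p : ℤ) ^ k := by exact_mod_cast hXp
          rw [abs_lt]
          constructor <;> linarith
        rw [hzx, hzx']
        linarith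
      · intro z hz j
        obtain ⟨x, hx, hzx, hxy⟩ := hFD z hz
        rw [hR, mem_filter] at hxy
        simp_rw [hzx]
        exact hxy.2 j
    have h3 := card_le_mul_card_image_of_maps_to h1 _ h2
    have h4 : #D ≤ X ^ k := by
      refine (card_filter_le _ _).trans ?_
      simp
    rw [mul_comm]
    exact h3.trans (by gcongr)
  calc _ ≤ #R * vmv m k {x ∈ Icc (1 : ℤ) X | (x - 1) % p = a} := by
        refine solutions_le _ _ _ R ?_
        intro x hx y hy u hu w hw h
        rw [hR, mem_filter, mem_product]
        refine ⟨⟨hx, hy⟩, fun j => ?_⟩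
        have h1 : ∑ i, powVec k (Sum.elim x u i) = ∑ i, powVec k (Sum.elim y w i) := by
          simpa [Fintype.sum_sum_type] using h
        rw [sum_powVec_eq_iff] at h1
        have h2 := psum_translate _ _ (-(a + 1)) h1 (j + 1) (by omega)
        simp only [Fintype.sum_sum_type, Sum.elim_inl, Sum.elim_inr] at h2
        have h3 : ∀ u ∈ (Fintype.piFinset fun _ : Fin m => {x ∈ Icc (1 : ℤ) X | (x - 1) % p = a}),
            (p : ℤ) ^ (j + 1 : ℕ) ∣ ∑ i, (u i + -(a + 1)) ^ (j + 1 : ℕ) := by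
          intro u hu
          rw [Fintype.mem_piFinset] at hu
          refine dvd_sum fun i _ => pow_dvd_pow_of_dvd ?_ _
          have := (mem_filter.1 (hu i)).2
          rw [show u i + -(a + 1) = (u i - 1) - a by ring, ← this]
          exact Int.dvd_self_sub_emod
        have h4 := dvd_sub (h3 w hw) (h3 u hu)
        have h5 : ∑ i, (x i + -(a + 1)) ^ (j + 1 : ℕ) - ∑ i, (y i + -(a + 1)) ^ (j + 1 : ℕ)
            = ∑ i, (w i + -(a + 1)) ^ (j + 1 : ℕ) - ∑ i, (u i + -(a + 1)) ^ (j + 1 : ℕ) := by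
          linarith
        exact h5 ▸ h4
    _ ≤ _ := Nat.mul_le_mul hRcard (vmv_residue_le hp.ne_zero hX a)

lemma exists_distinct_or_subset (hp : 0 < p) (hkp : k ≤ p) (x : Fin s → ℤ) :
    (∃ σ : Fin k ↪ Fin s, ∀ i j, (p : ℤ) ∣ x (σ i) - x (σ j) → i = j) ∨
    ∃ c ∈ powersetCard (k - 1) (Ico (0 : ℤ) p), ∀ i, (x i - 1) % p ∈ c := by
  classical
  have hp0 : (0 : ℤ) < p := by exact_mod_cast hp
  set r : Fin s → ℤ := fun i => (x i - 1) % p with hr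
  set T := univ.image r with hT
  have hTsub : T ⊆ Ico (0 : ℤ) p := by
    intro y hy
    rw [hT, mem_image] at hy
    obtain ⟨i, -, rfl⟩ := hy
    exact mem_Ico.2 ⟨Int.emod_nonneg _ hp0.ne', Int.emod_lt_of_pos _ hp0⟩
  by_cases hcard : k ≤ #T
  · left
    obtain ⟨U, hU, hUk⟩ := exists_subset_card_eq hcard
    have hpre : ∀ y : U, ∃ i, r i = y := fun y => by
      have := hU y.2
      rw [hT, mem_image] at this
      obtain ⟨i, -, hi⟩ := this
      exact ⟨i, hi⟩
    choose g hg using hpre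
    have e : Fin k ≃ U := (U.equivFinOfCardEq hUk).symm
    have hinj : Function.Injective (fun i => g (e i)) := fun i j hij => by
      apply e.injective
      apply Subtype.ext
      rw [← hg, ← hg]
      exact congrArg r hij
    refine ⟨⟨_, hinj⟩, fun i j hij => ?_⟩
    apply e.injective
    apply Subtype.ext
    rw [← hg, ← hg]
    simp only [Function.Embedding.coeFn_mk] at hij
    refine Int.emod_eq_emod_iff_emod_sub_eq_zero.2 (Int.emod_eq_zero_of_dvd ?_)
    simpa using hij
  · right
    obtain ⟨c, hc1, hc2, hc3⟩ := exists_subsuperset_card_eq hTsub (by omega : #T ≤ k - 1)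
      (by rw [Int.card_Ico]; simp; omega)
    exact ⟨c, mem_powersetCard.2 ⟨hc2, hc3⟩, fun i => hc1 (mem_image_of_mem r (mem_univ i))⟩

lemma vmv_add_le (I : Finset ℤ) : vmv (m + k) k I ≤ #I ^ (2 * k) * vmv m k I := by
  classical
  have h1 : vmv (m + k) k I ≤ solutions m (Fintype.piFinset fun _ : Fin k => I)
      (fun x => ∑ i, powVec k (x i)) I (powVec k) := by
    refine energy_split (Fin.castLEEmb (by omega)) I _ _ fun x hx => ?_
    rw [Fintype.mem_piFinset] at hx
    exact ⟨hx, by rw [Fintype.mem_piFinset]; exact fun i => hx _⟩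
  refine h1.trans ((solutions_le _ _ _
    (Fintype.piFinset (fun _ : Fin k => I) ×ˢ Fintype.piFinset (fun _ : Fin k => I)) ?_).trans ?_)
  · intro x hx y hy _ _ _ _ _
    exact mem_product.2 ⟨hx, hy⟩
  · rw [card_product, Fintype.card_piFinset_const, ← pow_add, ← two_mul]

/-- The `p`-adic recursion for Vinogradov's mean value. -/
lemma vmv_recursion (hp : p.Prime) (hk : k < p) (hk0 : k ≠ 0) (hm : m ≠ 0) {X X' : ℕ}
    (hX : X ≤ p * X') (hXp : X ≤ p ^ k) :
    vmv (m + k) k (Icc (1 : ℤ) X) ≤ 2 *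
      ((m + k) ^ (2 * k) * (p ^ (2 * m) * (X ^ k * (k.factorial * p ^ (k * (k - 1) / 2))))
        + p ^ (2 * (k - 1)) * (k ^ (2 * (m + k)) * X' ^ (2 * k))) * vmv m k (Icc (1 : ℤ) X') := by
  classical
  set I := Icc (1 : ℤ) X with hI
  set S := Fintype.piFinset fun _ : Fin (m + k) => I with hS
  set v : (Fin (m + k) → ℤ) → Fin k → ℤ := fun x => ∑ i, powVec k (x i) with hv
  set J := vmv m k (Icc (1 : ℤ) X') with hJ
  set Gσ : (Fin k ↪ Fin (m + k)) → Finset (Fin (m + k) → ℤ) := fun σ =>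
    {x ∈ S | ∀ i j, (p : ℤ) ∣ x (σ i) - x (σ j) → i = j} with hG
  set Bc : Finset ℤ → Finset (Fin (m + k) → ℤ) := fun c =>
    Fintype.piFinset fun _ : Fin (m + k) => {x ∈ I | (x - 1) % p ∈ c} with hB
  have hresid : ∀ x ∈ I, (x - 1) % (p : ℤ) ∈ Ico (0 : ℤ) p := fun x _ => by
    have hp0 : (0 : ℤ) < p := by exact_mod_cast hp.pos
    exact mem_Ico.2 ⟨Int.emod_nonneg _ hp0.ne', Int.emod_lt_of_pos _ hp0⟩
  have hgood : energy (univ.biUnion Gσ) v ≤ ((m + k) ^ k) ^ 2 *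
      (p ^ (2 * m) * (X ^ k * (k.factorial * p ^ (k * (k - 1) / 2)) * J)) := by
    refine (energy_le_of_cover univ Gσ v subset_rfl (B := p ^ (2 * m) *
      (X ^ k * (k.factorial * p ^ (k * (k - 1) / 2)) * J)) fun σ _ => ?_).trans ?_
    · refine (energy_split σ I (distinctTuples p k I) (Gσ σ) fun x hx => ?_).trans ?_
      · rw [hG, mem_filter, hS, Fintype.mem_piFinset] at hx
        refine ⟨hx.1, ?_⟩
        rw [distinctTuples, mem_filter, Fintype.mem_piFinset]
        exact ⟨fun i => hx.1 _, hx.2⟩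
      · refine (solutions_holder m _ _ I _ (Ico (0 : ℤ) p) (fun x => (x - 1) % p) hresid hm _
          fun a _ => solutions_distinct_le hp hk hk0 hX hXp a).trans ?_
        simp [hJ]
    · gcongr
      rw [card_univ, Fintype.card_embedding_eq, Fintype.card_fin, Fintype.card_fin]
      exact Nat.descFactorial_le_pow _ _
  have hbad : energy ((powersetCard (k - 1) (Ico (0 : ℤ) p)).biUnion Bc) v ≤
      (p ^ (k - 1)) ^ 2 * (k ^ (2 * (m + k)) * (X' ^ (2 * k) * J)) := by
    refine (energy_le_of_cover _ Bc v subset_rfl (B := k ^ (2 * (m + k)) * (X' ^ (2 * k) * J))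
      fun c hc => ?_).trans ?_
    · rw [mem_powersetCard] at hc
      have h1 : energy (Bc c) v = vmv (m + k) k {x ∈ I | (x - 1) % p ∈ c} := rfl
      rw [h1, vmv_eq_solutions]
      refine (solutions_holder (m + k) _ _ _ _ c (fun x => (x - 1) % p)
        (fun x hx => (mem_filter.1 hx).2) (by omega) (X' ^ (2 * k) * J) fun a ha => ?_).trans ?_
      · rw [← vmv_eq_solutions]
        calc _ ≤ vmv (m + k) k {x ∈ I | (x - 1) % p = a} := by
              refine energy_mono (Fintype.piFinset_subset _ _ fun _ => ?_) _
              intro x hx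
              rw [mem_filter, mem_filter] at hx
              exact mem_filter.2 ⟨hx.1.1, hx.2⟩
          _ ≤ vmv (m + k) k (Icc (1 : ℤ) X') := vmv_residue_le hp.ne_zero hX a
          _ ≤ _ := by
              refine vmv_add_le _ |>.trans ?_
              simp [hJ]
      · gcongr
        omega
    · gcongr
      rw [card_powersetCard, Int.card_Ico]
      simpa using Nat.choose_le_pow p (k - 1)
  have hcover : S ⊆ univ.biUnion (fun b : Bool => if b then univ.biUnion Gσ else
      (powersetCard (k - 1) (Ico (0 : ℤ) p)).biUnion Bc) := by
    intro x hx
    rw [mem_biUnion]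
    rcases exists_distinct_or_subset hp.pos hk.le x with ⟨σ, hσ⟩ | ⟨c, hc, hcx⟩
    · refine ⟨true, mem_univ _, ?_⟩
      rw [if_pos rfl, mem_biUnion]
      exact ⟨σ, mem_univ _, mem_filter.2 ⟨hx, hσ⟩⟩
    · refine ⟨false, mem_univ _, ?_⟩
      rw [if_neg (by simp), mem_biUnion]
      refine ⟨c, hc, ?_⟩
      rw [hS, Fintype.mem_piFinset] at hx
      rw [hB, Fintype.mem_piFinset]
      exact fun i => mem_filter.2 ⟨hx i, hcx i⟩
  have htot := (energy_mono hcover v).trans (energy_biUnion_le _ _ v)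
  simp only [Fintype.univ_bool, mem_singleton, Bool.true_eq_false,
    not_false_eq_true, sum_insert, ↓reduceIte, sum_singleton, Bool.false_eq_true] at htot
  calc vmv (m + k) k I = energy S v := rfl
    _ ≤ _ := htot
    _ ≤ 2 * (((m + k) ^ k) ^ 2 *
          (p ^ (2 * m) * (X ^ k * (k.factorial * p ^ (k * (k - 1) / 2)) * J)) +
        (p ^ (k - 1)) ^ 2 * (k ^ (2 * (m + k)) * (X' ^ (2 * k) * J))) :=
        Nat.mul_le_mul (by simp) (add_le_add hgood hbad)
    _ = _ := by ring

end MeanValue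

end VinogradovKorobov

namespace VinogradovKorobov

open Finset

section MeanValueBound

variable {k m s p X : ℕ}

lemma vmv_le_trivial (s k X : ℕ) : vmv s k (Icc (1 : ℤ) X) ≤ X ^ (2 * s) := by
  refine (card_filter_le _ _).trans ?_
  rw [card_product, Fintype.card_piFinset_const, Int.card_Icc, ← pow_add, ← two_mul]
  simp

lemma exists_root (hk : k ≠ 0) (X : ℕ) (hX : X ≠ 0) : ∃ Y, X ≤ (Y + 1) ^ k ∧ Y ^ k < X := by
  classical
  have h : ∃ Y, X ≤ (Y + 1) ^ k := ⟨X, (Nat.le_succ X).trans (Nat.le_self_pow hk _)⟩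
  refine ⟨Nat.find h, Nat.find_spec h, ?_⟩
  rcases Nat.eq_zero_or_pos (Nat.find h) with h0 | h0
  · rw [h0, zero_pow hk]; omega
  · have := Nat.find_min h (m := Nat.find h - 1) (by omega)
    rw [Nat.sub_add_cancel h0] at this
    omega

/-- A prime adapted to the `p`-adic recursion. -/
lemma exists_prime_root (hk : 3 ≤ k) (hX : k ^ k < X) :
    ∃ p X' : ℕ, p.Prime ∧ k < p ∧ X ≤ p ^ k ∧ p ^ k ≤ 4 ^ k * X ∧ X ≤ p * X' ∧ p * X' ≤ 2 * X ∧
      X' ≠ 0 := by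
  obtain ⟨Y, hY1, hY2⟩ := exists_root (by omega : k ≠ 0) X (by omega)
  have hkY : k ≤ Y := by
    by_contra h
    have : (Y + 1) ^ k ≤ k ^ k := Nat.pow_le_pow_left (by omega) _
    omega
  obtain ⟨p, hp, hp1, hp2⟩ := Nat.exists_prime_lt_and_le_two_mul (Y + 1) (by omega)
  have hp4 : p ≤ 4 * Y := by omega
  have hpX : p ≤ X := by
    refine hp4.trans (le_trans ?_ hY2.le)
    calc 4 * Y ≤ Y ^ 2 * Y := by gcongr; nlinarith
      _ = Y ^ 3 := by ring
      _ ≤ Y ^ k := Nat.pow_le_pow_right (by omega) hk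
  have h3 := Nat.div_add_mod (X - 1) p
  have h4 := Nat.mod_lt (X - 1) hp.pos
  have h5 : X ≠ 0 := by omega
  generalize (X - 1) / p = q at h3 ⊢
  generalize (X - 1) % p = z at h3 h4
  generalize hpq : p * q = w at h3
  refine ⟨p, q + 1, hp, by omega, hY1.trans (Nat.pow_le_pow_left hp1.le _), ?_, ?_, ?_,
    by omega⟩
  · calc p ^ k ≤ (4 * Y) ^ k := Nat.pow_le_pow_left hp4 _
      _ = 4 ^ k * Y ^ k := mul_pow _ _ _
      _ ≤ _ := by gcongr
  · rw [mul_add, hpq]; omega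
  · rw [mul_add, hpq]; omega

lemma vmv_step_const (hk : 4 ≤ k) (hm : k ^ 2 ≤ m) (hmk : m + k ≤ k ^ 4) :
    2 * ((m + k) ^ (2 * k) * k.factorial + k ^ (2 * (m + k)) * 4 ^ k) * 2 ^ (2 * m) * 4 ^ k ^ 2
      ≤ k ^ (7 * (m + k)) := by
  have h1 : (m + k) ^ (2 * k) * k.factorial ≤ k ^ (2 * (m + k) + 9 * k) := by
    calc _ ≤ (k ^ 4) ^ (2 * k) * k ^ k := by
          gcongr
          exact Nat.factorial_le_pow k
      _ = k ^ (9 * k) := by rw [← pow_mul, ← pow_add]; ring_nf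
      _ ≤ _ := Nat.pow_le_pow_right (by omega) (by omega)
  have h2 : k ^ (2 * (m + k)) * 4 ^ k ≤ k ^ (2 * (m + k) + 9 * k) := by
    calc _ ≤ k ^ (2 * (m + k)) * k ^ k := by gcongr
      _ = k ^ (2 * (m + k) + k) := by rw [← pow_add]
      _ ≤ _ := Nat.pow_le_pow_right (by omega) (by omega)
  have h3 : 2 ^ (2 * m) ≤ k ^ m := by
    rw [pow_mul]
    gcongr
    omega
  have h4 : 4 ^ k ^ 2 ≤ k ^ k ^ 2 := by gcongr
  calc _ ≤ 2 * (k ^ (2 * (m + k) + 9 * k) + k ^ (2 * (m + k) + 9 * k)) * k ^ m * k ^ k ^ 2 := by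
        gcongr
    _ = 4 * k ^ (2 * (m + k) + 9 * k) * k ^ m * k ^ k ^ 2 := by ring
    _ ≤ k * k ^ (2 * (m + k) + 9 * k) * k ^ m * k ^ k ^ 2 := by gcongr
    _ = k ^ (2 * (m + k) + 9 * k + 1 + m + k ^ 2) := by rw [← pow_succ', ← pow_add, ← pow_add]
    _ ≤ _ := Nat.pow_le_pow_right (by omega) (by nlinarith)

/-- The exponent in Vinogradov's mean value theorem after `r` steps of the recursion. -/
noncomputable def mvExp (k r : ℕ) : ℝ :=
  2 * (k * (k + r)) - k * (k + 1) / 2 * (1 - (1 - 1 / k) ^ r)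

lemma mvExp_delta (hk : 1 ≤ k) (r : ℕ) : 0 ≤ (1 - 1 / (k : ℝ)) ^ r ∧ (1 - 1 / (k : ℝ)) ^ r ≤ 1 := by
  have h : 1 / (k : ℝ) ≤ 1 := by
    rw [div_le_one (by positivity)]
    exact_mod_cast hk
  have h' : 0 ≤ 1 / (k : ℝ) := by positivity
  exact ⟨pow_nonneg (by linarith) _, pow_le_one₀ (by linarith) (by linarith)⟩

/-- Vinogradov's mean value theorem. -/
theorem vmv_le (hk : 4 ≤ k) (r : ℕ) (hr : k * (k + r) ≤ k ^ 4) (X : ℕ) (hX : X ≠ 0) :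
    (vmv (k * (k + r)) k (Icc (1 : ℤ) X) : ℝ) ≤
      (k : ℝ) ^ (k ^ 3 + 7 * (k * (k + r)) * r) * (X : ℝ) ^ mvExp k r := by
  have hk1 : (1 : ℝ) ≤ k := by exact_mod_cast (by omega : 1 ≤ k)
  have hk0 : (0 : ℝ) < k := by linarith
  induction r generalizing X with
  | zero =>
    have h1 : (vmv (k * (k + 0)) k (Icc (1 : ℤ) X) : ℝ) ≤ (X : ℝ) ^ mvExp k 0 := by
      have h2 : mvExp k 0 = ((2 * (k * (k + 0)) : ℕ) : ℝ) := by simp [mvExp]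
      rw [h2, Real.rpow_natCast]
      exact_mod_cast vmv_le_trivial _ _ _
    exact h1.trans (le_mul_of_one_le_left (by positivity) (one_le_pow₀ hk1))
  | succ r ih =>
    have hX1 : (1 : ℝ) ≤ X := by exact_mod_cast Nat.one_le_iff_ne_zero.2 hX
    have hX0 : (0 : ℝ) < X := by linarith
    have hr' : k * (k + r) ≤ k ^ 4 := le_trans (by gcongr; omega) hr
    obtain ⟨hd0, hd1⟩ := mvExp_delta (by omega : 1 ≤ k) (r + 1)
    rcases le_or_gt X (k ^ k) with hsmall | hlarge
    · have h1 : (vmv (k * (k + (r + 1))) k (Icc (1 : ℤ) X) : ℝ)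
          ≤ (X : ℝ) ^ (2 * (k * (k + (r + 1)))) := by
        exact_mod_cast vmv_le_trivial _ _ _
      have h2 : (X : ℝ) ^ (2 * (k * (k + (r + 1)))) = (X : ℝ) ^ (k * (k + 1) / 2 *
          (1 - (1 - 1 / (k : ℝ)) ^ (r + 1))) * (X : ℝ) ^ mvExp k (r + 1) := by
        rw [← Real.rpow_add hX0, mvExp, ← Real.rpow_natCast]
        congr 1
        push_cast
        ring
      have h3 : (X : ℝ) ^ (k * (k + 1) / 2 * (1 - (1 - 1 / (k : ℝ)) ^ (r + 1))) ≤
          (k : ℝ) ^ k ^ 3 := by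
        calc _ ≤ (X : ℝ) ^ ((k ^ 2 : ℕ) : ℝ) := by
              apply Real.rpow_le_rpow_of_exponent_le hX1
              have : (k : ℝ) * (k + 1) / 2 ≤ k ^ 2 := by nlinarith
              push_cast
              calc _ ≤ (k : ℝ) * (k + 1) / 2 * 1 := by gcongr; linarith
                _ ≤ _ := by linarith
          _ ≤ (((k ^ k : ℕ) : ℝ)) ^ ((k ^ 2 : ℕ) : ℝ) := by
              gcongr
          _ = _ := by
              rw [Real.rpow_natCast]
              push_cast
              rw [← pow_mul]
              ring_nf
      rw [h2] at h1
      refine h1.trans ?_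
      gcongr
      exact h3.trans (pow_le_pow_right₀ hk1 (by omega))
    · obtain ⟨p, X', hp, hkp, hXp, hpX, hXX', hX'X, hX'0⟩ :=
        exists_prime_root (by omega : 3 ≤ k) hlarge
      set m := k * (k + r) with hm
      have hmk : k * (k + (r + 1)) = m + k := by rw [hm]; ring
      have hk2m : k ^ 2 ≤ m := by rw [hm]; nlinarith
      have hm0 : m ≠ 0 := by
        have : 0 < k ^ 2 := by positivity
        omega
      rw [hmk] at hr ⊢
      have hrec := vmv_recursion (m := m) hp hkp (by omega : k ≠ 0) hm0 hXX' hXp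
      have hih := ih hr' X' hX'0
      obtain ⟨hδ0, hδ1⟩ := mvExp_delta (by omega : 1 ≤ k) r
      set δ := (1 - 1 / (k : ℝ)) ^ r with hδ
      have hp0 : (0 : ℝ) < p := by exact_mod_cast hp.pos
      have hX'p : (X' : ℝ) ≤ 2 * X / p := by
        rw [le_div_iff₀ hp0]
        have : ((p * X' : ℕ) : ℝ) ≤ ((2 * X : ℕ) : ℝ) := by exact_mod_cast hX'X
        push_cast at this
        linarith
      -- the factor in the recursion
      have hfac : 2 * ((m + k) ^ (2 * k) * (p ^ (2 * m) *
            (X ^ k * (k.factorial * p ^ (k * (k - 1) / 2))))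
          + p ^ (2 * (k - 1)) * (k ^ (2 * (m + k)) * X' ^ (2 * k))) ≤
          2 * ((m + k) ^ (2 * k) * k.factorial + k ^ (2 * (m + k)) * 4 ^ k) *
            (p ^ (2 * m + k * (k - 1) / 2) * X ^ k) := by
        have h1 : p ^ (2 * (k - 1)) * X' ^ (2 * k) ≤
            4 ^ k * (p ^ (2 * m + k * (k - 1) / 2) * X ^ k) := by
          calc p ^ (2 * (k - 1)) * X' ^ (2 * k) ≤ p ^ (2 * k) * X' ^ (2 * k) := by
                gcongr
                · exact hp.one_le
                · omega
            _ = (p * X') ^ (2 * k) := by rw [mul_pow]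
            _ ≤ (2 * X) ^ (2 * k) := by gcongr
            _ = 4 ^ k * (X ^ k * X ^ k) := by
                rw [mul_pow, pow_mul, two_mul k, pow_add]
                norm_num
            _ ≤ 4 ^ k * (p ^ (2 * m + k * (k - 1) / 2) * X ^ k) := by
                refine Nat.mul_le_mul_left _ (Nat.mul_le_mul_right _ ?_)
                calc X ^ k ≤ (p ^ k) ^ k := by gcongr
                  _ = p ^ (k ^ 2) := by rw [← pow_mul, sq]
                  _ ≤ _ := Nat.pow_le_pow_right hp.pos (by omega)
        calc _ = 2 * ((m + k) ^ (2 * k) * k.factorial * (p ^ (2 * m + k * (k - 1) / 2) * X ^ k)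
              + k ^ (2 * (m + k)) * (p ^ (2 * (k - 1)) * X' ^ (2 * k))) := by
              rw [pow_add]; ring
          _ ≤ 2 * ((m + k) ^ (2 * k) * k.factorial * (p ^ (2 * m + k * (k - 1) / 2) * X ^ k)
              + k ^ (2 * (m + k)) * (4 ^ k * (p ^ (2 * m + k * (k - 1) / 2) * X ^ k))) := by
              gcongr
          _ = _ := by ring
      have hcast : (vmv (m + k) k (Icc (1 : ℤ) X) : ℝ) ≤
          ((2 * ((m + k) ^ (2 * k) * k.factorial + k ^ (2 * (m + k)) * 4 ^ k) : ℕ) : ℝ) *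
            ((p : ℝ) ^ (2 * m + k * (k - 1) / 2) * (X : ℝ) ^ k) *
            vmv m k (Icc (1 : ℤ) X') := by
        exact_mod_cast hrec.trans (Nat.mul_le_mul_right _ hfac)
      have hexp0 : 0 ≤ mvExp k r := by
        rw [mvExp, ← hδ]
        have h1 : (k : ℝ) * (k + 1) / 2 * (1 - δ) ≤ k * (k + 1) / 2 * 1 := by
          gcongr; linarith
        have h2 : (0 : ℝ) ≤ k * r := by positivity
        nlinarith
      have hX'2 : (X' : ℝ) ^ mvExp k r ≤ ((2 ^ (2 * m) : ℕ) : ℝ) *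
          ((X : ℝ) ^ mvExp k r * (p : ℝ) ^ (-mvExp k r)) := by
        calc (X' : ℝ) ^ mvExp k r ≤ (2 * X / p) ^ mvExp k r := by gcongr
          _ = 2 ^ mvExp k r * ((X : ℝ) ^ mvExp k r * (p : ℝ) ^ (-mvExp k r)) := by
              rw [Real.div_rpow (by positivity) (by positivity), Real.mul_rpow (by norm_num)
                (by positivity), Real.rpow_neg hp0.le, div_eq_mul_inv, mul_assoc]
          _ ≤ _ := by
              gcongr
              push_cast
              rw [← Real.rpow_natCast]
              apply Real.rpow_le_rpow_of_exponent_le (by norm_num)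
              rw [mvExp, ← hδ, hm]
              push_cast
              have : 0 ≤ (k : ℝ) * (k + 1) / 2 * (1 - δ) :=
                mul_nonneg (by positivity) (by linarith)
              linarith
      have hpexp : (p : ℝ) ^ (2 * m + k * (k - 1) / 2) * (p : ℝ) ^ (-mvExp k r) ≤
          ((4 ^ k ^ 2 : ℕ) : ℝ) * (X : ℝ) ^ (k - (k + 1) / 2 * δ) := by
        have hkk : ((k * (k - 1) / 2 : ℕ) : ℝ) = (k : ℝ) * (k - 1) / 2 := by
          rw [Nat.cast_div (even_iff_two_dvd.1 (Nat.even_mul_pred_self k)) (by norm_num)]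
          push_cast [Nat.cast_sub (by omega : 1 ≤ k)]
          ring
        have he0 : (0 : ℝ) ≤ k - (k + 1) / 2 * δ := by nlinarith
        calc _ = ((p : ℝ) ^ k) ^ ((k : ℝ) - (k + 1) / 2 * δ) := by
              rw [← Real.rpow_natCast, ← Real.rpow_add hp0, ← Real.rpow_natCast,
                ← Real.rpow_mul hp0.le]
              congr 1
              rw [mvExp, ← hδ, hm]
              push_cast
              rw [hkk]
              ring
          _ ≤ (4 ^ k * X) ^ ((k : ℝ) - (k + 1) / 2 * δ) := by
              gcongr
              exact_mod_cast hpX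
          _ = ((4 : ℝ) ^ k) ^ ((k : ℝ) - (k + 1) / 2 * δ) * (X : ℝ) ^ (k - (k + 1) / 2 * δ) := by
              rw [Real.mul_rpow (by positivity) (by positivity)]
          _ ≤ _ := by
              gcongr
              push_cast
              rw [sq, pow_mul, ← Real.rpow_natCast (4 ^ k) k]
              apply Real.rpow_le_rpow_of_exponent_le
              · exact one_le_pow₀ (by norm_num)
              · have : 0 ≤ ((k : ℝ) + 1) / 2 * δ := by positivity
                linarith
      have hXexp : (X : ℝ) ^ k * (X : ℝ) ^ mvExp k r * (X : ℝ) ^ (k - (k + 1) / 2 * δ) =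
          (X : ℝ) ^ mvExp k (r + 1) := by
        rw [← Real.rpow_natCast, ← Real.rpow_add hX0, ← Real.rpow_add hX0]
        congr 1
        rw [mvExp, mvExp, pow_succ, ← hδ]
        push_cast
        field_simp
        ring
      have hconst : (((2 * ((m + k) ^ (2 * k) * k.factorial + k ^ (2 * (m + k)) * 4 ^ k) : ℕ) : ℝ))
          * ((2 ^ (2 * m) : ℕ) : ℝ) * ((4 ^ k ^ 2 : ℕ) : ℝ) ≤ (k : ℝ) ^ (7 * (m + k)) := by
        exact_mod_cast vmv_step_const hk hk2m hr
      calc _ ≤ _ := hcast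
        _ ≤ ((2 * ((m + k) ^ (2 * k) * k.factorial + k ^ (2 * (m + k)) * 4 ^ k) : ℕ) : ℝ) *
            ((p : ℝ) ^ (2 * m + k * (k - 1) / 2) * (X : ℝ) ^ k) *
            ((k : ℝ) ^ (k ^ 3 + 7 * m * r) * (((2 ^ (2 * m) : ℕ) : ℝ) *
          ((X : ℝ) ^ mvExp k r * (p : ℝ) ^ (-mvExp k r)))) := by
            gcongr
            exact hih.trans (by gcongr)
        _ = ((2 * ((m + k) ^ (2 * k) * k.factorial + k ^ (2 * (m + k)) * 4 ^ k) : ℕ) : ℝ) *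
            ((2 ^ (2 * m) : ℕ) : ℝ) * (k : ℝ) ^ (k ^ 3 + 7 * m * r) *
            ((X : ℝ) ^ k * (X : ℝ) ^ mvExp k r) *
            ((p : ℝ) ^ (2 * m + k * (k - 1) / 2) * (p : ℝ) ^ (-mvExp k r)) := by ring
        _ ≤ ((2 * ((m + k) ^ (2 * k) * k.factorial + k ^ (2 * (m + k)) * 4 ^ k) : ℕ) : ℝ) *
            ((2 ^ (2 * m) : ℕ) : ℝ) * (k : ℝ) ^ (k ^ 3 + 7 * m * r) *
            ((X : ℝ) ^ k * (X : ℝ) ^ mvExp k r) *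
            (((4 ^ k ^ 2 : ℕ) : ℝ) * (X : ℝ) ^ (k - (k + 1) / 2 * δ)) := by gcongr
        _ = (((2 * ((m + k) ^ (2 * k) * k.factorial + k ^ (2 * (m + k)) * 4 ^ k) : ℕ) : ℝ) *
            ((2 ^ (2 * m) : ℕ) : ℝ) * ((4 ^ k ^ 2 : ℕ) : ℝ)) * (k : ℝ) ^ (k ^ 3 + 7 * m * r) *
            (X : ℝ) ^ mvExp k (r + 1) := by rw [← hXexp]; ring
        _ ≤ (k : ℝ) ^ (7 * (m + k)) * (k : ℝ) ^ (k ^ 3 + 7 * m * r) *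
            (X : ℝ) ^ mvExp k (r + 1) := by gcongr
        _ ≤ _ := by
            rw [← pow_add]
            refine mul_le_mul_of_nonneg_right (pow_le_pow_right₀ hk1 ?_) (by positivity)
            nlinarith

end MeanValueBound

end VinogradovKorobov

namespace VinogradovKorobov

open Finset

section Bilinear

variable {k s : ℕ}

/-- The additive character `x ↦ exp (2π i x)`. -/
noncomputable def ex (x : ℝ) : ℂ := Complex.exp (2 * Real.pi * x * Complex.I)

lemma ex_add (x y : ℝ) : ex (x + y) = ex x * ex y := by
  rw [ex, ex, ex, ← Complex.exp_add]
  push_cast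
  ring_nf

lemma ex_zero : ex 0 = 1 := by simp [ex]

lemma ex_int (n : ℤ) : ex n = 1 := by
  rw [ex, Complex.exp_eq_one_iff]
  exact ⟨n, by push_cast; ring⟩

lemma norm_ex (x : ℝ) : ‖ex x‖ = 1 := by
  rw [ex]
  have : (2 * Real.pi * x * Complex.I : ℂ) = ((2 * Real.pi * x : ℝ) : ℂ) * Complex.I := by
    push_cast; ring
  rw [this, Complex.norm_exp_ofReal_mul_I]

lemma ex_neg (x : ℝ) : ex (-x) = (starRingEnd ℂ) (ex x) := by
  rw [ex, ex, ← Complex.exp_conj]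
  simp [show (starRingEnd ℂ) 2 = 2 from Complex.conj_ofNat 2]

lemma ex_sum {ι : Type*} (t : Finset ι) (f : ι → ℝ) : ex (∑ i ∈ t, f i) = ∏ i ∈ t, ex (f i) := by
  classical
  induction t using Finset.induction_on with
  | empty => simp [ex_zero]
  | insert a t ha ih => rw [sum_insert ha, prod_insert ha, ex_add, ih]

lemma norm_ex_sub_le (x y : ℝ) : ‖ex x - ex y‖ ≤ 2 * Real.pi * |x - y| := by
  have h : ex x - ex y = ex y * (ex (x - y) - 1) := by
    rw [mul_sub, ← ex_add, mul_one]; ring_nf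
  rw [h, norm_mul, norm_ex, one_mul, ex]
  have : (2 * Real.pi * ((x - y : ℝ) : ℂ) * Complex.I : ℂ)
    = Complex.I * ((2 * Real.pi * (x - y) : ℝ) : ℂ) := by push_cast; ring
  rw [this]
  refine (Real.norm_exp_I_mul_ofReal_sub_one_le).trans ?_
  rw [Real.norm_eq_abs, abs_mul, abs_of_pos Real.two_pi_pos]

/-- The character of `ℤᵏ` with frequency `β`. -/
noncomputable def latticeChar (β : Fin k → ℝ) (v : Fin k → ℤ) : ℂ := ex (∑ j, β j * v j)

lemma latticeChar_add (β : Fin k → ℝ) (v w : Fin k → ℤ) :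
    latticeChar β (v + w) = latticeChar β v * latticeChar β w := by
  rw [latticeChar, latticeChar, latticeChar, ← ex_add, ← sum_add_distrib]
  congr 1
  refine sum_congr rfl fun j _ => ?_
  simp only [Pi.add_apply]
  push_cast
  ring

lemma latticeChar_neg (β : Fin k → ℝ) (v : Fin k → ℤ) :
    latticeChar β (-v) = (starRingEnd ℂ) (latticeChar β v) := by
  rw [latticeChar, latticeChar, ← ex_neg, ← sum_neg_distrib]
  congr 1
  refine sum_congr rfl fun j _ => ?_
  simp only [Pi.neg_apply]
  push_cast
  ring

lemma latticeChar_sum {ι : Type*} (β : Fin k → ℝ) (t : Finset ι) (v : ι → Fin k → ℤ) :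
    latticeChar β (∑ i ∈ t, v i) = ∏ i ∈ t, latticeChar β (v i) := by
  classical
  induction t using Finset.induction_on with
  | empty => simp [latticeChar, ex_zero]
  | insert a t ha ih => rw [sum_insert ha, prod_insert ha, latticeChar_add, ih]

/-- The vector of power sums of a tuple. -/
def powSumVec (s k : ℕ) (x : Fin s → ℤ) : Fin k → ℤ := ∑ i, powVec k (x i)

lemma norm_pow_eq (β : Fin k → ℝ) (s : ℕ) (U : Finset ℤ) :
    ((‖∑ y ∈ U, latticeChar β (powVec k y)‖ ^ (2 * s) : ℝ) : ℂ) =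
      ∑ q ∈ (Fintype.piFinset fun _ : Fin s => U) ×ˢ (Fintype.piFinset fun _ : Fin s => U),
        latticeChar β (powSumVec s k q.1 - powSumVec s k q.2) := by
  have h1 : (∑ y ∈ U, latticeChar β (powVec k y)) ^ s =
      ∑ x ∈ Fintype.piFinset fun _ : Fin s => U, latticeChar β (powSumVec s k x) := by
    rw [Finset.sum_pow']
    refine sum_congr rfl fun x _ => ?_
    rw [powSumVec, latticeChar_sum]
  rw [pow_mul', ← norm_pow, h1, sum_product]
  push_cast
  rw [← Complex.mul_conj', map_sum, sum_mul_sum]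
  refine sum_congr rfl fun x _ => sum_congr rfl fun y _ => ?_
  rw [sub_eq_add_neg, latticeChar_add, latticeChar_neg]

lemma sum_pairs_le_energy {ι : Type*} {V : Type*} [DecidableEq V] [AddCommGroup V]
    (P : Finset ι) (v : ι → V) (B : Finset V) (hB : ∀ x ∈ P, ∀ y ∈ P, v x - v y ∈ B)
    (F : V → ℝ) (hF : ∀ d, 0 ≤ F d) :
    ∑ q ∈ P ×ˢ P, F (v q.1 - v q.2) ≤ energy P v * ∑ d ∈ B, F d := by
  rw [← sum_fiberwise_of_maps_to (t := B) (g := fun q : ι × ι => v q.1 - v q.2)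
    (fun q hq => hB _ (mem_product.1 hq).1 _ (mem_product.1 hq).2), mul_sum]
  refine sum_le_sum fun d _ => ?_
  rw [sum_congr rfl (g := fun _ => F d) fun q hq => by rw [(mem_filter.1 hq).2], sum_const,
    nsmul_eq_mul]
  refine mul_le_mul_of_nonneg_right ?_ (hF d)
  have h := card_shift_le_energy P v d
  refine le_trans ?_ (Nat.cast_le.2 h)
  refine Nat.cast_le.2 (card_le_card fun q hq => ?_)
  rw [mem_filter] at hq ⊢
  exact ⟨hq.1, by rw [← hq.2]; abel⟩

lemma pow_sum_le_card_mul {ι : Type*} (P : Finset ι) (f : ι → ℝ) (hf : ∀ i ∈ P, 0 ≤ f i) {n : ℕ}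
    (hn : n ≠ 0) : (∑ i ∈ P, f i) ^ n ≤ (#P : ℝ) ^ (n - 1) * ∑ i ∈ P, f i ^ n := by
  obtain ⟨n, rfl⟩ := Nat.exists_eq_succ_of_ne_zero hn
  rcases P.eq_empty_or_nonempty with rfl | hP
  · simp
  have h := pow_sum_div_card_le_sum_pow (s := P) (f := f) (n := n) hf
  have hc : (0 : ℝ) < (#P : ℝ) ^ n := by
    have := hP.card_pos
    positivity
  rw [div_le_iff₀ hc, mul_comm] at h
  simpa using h

/-- The box of possible differences of power sum vectors. -/
noncomputable def powBox (s k M : ℕ) : Finset (Fin k → ℤ) :=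
  Fintype.piFinset fun j : Fin k => Icc (-(s * M ^ (j + 1 : ℕ) : ℤ)) (s * M ^ (j + 1 : ℕ))

lemma powSumVec_sub_mem (M : ℕ) {x y : Fin s → ℤ}
    (hx : x ∈ Fintype.piFinset fun _ : Fin s => Icc (1 : ℤ) M)
    (hy : y ∈ Fintype.piFinset fun _ : Fin s => Icc (1 : ℤ) M) :
    powSumVec s k x - powSumVec s k y ∈ powBox s k M := by
  have key : ∀ z ∈ Fintype.piFinset (fun _ : Fin s => Icc (1 : ℤ) M), ∀ j,
      0 ≤ powSumVec s k z j ∧ powSumVec s k z j ≤ s * M ^ (j + 1 : ℕ) := by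
    intro z hz j
    rw [Fintype.mem_piFinset] at hz
    rw [powSumVec, Finset.sum_apply]
    constructor
    · exact sum_nonneg fun i _ => pow_nonneg (by have := mem_Icc.1 (hz i); linarith) _
    · refine (sum_le_card_nsmul univ _ ((M : ℤ) ^ (j + 1 : ℕ)) fun i _ => ?_).trans ?_
      · have := mem_Icc.1 (hz i)
        exact pow_le_pow_left₀ (by linarith) this.2 _
      · simp
  rw [powBox, Fintype.mem_piFinset]
  intro j
  rw [mem_Icc, Pi.sub_apply]
  have h1 := key x hx j
  have h2 := key y hy j
  constructor <;> linarith

/-- Vinogradov's bilinear method. -/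
theorem bilinear_pow_le (α : Fin k → ℝ) (M : ℕ) (hs : s ≠ 0) :
    ‖∑ x ∈ Icc (1 : ℤ) M, ∑ y ∈ Icc (1 : ℤ) M,
      ex (∑ j : Fin k, α j * x ^ (j + 1 : ℕ) * y ^ (j + 1 : ℕ))‖ ^ (2 * s * (2 * s)) ≤
    (M : ℝ) ^ (2 * (2 * s * (2 * s - 1))) * (vmv s k (Icc (1 : ℤ) M) : ℝ) ^ 2 *
      ∏ j : Fin k, ∑ μ ∈ Icc (-(s * M ^ (j + 1 : ℕ) : ℤ)) (s * M ^ (j + 1 : ℕ)),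
        ‖∑ ν ∈ Icc (-(s * M ^ (j + 1 : ℕ) : ℤ)) (s * M ^ (j + 1 : ℕ)), ex (α j * μ * ν)‖ := by
  set U := Icc (1 : ℤ) M with hU
  set P := Fintype.piFinset fun _ : Fin s => U with hP
  set J := vmv s k U with hJ
  have hUc : #U = M := by simp [hU]
  have hPPc : #(P ×ˢ P) = M ^ (2 * s) := by
    rw [card_product, hP, Fintype.card_piFinset_const, hUc, ← pow_add, two_mul]
  have hJE : energy P (powSumVec s k) = J := rfl
  set β : (Fin k → ℤ) → Fin k → ℝ := fun d j => α j * d j with hβ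
  set G : (Fin k → ℤ) → ℂ := fun d => ∑ x ∈ U, latticeChar (β d) (powVec k x) with hG
  have hT : ∑ x ∈ U, ∑ y ∈ U, ex (∑ j : Fin k, α j * x ^ (j + 1 : ℕ) * y ^ (j + 1 : ℕ)) =
      ∑ x ∈ U, ∑ y ∈ U, latticeChar (β (powVec k x)) (powVec k y) := by
    refine sum_congr rfl fun x _ => sum_congr rfl fun y _ => ?_
    rw [latticeChar]
    congr 1
    refine sum_congr rfl fun j _ => ?_
    simp [hβ, powVec]
  have hswap : ∀ x d : Fin k → ℤ, latticeChar (β x) d = latticeChar (β d) x := by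
    intro x d
    rw [latticeChar, latticeChar]
    congr 1
    refine sum_congr rfl fun j _ => ?_
    simp only [hβ]
    ring
  have hA : ‖∑ x ∈ U, ∑ y ∈ U, latticeChar (β (powVec k x)) (powVec k y)‖ ^ (2 * s) ≤
      (M : ℝ) ^ (2 * s - 1) * ∑ q ∈ P ×ˢ P, ‖G (powSumVec s k q.1 - powSumVec s k q.2)‖ := by
    calc _ ≤ (∑ x ∈ U, ‖∑ y ∈ U, latticeChar (β (powVec k x)) (powVec k y)‖) ^ (2 * s) := by
          gcongr
          exact norm_sum_le _ _
      _ ≤ (#U : ℝ) ^ (2 * s - 1) *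
          ∑ x ∈ U, ‖∑ y ∈ U, latticeChar (β (powVec k x)) (powVec k y)‖ ^ (2 * s) :=
          pow_sum_le_card_mul _ _ (fun _ _ => norm_nonneg _) (by omega)
      _ ≤ _ := by
          rw [hUc]
          gcongr
          have h1 : ((∑ x ∈ U, ‖∑ y ∈ U, latticeChar (β (powVec k x)) (powVec k y)‖ ^ (2 * s) : ℝ)
              : ℂ) = ∑ q ∈ P ×ˢ P, G (powSumVec s k q.1 - powSumVec s k q.2) := by
            rw [Complex.ofReal_sum, sum_congr rfl fun x _ => norm_pow_eq _ _ _, sum_comm]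
            refine sum_congr rfl fun q _ => ?_
            rw [hG]
            exact sum_congr rfl fun x _ => hswap _ _
          have h2 : 0 ≤ ∑ x ∈ U, ‖∑ y ∈ U, latticeChar (β (powVec k x)) (powVec k y)‖ ^ (2 * s) :=
            sum_nonneg fun _ _ => by positivity
          rw [← Real.norm_of_nonneg h2, ← Complex.norm_real, h1]
          exact norm_sum_le _ _
  have hB : (∑ q ∈ P ×ˢ P, ‖G (powSumVec s k q.1 - powSumVec s k q.2)‖) ^ (2 * s) ≤
      ((M : ℝ) ^ (2 * s)) ^ (2 * s - 1) * (J * ∑ d ∈ powBox s k M, ‖G d‖ ^ (2 * s)) := by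
    refine (pow_sum_le_card_mul _ _ (fun _ _ => norm_nonneg _) (by omega)).trans ?_
    rw [hPPc, Nat.cast_pow]
    gcongr
    exact sum_pairs_le_energy P (powSumVec s k) _ (fun x hx y hy => powSumVec_sub_mem M hx hy)
      (fun d => ‖G d‖ ^ (2 * s)) fun _ => by positivity
  have hC : ∑ d ∈ powBox s k M, ‖G d‖ ^ (2 * s) ≤ J *
      ∏ j : Fin k, ∑ μ ∈ Icc (-(s * M ^ (j + 1 : ℕ) : ℤ)) (s * M ^ (j + 1 : ℕ)),
        ‖∑ ν ∈ Icc (-(s * M ^ (j + 1 : ℕ) : ℤ)) (s * M ^ (j + 1 : ℕ)), ex (α j * μ * ν)‖ := by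
    have h1 : ((∑ d ∈ powBox s k M, ‖G d‖ ^ (2 * s) : ℝ) : ℂ) = ∑ q ∈ P ×ˢ P,
        ∑ d ∈ powBox s k M, latticeChar (β (powSumVec s k q.1 - powSumVec s k q.2)) d := by
      rw [Complex.ofReal_sum, sum_congr rfl fun x _ => norm_pow_eq _ _ _, sum_comm]
      exact sum_congr rfl fun q _ => sum_congr rfl fun d _ => hswap _ _
    have h2 : 0 ≤ ∑ d ∈ powBox s k M, ‖G d‖ ^ (2 * s) := sum_nonneg fun _ _ => by positivity
    have h3 : ∏ j : Fin k, ∑ μ ∈ Icc (-(s * M ^ (j + 1 : ℕ) : ℤ)) (s * M ^ (j + 1 : ℕ)),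
        ‖∑ ν ∈ Icc (-(s * M ^ (j + 1 : ℕ) : ℤ)) (s * M ^ (j + 1 : ℕ)), ex (α j * μ * ν)‖ =
        ∑ c ∈ powBox s k M, ‖∑ d ∈ powBox s k M, latticeChar (β c) d‖ := by
      rw [prod_univ_sum, powBox]
      refine sum_congr rfl fun c _ => ?_
      rw [← norm_prod, prod_univ_sum]
      congr 1
      refine sum_congr rfl fun d _ => ?_
      rw [latticeChar, ex_sum]
    rw [h3, ← Real.norm_of_nonneg h2, ← Complex.norm_real, h1]
    refine (norm_sum_le _ _).trans ?_
    exact sum_pairs_le_energy P (powSumVec s k) _ (fun x hx y hy => powSumVec_sub_mem M hx hy)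
      (fun c => ‖∑ d ∈ powBox s k M, latticeChar (β c) d‖) fun _ => norm_nonneg _
  rw [hT, pow_mul]
  calc _ ≤ ((M : ℝ) ^ (2 * s - 1) *
        ∑ q ∈ P ×ˢ P, ‖G (powSumVec s k q.1 - powSumVec s k q.2)‖) ^ (2 * s) := by gcongr
    _ = (M : ℝ) ^ (2 * s * (2 * s - 1)) *
        (∑ q ∈ P ×ˢ P, ‖G (powSumVec s k q.1 - powSumVec s k q.2)‖) ^ (2 * s) := by
        rw [mul_pow, ← pow_mul, mul_comm (2 * s - 1)]
    _ ≤ (M : ℝ) ^ (2 * s * (2 * s - 1)) * (((M : ℝ) ^ (2 * s)) ^ (2 * s - 1) * (J * (J *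
      ∏ j : Fin k, ∑ μ ∈ Icc (-(s * M ^ (j + 1 : ℕ) : ℤ)) (s * M ^ (j + 1 : ℕ)),
        ‖∑ ν ∈ Icc (-(s * M ^ (j + 1 : ℕ) : ℤ)) (s * M ^ (j + 1 : ℕ)), ex (α j * μ * ν)‖))) := by
        gcongr
        exact hB.trans (by gcongr)
    _ = _ := by
        rw [← pow_mul, two_mul (2 * s * (2 * s - 1)), pow_add]
        ring

end Bilinear

end VinogradovKorobov

namespace VinogradovKorobov

open Finset

section Spacing

lemma norm_ex_sub_one_ge {β η : ℝ} (h : η ≤ |β - round β|) : 4 * η ≤ ‖ex β - 1‖ := by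
  have h1 : ex β = ex (β - round β) := by
    have h2 : ex β = ex ((β - round β) + round β) := by ring_nf
    rw [h2, ex_add, ex_int, mul_one]
  have h2 : (2 * Real.pi * ((β - round β : ℝ) : ℂ) * Complex.I : ℂ)
    = Complex.I * ((2 * Real.pi * (β - round β) : ℝ) : ℂ) := by push_cast; ring
  have h3 : |Real.pi * (β - round β)| ≤ Real.pi / 2 := by
    rw [abs_mul, abs_of_pos Real.pi_pos]
    have := abs_sub_round β
    nlinarith [Real.pi_pos]
  have h4 := Real.mul_abs_le_abs_sin h3
  rw [h1, ex, h2, Complex.norm_exp_I_mul_ofReal_sub_one, norm_mul, Real.norm_eq_abs,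
    Real.norm_eq_abs, abs_two, show 2 * Real.pi * (β - round β) / 2 = Real.pi * (β - round β) by ring]
  rw [abs_mul, abs_of_pos Real.pi_pos] at h4
  have h5 : 2 / Real.pi * (Real.pi * |β - round β|) = 2 * |β - round β| := by
    field_simp
  linarith

lemma norm_geom_le {β η : ℝ} (hη : 0 < η) (h : η ≤ |β - round β|) (H : ℕ) :
    ‖∑ ν ∈ Icc (-H : ℤ) H, ex (β * ν)‖ ≤ 1 / (2 * η) := by
  have hstep : ∀ n : ℤ, ex (β * (n + 1)) = ex β * ex (β * n) := fun n => by
    rw [← ex_add]; ring_nf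
  have h1 : (ex β - 1) * ∑ ν ∈ Icc (-H : ℤ) H, ex (β * ν) =
      ex (β * (H + 1)) - ex (β * (-H)) := by
    induction H with
    | zero =>
      simp [ex_zero]
    | succ H ih =>
      have hI : Icc (-(H + 1 : ℕ) : ℤ) (H + 1 : ℕ) =
          insert (-(H + 1 : ℤ)) (insert (H + 1 : ℤ) (Icc (-H : ℤ) H)) := by
        ext x
        simp only [mem_insert, mem_Icc]
        push_cast
        omega
      rw [hI, sum_insert, sum_insert, mul_add, mul_add, ih]
      · push_cast
        have e1 := hstep (-(H + 1))
        have e2 := hstep (H + 1)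
        push_cast at e1 e2
        rw [show (-(H + 1 : ℝ) + 1) = -H by ring] at e1
        rw [sub_mul, sub_mul, ← e1, ← e2]
        ring
      · simp
      · simp only [mem_insert, mem_Icc]
        omega
  have h2 := norm_ex_sub_one_ge h
  have h3 : ‖ex β - 1‖ * ‖∑ ν ∈ Icc (-H : ℤ) H, ex (β * ν)‖ ≤ 2 := by
    rw [← norm_mul, h1]
    refine (norm_sub_le _ _).trans ?_
    rw [norm_ex, norm_ex]
    norm_num
  rw [le_div_iff₀ (by positivity)]
  have h4 : 0 ≤ ‖∑ ν ∈ Icc (-H : ℤ) H, ex (β * ν)‖ := norm_nonneg _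
  nlinarith

lemma card_int_near_le (S : Finset ℤ) (c r : ℝ) (hr : 0 ≤ r) (hS : ∀ μ ∈ S, |(μ : ℝ) - c| ≤ r) :
    (#S : ℝ) ≤ 2 * r + 1 := by
  have h1 : S ⊆ Icc ⌈c - r⌉ ⌊c + r⌋ := by
    intro μ hμ
    have := abs_le.1 (hS μ hμ)
    rw [mem_Icc, Int.ceil_le, Int.le_floor]
    constructor <;> linarith
  have h2 := card_le_card h1
  rw [Int.card_Icc] at h2
  have h3 : (#S : ℝ) ≤ ((⌊c + r⌋ + 1 - ⌈c - r⌉).toNat : ℝ) := by exact_mod_cast h2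
  refine h3.trans ?_
  rcases le_total 0 (⌊c + r⌋ + 1 - ⌈c - r⌉) with h | h
  · have h4 : (((⌊c + r⌋ + 1 - ⌈c - r⌉).toNat : ℤ) : ℝ) = ((⌊c + r⌋ + 1 - ⌈c - r⌉ : ℤ) : ℝ) := by
      rw [Int.toNat_of_nonneg h]
    rw [Int.cast_natCast] at h4
    rw [h4]
    push_cast
    linarith [Int.floor_le (c + r), Int.le_ceil (c - r)]
  · rw [Int.toNat_of_nonpos h]
    push_cast
    linarith

lemma card_near_int_le {α η : ℝ} (hα : 0 < α) (hη : 0 < η) (H : ℕ) :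
    ((#((Icc (-H : ℤ) H).filter fun μ : ℤ => |α * μ - round (α * μ)| < η) : ℕ) : ℝ) ≤
      (2 * α * H + 2) * (2 * η / α + 1) := by
  set S : Finset ℤ := ((Icc (-H : ℤ) H).filter fun μ : ℤ => |α * μ - round (α * μ)| < η) with hS
  have h1 : (#(S.image fun μ : ℤ => round (α * μ)) : ℝ) ≤ 2 * α * H + 2 := by
    refine (card_int_near_le _ 0 (α * H + 1 / 2) (by positivity) fun z hz => ?_).trans_eq (by ring)
    rw [mem_image] at hz
    obtain ⟨μ, hμ, rfl⟩ := hz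
    rw [hS, mem_filter, mem_Icc] at hμ
    have h2 := abs_le.1 (abs_sub_round (α * μ))
    have h3 : |α * μ| ≤ α * H := by
      rw [abs_mul, abs_of_pos hα]
      gcongr
      have h4 : |μ| ≤ (H : ℤ) := abs_le.2 hμ.1
      exact_mod_cast h4
    have h4 := abs_le.1 h3
    rw [sub_zero, abs_le]
    constructor <;> linarith
  have h2 := card_eq_sum_card_image (fun μ : ℤ => round (α * μ)) S
  have h3 : (#S : ℝ) = ∑ z ∈ S.image (fun μ : ℤ => round (α * μ)),
      ((#(S.filter fun μ : ℤ => round (α * μ) = z) : ℕ) : ℝ) := by exact_mod_cast h2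
  rw [h3]
  have h4 : ∀ z ∈ S.image (fun μ : ℤ => round (α * μ)),
      ((#(S.filter fun μ : ℤ => round (α * μ) = z) : ℕ) : ℝ) ≤ 2 * η / α + 1 := by
    intro z _
    refine (card_int_near_le _ (z / α) (η / α) (by positivity) fun μ hμ => ?_).trans_eq
      (by ring)
    rw [mem_filter, hS, mem_filter] at hμ
    rw [show (μ : ℝ) - z / α = (α * μ - z) / α by field_simp, abs_div, abs_of_pos hα]
    gcongr
    have := hμ.1.2
    rw [hμ.2] at this
    exact this.le
  refine (sum_le_card_nsmul _ _ _ h4).trans ?_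
  rw [nsmul_eq_mul]
  gcongr

lemma sum_norm_geom_le {α η : ℝ} (hα : 0 < α) (hη : 0 < η) (H : ℕ) :
    ∑ μ ∈ Icc (-H : ℤ) H, ‖∑ ν ∈ Icc (-H : ℤ) H, ex (α * μ * ν)‖ ≤
      (2 * H + 1) * ((2 * α * H + 2) * (2 * η / α + 1) + 1 / (2 * η)) := by
  have hcard : (#(Icc (-H : ℤ) H) : ℝ) = 2 * H + 1 := by
    rw [Int.card_Icc]
    have : ((H : ℤ) + 1 - -H).toNat = 2 * H + 1 := by omega
    rw [this]
    push_cast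
    ring
  rw [← sum_filter_add_sum_filter_not _ (fun μ : ℤ => |α * μ - round (α * μ)| < η), mul_add]
  apply add_le_add
  · refine (sum_le_card_nsmul _ _ (2 * H + 1 : ℝ) fun μ _ => ?_).trans ?_
    · refine (norm_sum_le _ _).trans ?_
      simp [norm_ex, ← hcard]
    · rw [nsmul_eq_mul, mul_comm]
      gcongr
      exact card_near_int_le hα hη H
  · refine (sum_le_card_nsmul _ _ (1 / (2 * η)) fun μ hμ => ?_).trans ?_
    · rw [mem_filter, not_lt] at hμ
      exact norm_geom_le hη hμ.2 H
    · rw [nsmul_eq_mul]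
      gcongr
      rw [← hcard]
      exact_mod_cast card_filter_le _ _

lemma sum_norm_geom_neg (α : ℝ) (H : ℕ) :
    ∑ μ ∈ Icc (-H : ℤ) H, ‖∑ ν ∈ Icc (-H : ℤ) H, ex (-α * μ * ν)‖ =
      ∑ μ ∈ Icc (-H : ℤ) H, ‖∑ ν ∈ Icc (-H : ℤ) H, ex (α * μ * ν)‖ := by
  refine sum_congr rfl fun μ _ => ?_
  rw [← RCLike.norm_conj, map_sum]
  congr 1
  refine sum_congr rfl fun ν _ => ?_
  rw [← ex_neg]
  ring_nf

lemma sum_norm_geom_trivial (α : ℝ) (H : ℕ) :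
    ∑ μ ∈ Icc (-H : ℤ) H, ‖∑ ν ∈ Icc (-H : ℤ) H, ex (α * μ * ν)‖ ≤ (2 * H + 1) ^ 2 := by
  have hcard : (#(Icc (-H : ℤ) H) : ℝ) = 2 * H + 1 := by
    rw [Int.card_Icc]
    have : ((H : ℤ) + 1 - -H).toNat = 2 * H + 1 := by omega
    rw [this]
    push_cast
    ring
  rw [sq]
  nth_rewrite 1 [← hcard]
  rw [← nsmul_eq_mul]
  refine sum_le_card_nsmul _ _ _ fun μ _ => (norm_sum_le _ _).trans ?_
  simp [norm_ex, ← hcard]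

end Spacing

end VinogradovKorobov

namespace VinogradovKorobov

open Finset

section Parameters

variable {k s j M : ℕ} {N l t n : ℝ}

set_option maxHeartbeats 1000000 in
lemma sum_norm_geom_good (hN : 1 ≤ N) (hl : 1 / 2 ≤ l) (ht : t = N ^ l) (hM : N ^ (2 / 5 : ℝ) ≤ 2 * M)
    (hn : N ≤ n) (hn2 : n ≤ 2 * N) (hj0 : 1 ≤ j) (hjk : j ≤ k) (hjs : j ≤ s) (hj2 : 2 * l ≤ j)
    (hj4 : j ≤ 4 * l) :
    ∑ μ ∈ Icc (-(s * M ^ j : ℕ) : ℤ) (s * M ^ j : ℕ),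
      ‖∑ ν ∈ Icc (-(s * M ^ j : ℕ) : ℤ) (s * M ^ j : ℕ),
        ex (t / (2 * Real.pi * j * n ^ j) * μ * ν)‖ ≤
      120 * 4 ^ k * (s * M ^ j : ℝ) ^ 2 * N ^ (-l / 10) := by
  have hN0 : 0 < N := by linarith
  have hn0 : 0 < n := by linarith
  have ht0 : 0 < t := by rw [ht]; positivity
  have hj1 : (1 : ℝ) ≤ j := by exact_mod_cast hj0
  have hjs' : (j : ℝ) ≤ s := by exact_mod_cast hjs
  have hs1 : (1 : ℝ) ≤ s := by linarith
  have hπ := Real.pi_gt_three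
  have hπ4 : Real.pi < 3.15 := Real.pi_lt_d2
  set α := t / (2 * Real.pi * j * n ^ j) with hα
  set η := N ^ (l / 10 - 2 / 5 * j) with hη
  set q := N ^ (-l / 10) with hq
  set E : ℝ := 4 ^ k with hE
  have hα0 : 0 < α := by positivity
  have hη0 : 0 < η := by positivity
  have hq0 : 0 < q := by positivity
  have hE1 : 1 ≤ E := one_le_pow₀ (by norm_num)
  have h4j : (4 : ℝ) ^ j ≤ E := pow_le_pow_right₀ (by norm_num) hjk
  have h2j : (2 : ℝ) ^ j ≤ E := (pow_le_pow_left₀ (by norm_num) (by norm_num) _).trans h4j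
  have hA : N ^ (2 / 5 * j : ℝ) ≤ 2 ^ j * (M : ℝ) ^ j := by
    rw [Real.rpow_mul hN0.le, Real.rpow_natCast, ← mul_pow]
    gcongr
  have hA1 : 1 ≤ N ^ (2 / 5 * j : ℝ) := Real.one_le_rpow hN (by positivity)
  have hMj0 : 1 ≤ M ^ j := by
    apply Nat.one_le_pow
    by_contra h0
    have h0' : M = 0 := by omega
    rw [h0', Nat.cast_zero, zero_pow (by omega)] at hA
    linarith
  have hMj1 : (1 : ℝ) ≤ (M : ℝ) ^ j := by exact_mod_cast hMj0
  have hcast : ((s * M ^ j : ℕ) : ℝ) = s * (M : ℝ) ^ j := by push_cast; ring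
  have hmain := sum_norm_geom_le hα0 hη0 (s * M ^ j)
  rw [hcast] at hmain
  set H : ℝ := s * (M : ℝ) ^ j with hH
  have hH1 : 1 ≤ H := by nlinarith
  have hηq : η ≤ q := Real.rpow_le_rpow_of_exponent_le hN (by linarith)
  have hnj : N ^ j ≤ n ^ j := by gcongr
  have hnj2 : n ^ j ≤ 2 ^ j * N ^ j := by rw [← mul_pow]; gcongr
  have h1 : α ≤ q / 2 := by
    have h2 : t / N ^ j ≤ q := by
      rw [ht, ← Real.rpow_natCast, ← Real.rpow_sub hN0]
      exact Real.rpow_le_rpow_of_exponent_le hN (by linarith)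
    calc α ≤ t / (2 * N ^ j) := by
          rw [hα]
          gcongr
          nlinarith
      _ = (t / N ^ j) / 2 := by field_simp
      _ ≤ q / 2 := by gcongr
  have hAq : N ^ (2 / 5 * j : ℝ) * q ≤ 2 ^ j * (M : ℝ) ^ j * q := by gcongr
  have h3 : 4 * η / α ≤ 26 * E * H * q := by
    have h4 : η * N ^ j / t ≤ N ^ (2 / 5 * j : ℝ) * q := by
      rw [hη, ht, hq, ← Real.rpow_natCast, ← Real.rpow_add hN0, ← Real.rpow_sub hN0,
        ← Real.rpow_add hN0]
      exact Real.rpow_le_rpow_of_exponent_le hN (by linarith)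
    have h5 : 4 * η / α = 8 * Real.pi * j * (η * n ^ j / t) := by
      rw [hα]
      field_simp
      ring
    calc 4 * η / α = 8 * Real.pi * j * (η * n ^ j / t) := h5
      _ ≤ 8 * 3.15 * s * (η * (2 ^ j * N ^ j) / t) := by gcongr
      _ = 8 * 3.15 * s * 2 ^ j * (η * N ^ j / t) := by ring
      _ ≤ 8 * 3.15 * s * 2 ^ j * (2 ^ j * (M : ℝ) ^ j * q) := by
          gcongr
          exact h4.trans hAq
      _ = 25.2 * (2 * 2) ^ j * H * q := by rw [hH, mul_pow]; ring
      _ ≤ 26 * E * H * q := by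
          have h5' : ((2 : ℝ) * 2) ^ j ≤ E := by
            rw [show (2 : ℝ) * 2 = 4 by norm_num]
            exact h4j
          gcongr
          norm_num
  have h6 : (1 : ℝ) ≤ E * H * q := by
    have h7 : N ^ (l / 10) ≤ N ^ (2 / 5 * j : ℝ) :=
      Real.rpow_le_rpow_of_exponent_le hN (by linarith)
    have h8 : N ^ (l / 10) * q = 1 := by
      rw [hq, ← Real.rpow_add hN0]
      ring_nf
      exact Real.rpow_zero _
    calc 1 = N ^ (l / 10) * q := h8.symm
      _ ≤ 2 ^ j * (M : ℝ) ^ j * q := by gcongr; exact h7.trans hA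
      _ ≤ E * H * q := by
          gcongr
          nlinarith
  have h9 : 1 / (2 * η) ≤ E * H * q := by
    have h10 : 1 / η = N ^ (2 / 5 * j : ℝ) * q := by
      rw [hη, hq, one_div, ← Real.rpow_neg hN0.le, ← Real.rpow_add hN0]
      ring_nf
    calc 1 / (2 * η) = 1 / η / 2 := by field_simp
      _ ≤ 1 / η := by linarith [show 0 < 1 / η by positivity]
      _ ≤ 2 ^ j * (M : ℝ) ^ j * q := h10.le.trans hAq
      _ ≤ E * H * q := by
          gcongr
          nlinarith
  refine hmain.trans ?_
  have hHq : 0 < H * q := by positivity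
  have hEHq : H * q ≤ E * H * q := by nlinarith
  have h11 : (2 * α * H + 2) * (2 * η / α + 1) + 1 / (2 * η) ≤ 40 * (E * H * q) := by
    have h12 : (2 * α * H + 2) * (2 * η / α + 1) = 4 * (η * H) + 2 * (α * H) + 4 * η / α + 2 := by
      field_simp
      ring
    have h13 : η * H ≤ E * H * q := by
      calc η * H ≤ q * H := by gcongr
        _ ≤ _ := by linarith
    have h14 : 2 * (α * H) ≤ E * H * q := by
      calc 2 * (α * H) ≤ 2 * (q / 2 * H) := by gcongr
        _ ≤ _ := by linarith
    rw [h12]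
    linarith
  calc (2 * H + 1) * ((2 * α * H + 2) * (2 * η / α + 1) + 1 / (2 * η)) ≤
      3 * H * (40 * (E * H * q)) := by
        gcongr
        linarith
    _ = _ := by ring

lemma le_card_good (hl : 1 / 2 ≤ l) (hk : 4 * l ≤ k) :
    l ≤ (#{j : Fin k | 2 * l ≤ (j + 1 : ℕ) ∧ (j + 1 : ℕ) ≤ 4 * l} : ℕ) := by
  set a := ⌈2 * l⌉₊ with ha
  set b := ⌊4 * l⌋₊ with hb
  have hbk : b ≤ k := by
    have : (b : ℝ) ≤ 4 * l := Nat.floor_le (by linarith)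
    exact_mod_cast this.trans hk
  have ha1 : 2 * l ≤ a := Nat.le_ceil _
  have ha2 : (a : ℝ) < 2 * l + 1 := Nat.ceil_lt_add_one (by linarith)
  have hb1 : (b : ℝ) ≤ 4 * l := Nat.floor_le (by linarith)
  have hb2 : 4 * l < b + 1 := Nat.lt_floor_add_one _
  have ha0 : 1 ≤ a := by
    have : (0 : ℝ) < a := by linarith
    exact_mod_cast this
  have hcard : b + 1 - a ≤ #{j : Fin k | 2 * l ≤ (j + 1 : ℕ) ∧ (j + 1 : ℕ) ≤ 4 * l} := by
    rw [← Nat.card_Icc, ← Finset.card_map ⟨fun j : Fin k => (j : ℕ) + 1, fun x y h => by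
      apply Fin.ext; simpa using h⟩]
    apply card_le_card
    intro j hj
    rw [mem_Icc] at hj
    rw [mem_map]
    have h1 : (a : ℝ) ≤ j := by exact_mod_cast hj.1
    have h2 : (j : ℝ) ≤ b := by exact_mod_cast hj.2
    refine ⟨⟨j - 1, by omega⟩, ?_, ?_⟩
    · rw [mem_filter]
      refine ⟨mem_univ _, ?_⟩
      rw [show ((⟨j - 1, by omega⟩ : Fin k) : ℕ) + 1 = j from Nat.sub_add_cancel (by omega)]
      constructor <;> linarith
    · exact Nat.sub_add_cancel (by omega)
  refine le_trans ?_ (Nat.cast_le.2 hcard)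
  have hab : a ≤ b := by
    rw [hb, Nat.le_floor_iff (by linarith)]
    rcases le_or_gt l 1 with h | h
    · have h1 : a ≤ 2 := by
        rw [ha, Nat.ceil_le]
        push_cast
        linarith
      have : (a : ℝ) ≤ 2 := by exact_mod_cast h1
      linarith
    · linarith
  rw [Nat.cast_sub (by omega)]
  push_cast
  rcases le_or_gt l 1 with h | h
  · have : (a : ℝ) ≤ b := by exact_mod_cast hab
    linarith
  · linarith

/-- The Taylor coefficients of the phase. -/
noncomputable def phaseCoeff (k : ℕ) (t n : ℝ) : Fin k → ℝ := fun j =>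
  -(t / (2 * Real.pi)) * ((-1) ^ (j : ℕ) / ((j + 1 : ℕ) * n ^ (j + 1 : ℕ)))

lemma sum_norm_phaseCoeff (j : Fin k) (H : ℕ) :
    ∑ μ ∈ Icc (-H : ℤ) H, ‖∑ ν ∈ Icc (-H : ℤ) H, ex (phaseCoeff k t n j * μ * ν)‖ =
    ∑ μ ∈ Icc (-H : ℤ) H, ‖∑ ν ∈ Icc (-H : ℤ) H,
      ex (t / (2 * Real.pi * (j + 1 : ℕ) * n ^ (j + 1 : ℕ)) * μ * ν)‖ := by
  rcases neg_one_pow_eq_or ℝ (j : ℕ) with h | h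
  · rw [phaseCoeff, h, ← sum_norm_geom_neg]
    refine sum_congr rfl fun μ _ => ?_
    congr 1
    refine sum_congr rfl fun ν _ => ?_
    congr 1
    field_simp
  · rw [phaseCoeff, h]
    refine sum_congr rfl fun μ _ => ?_
    congr 1
    refine sum_congr rfl fun ν _ => ?_
    congr 1
    field_simp

lemma prod_spacing_le (hN : 1 ≤ N) (hl : 1 / 2 ≤ l) (ht : t = N ^ l)
    (hM : N ^ (2 / 5 : ℝ) ≤ 2 * M) (hM0 : M ≠ 0)
    (hn : N ≤ n) (hn2 : n ≤ 2 * N) (hks : k ≤ s) (hk : 4 * l ≤ k) (hs : s ≠ 0) :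
    ∏ j : Fin k, ∑ μ ∈ Icc (-(s * M ^ (j + 1 : ℕ) : ℤ)) (s * M ^ (j + 1 : ℕ)),
      ‖∑ ν ∈ Icc (-(s * M ^ (j + 1 : ℕ) : ℤ)) (s * M ^ (j + 1 : ℕ)),
        ex (phaseCoeff k t n j * μ * ν)‖ ≤
    (120 * 4 ^ k * (s : ℝ) ^ 2) ^ k * (M : ℝ) ^ (k * (k + 1)) * N ^ (-l ^ 2 / 10) := by
  have hN0 : 0 < N := by linarith
  have hM1 : (1 : ℝ) ≤ M := by exact_mod_cast Nat.one_le_iff_ne_zero.2 hM0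
  have hs1 : (1 : ℝ) ≤ s := by exact_mod_cast Nat.one_le_iff_ne_zero.2 hs
  have h4 : (1 : ℝ) ≤ 4 ^ k := one_le_pow₀ (by norm_num)
  calc _ ≤ ∏ j : Fin k, ((120 * 4 ^ k * (s : ℝ) ^ 2) * ((M : ℝ) ^ (2 * (j + 1 : ℕ)) *
        if 2 * l ≤ (j + 1 : ℕ) ∧ (j + 1 : ℕ) ≤ 4 * l then N ^ (-l / 10) else 1)) := by
        refine prod_le_prod (fun _ _ => sum_nonneg fun _ _ => norm_nonneg _) fun j _ => ?_
        have h1 := sum_norm_phaseCoeff (t := t) (n := n) j (s * M ^ (j + 1 : ℕ))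
        have h2 := sum_norm_geom_trivial (phaseCoeff k t n j) (s * M ^ (j + 1 : ℕ))
        have hcast : ((s * M ^ (j + 1 : ℕ) : ℕ) : ℤ) = (s * M ^ (j + 1 : ℕ) : ℤ) := by push_cast; ring
        rw [hcast] at h1 h2
        have hH1 : (1 : ℝ) ≤ s * (M : ℝ) ^ (j + 1 : ℕ) :=
          one_le_mul_of_one_le_of_one_le hs1 (one_le_pow₀ hM1)
        split_ifs with hj
        · rw [h1]
          have h3 := sum_norm_geom_good (k := k) (s := s) hN hl ht hM hn hn2
            (by omega : 1 ≤ (j + 1 : ℕ)) (by omega) (by omega) hj.1 hj.2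
          rw [hcast] at h3
          refine h3.trans_eq ?_
          rw [mul_pow, ← pow_mul, mul_comm (j + 1 : ℕ) 2]
          ring
        · refine h2.trans ?_
          push_cast
          calc (2 * (s * (M : ℝ) ^ (j + 1 : ℕ)) + 1) ^ 2 ≤ (3 * (s * (M : ℝ) ^ (j + 1 : ℕ))) ^ 2 := by
                gcongr
                linarith
            _ = 9 * 1 * (s : ℝ) ^ 2 * ((M : ℝ) ^ (2 * (j + 1 : ℕ)) * 1) := by
                rw [mul_pow, mul_pow, ← pow_mul, mul_comm (j + 1 : ℕ) 2]
                ring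
            _ ≤ _ := by
                gcongr
                norm_num
    _ = (120 * 4 ^ k * (s : ℝ) ^ 2) ^ k * (M : ℝ) ^ (k * (k + 1)) * (N ^ (-l / 10)) ^
        (#{j : Fin k | 2 * l ≤ (j + 1 : ℕ) ∧ (j + 1 : ℕ) ≤ 4 * l} : ℕ) := by
        have hsum : ∑ j : Fin k, 2 * ((j : ℕ) + 1) = k * (k + 1) := by
          rw [Fin.sum_univ_eq_sum_range (fun i => 2 * (i + 1)), ← mul_sum]
          have h5 := sum_range_id_mul_two (k + 1)
          rw [sum_range_succ'] at h5
          simp only [add_zero, Nat.add_sub_cancel] at h5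
          rw [mul_comm, h5, mul_comm]
        rw [prod_mul_distrib, prod_const, card_univ, Fintype.card_fin, prod_mul_distrib,
          prod_pow_eq_pow_sum, ← prod_filter, prod_const, hsum]
        ring
    _ ≤ _ := by
        gcongr
        rw [← Real.rpow_natCast, ← Real.rpow_mul hN0.le]
        apply Real.rpow_le_rpow_of_exponent_le hN
        have := le_card_good hl hk
        nlinarith

end Parameters

end VinogradovKorobov

namespace VinogradovKorobov

open Finset

section BilinearBound

/-- The constant in the saving `N ^ (-c / l ^ 2)` for Vinogradov's exponential sum. -/
noncomputable def savingConst : ℝ := 1 / 668168000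

lemma savingConst_pos : 0 < savingConst := by norm_num [savingConst]

variable {k M : ℕ} {N l t n : ℝ}

lemma one_sub_inv_pow_le (hk : 1 ≤ k) : (1 - 1 / (k : ℝ)) ^ (9 * k) ≤ 1 / 2584 := by
  have hk0 : (0 : ℝ) < k := by exact_mod_cast hk
  have h1 : 1 - 1 / (k : ℝ) ≤ Real.exp (-(1 / k)) := by
    have := Real.add_one_le_exp (-(1 / (k : ℝ)))
    linarith
  have h0 : 0 ≤ 1 - 1 / (k : ℝ) := by
    rw [sub_nonneg, div_le_one hk0]
    exact_mod_cast hk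
  calc (1 - 1 / (k : ℝ)) ^ (9 * k) ≤ Real.exp (-(1 / k)) ^ (9 * k) := by gcongr
    _ = (Real.exp 1 ^ 9)⁻¹ := by
      rw [← Real.exp_nat_mul, ← Real.exp_nat_mul, ← Real.exp_neg]
      congr 1
      push_cast
      field_simp
    _ ≤ _ := by
      rw [inv_eq_one_div]
      apply one_div_le_one_div_of_le (by norm_num)
      calc (2584 : ℝ) ≤ 2.7 ^ 9 := by norm_num
        _ ≤ _ := by
          gcongr
          exact (by norm_num : (2.7 : ℝ) ≤ 2.7182818283).trans Real.exp_one_gt_d9.le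

lemma const_pow_le (hk : 8 ≤ k) :
    ((k : ℝ) ^ (k ^ 3 + 7 * (k * (k + 9 * k)) * (9 * k))) ^ 2 *
      (120 * 4 ^ k * ((k * (k + 9 * k) : ℕ) : ℝ) ^ 2) ^ k ≤
    (k : ℝ) ^ (2 * (k * (k + 9 * k)) * (2 * (k * (k + 9 * k)))) := by
  have hk8 : (8 : ℝ) ≤ k := by exact_mod_cast hk
  have h1 : 120 * 4 ^ k * ((k * (k + 9 * k) : ℕ) : ℝ) ^ 2 ≤ (k : ℝ) ^ (k + 9) := by
    push_cast
    calc 120 * 4 ^ k * ((k : ℝ) * (k + 9 * k)) ^ 2 = 12000 * 4 ^ k * (k : ℝ) ^ 4 := by ring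
      _ ≤ (k : ℝ) ^ 5 * k ^ k * k ^ 4 := by
        gcongr
        · calc (12000 : ℝ) ≤ 8 ^ 5 := by norm_num
            _ ≤ _ := by gcongr
        · linarith
      _ = _ := by ring
  calc _ ≤ ((k : ℝ) ^ (k ^ 3 + 7 * (k * (k + 9 * k)) * (9 * k))) ^ 2 * ((k : ℝ) ^ (k + 9)) ^ k := by
        gcongr
    _ = (k : ℝ) ^ ((k ^ 3 + 7 * (k * (k + 9 * k)) * (9 * k)) * 2 + (k + 9) * k) := by
        rw [← pow_mul, ← pow_mul, pow_add]
    _ ≤ _ := by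
        apply pow_le_pow_right₀ (by linarith)
        obtain ⟨m, rfl⟩ := Nat.exists_eq_add_of_le hk
        ring_nf
        nlinarith

set_option maxHeartbeats 1000000 in
lemma bilinear_numerics {s : ℕ} {T J P ρ E : ℝ} (hN : 1 ≤ N) (hl : 1 / 2 ≤ l)
    (hM1 : (1 : ℝ) ≤ M) (hMN : M ≤ N ^ (2 / 5 : ℝ)) (hk : 5 * l + 5 ≤ k) (hk2 : k ≤ 5 * l + 6)
    (hs : s = k * (k + 9 * k)) (hρ0 : 0 ≤ ρ) (hρ1 : ρ ≤ 1 / 2584)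
    (hE : E = 2 * s - k * (k + 1) / 2 * (1 - ρ)) (hJ0 : 0 ≤ J) (hP0 : 0 ≤ P)
    (hT : T ^ (2 * s * (2 * s)) ≤ (M : ℝ) ^ (2 * (2 * s * (2 * s - 1))) * J ^ 2 * P)
    (hJ : J ≤ (k : ℝ) ^ (k ^ 3 + 7 * s * (9 * k)) * (M : ℝ) ^ E)
    (hP : P ≤ (120 * 4 ^ k * (s : ℝ) ^ 2) ^ k * (M : ℝ) ^ (k * (k + 1)) * N ^ (-l ^ 2 / 10)) :
    T ≤ (M : ℝ) ^ 2 * k * N ^ (-savingConst / l ^ 2) := by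
  have hN0 : 0 < N := by linarith
  have hMpos : (0 : ℝ) < M := by linarith
  have hk8 : 8 ≤ k := by
    have : (7 : ℝ) < k := by linarith
    exact_mod_cast this
  have hk8' : (8 : ℝ) ≤ k := by exact_mod_cast hk8
  have hl0 : 0 < l := by linarith
  have hs' : s = 10 * k ^ 2 := by rw [hs]; ring
  have hs0 : s ≠ 0 := by rw [hs']; positivity
  have hsr : (s : ℝ) = 10 * k ^ 2 := by rw [hs']; push_cast; ring
  have hc := const_pow_le hk8
  rw [← hs] at hc
  clear hs
  have hpow : (M : ℝ) ^ (2 * (2 * s * (2 * s - 1))) * ((M : ℝ) ^ E) ^ 2 *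
      (M : ℝ) ^ (k * (k + 1)) = (M : ℝ) ^ (2 * (2 * s * (2 * s))) * (M : ℝ) ^ (k * (k + 1) * ρ : ℝ) := by
    rw [← Real.rpow_natCast, ← Real.rpow_natCast, ← Real.rpow_natCast, ← Real.rpow_natCast,
      ← Real.rpow_mul hMpos.le, ← Real.rpow_add hMpos, ← Real.rpow_add hMpos,
      ← Real.rpow_add hMpos]
    congr 1
    have h2s : ((2 * s - 1 : ℕ) : ℝ) = 2 * s - 1 := by
      rw [Nat.cast_sub (by omega)]; push_cast; ring
    rw [hE]
    push_cast [h2s]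
    ring
  have hMρ : (M : ℝ) ^ (k * (k + 1) * ρ : ℝ) ≤ N ^ (l ^ 2 / 20) := by
    calc (M : ℝ) ^ (k * (k + 1) * ρ : ℝ) ≤ (M : ℝ) ^ (l ^ 2 / 8 : ℝ) := by
          apply Real.rpow_le_rpow_of_exponent_le hM1
          calc (k : ℝ) * (k + 1) * ρ ≤ (17 * l) * (19 * l) * (1 / 2584) := by
                gcongr <;> linarith
            _ = _ := by ring
      _ ≤ (N ^ (2 / 5 : ℝ)) ^ (l ^ 2 / 8 : ℝ) := by gcongr
      _ = _ := by
          rw [← Real.rpow_mul hN0.le]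
          congr 1
          ring
  have hsave : N ^ (-l ^ 2 / 20) ≤ (N ^ (-savingConst / l ^ 2)) ^ (2 * s * (2 * s)) := by
    rw [← Real.rpow_mul_natCast hN0.le]
    apply Real.rpow_le_rpow_of_exponent_le hN
    rw [savingConst]
    push_cast
    rw [hsr, neg_div, neg_div, neg_mul, neg_le_neg_iff, div_mul_eq_mul_div,
      div_le_iff₀ (by positivity)]
    have h17 : (k : ℝ) ≤ 17 * l := by linarith
    have : (k : ℝ) ^ 4 ≤ (17 * l) ^ 4 := by gcongr
    nlinarith
  have hW0 : 0 ≤ N ^ (-savingConst / l ^ 2) := by positivity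
  generalize N ^ (-savingConst / l ^ 2) = W at *
  have hW : 0 ≤ N ^ (-l ^ 2 / 10) := by positivity
  have hX : T ^ (2 * s * (2 * s)) ≤ ((M : ℝ) ^ 2 * k * W) ^ (2 * s * (2 * s)) := by
    calc _ ≤ _ := hT
      _ ≤ (M : ℝ) ^ (2 * (2 * s * (2 * s - 1))) *
          ((k : ℝ) ^ (k ^ 3 + 7 * s * (9 * k)) * (M : ℝ) ^ E) ^ 2 *
          ((120 * 4 ^ k * (s : ℝ) ^ 2) ^ k * (M : ℝ) ^ (k * (k + 1)) * N ^ (-l ^ 2 / 10)) := by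
          gcongr
      _ = (((k : ℝ) ^ (k ^ 3 + 7 * s * (9 * k))) ^ 2 * (120 * 4 ^ k * (s : ℝ) ^ 2) ^ k) *
          ((M : ℝ) ^ (2 * (2 * s * (2 * s - 1))) * ((M : ℝ) ^ E) ^ 2 *
      (M : ℝ) ^ (k * (k + 1))) * N ^ (-l ^ 2 / 10) := by
          rw [mul_pow]
          generalize (k : ℝ) ^ (k ^ 3 + 7 * s * (9 * k)) = a1
          generalize (M : ℝ) ^ (2 * (2 * s * (2 * s - 1))) = a2
          generalize (M : ℝ) ^ E = a3
          generalize (M : ℝ) ^ (k * (k + 1)) = a4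
          generalize (120 * 4 ^ k * (s : ℝ) ^ 2) ^ k = a5
          ring
      _ ≤ (k : ℝ) ^ (2 * s * (2 * s)) *
          ((M : ℝ) ^ (2 * (2 * s * (2 * s))) * N ^ (l ^ 2 / 20)) * N ^ (-l ^ 2 / 10) := by
          rw [hpow]
          gcongr
      _ = (k : ℝ) ^ (2 * s * (2 * s)) *
          ((M : ℝ) ^ (2 * (2 * s * (2 * s)))) * N ^ (-l ^ 2 / 20) := by
          have : N ^ (-l ^ 2 / 20) = N ^ (l ^ 2 / 20) * N ^ (-l ^ 2 / 10) := by
            rw [← Real.rpow_add hN0]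
            congr 1
            ring
          rw [this]
          simp only [mul_assoc]
      _ ≤ (k : ℝ) ^ (2 * s * (2 * s)) *
          ((M : ℝ) ^ (2 * (2 * s * (2 * s)))) * W ^ (2 * s * (2 * s)) := by
          gcongr
      _ = _ := by
          rw [mul_pow, mul_pow, ← pow_mul]
          generalize 2 * s * (2 * s) = q
          ring
  exact le_of_pow_le_pow_left₀ (by positivity) (by positivity) hX

lemma norm_bilinear_le (hN : 1 ≤ N) (hl : 1 / 2 ≤ l) (ht : t = N ^ l)
    (hM : N ^ (2 / 5 : ℝ) ≤ 2 * M) (hM0 : M ≠ 0) (hMN : M ≤ N ^ (2 / 5 : ℝ))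
    (hn : N ≤ n) (hn2 : n ≤ 2 * N) (hk : 5 * l + 5 ≤ k) (hk2 : k ≤ 5 * l + 6) :
    ‖∑ x ∈ Icc (1 : ℤ) M, ∑ y ∈ Icc (1 : ℤ) M,
      ex (∑ j : Fin k, phaseCoeff k t n j * x ^ (j + 1 : ℕ) * y ^ (j + 1 : ℕ))‖ ≤
    (M : ℝ) ^ 2 * k * N ^ (-savingConst / l ^ 2) := by
  have hM1 : (1 : ℝ) ≤ M := by exact_mod_cast Nat.one_le_iff_ne_zero.2 hM0
  have hk8 : 8 ≤ k := by
    have : (7 : ℝ) < k := by linarith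
    exact_mod_cast this
  have hs' : k * (k + 9 * k) = 10 * k ^ 2 := by ring
  obtain ⟨s, hs⟩ : ∃ s, s = k * (k + 9 * k) := ⟨_, rfl⟩
  have hs0 : s ≠ 0 := by rw [hs]; positivity
  have hks : k ≤ s := by rw [hs, hs']; nlinarith
  have hk1 : 1 / (k : ℝ) ≤ 1 := by
    rw [div_le_one (by positivity)]
    exact_mod_cast (by omega : 1 ≤ k)
  have hJ := vmv_le (k := k) (by omega) (9 * k)
    (by rw [hs']; nlinarith [Nat.pow_le_pow_left hk8 2]) M hM0
  rw [← hs] at hJ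
  refine bilinear_numerics hN hl hM1 hMN hk hk2 hs (pow_nonneg (sub_nonneg.2 hk1) _)
    (one_sub_inv_pow_le (by omega)) ?_ (Nat.cast_nonneg (vmv s k (Icc (1 : ℤ) M)))
    (prod_nonneg fun _ _ => sum_nonneg fun _ _ => norm_nonneg _)
    (bilinear_pow_le (phaseCoeff k t n) M hs0) hJ
    (prod_spacing_le (k := k) (s := s) hN hl ht hM hM0 hn hn2 hks (by linarith) hs0)
  rw [mvExp, hs]
  push_cast
  ring

end BilinearBound

end VinogradovKorobov

namespace VinogradovKorobov

open Finset

section ExponentialSum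

lemma norm_sum_sub_sum_shift_le {g : ℕ → ℂ} (hg : ∀ n, ‖g n‖ ≤ 1) {a b : ℕ} (hab : a ≤ b) (h : ℕ) :
    ‖∑ n ∈ Ioc a b, g n - ∑ n ∈ Ioc a b, g (n + h)‖ ≤ 2 * h := by
  induction h with
  | zero => simp
  | succ h ih =>
    have h1 : ∑ n ∈ Ioc a b, g (n + h) - ∑ n ∈ Ioc a b, g (n + (h + 1)) =
        g (a + 1 + h) - g (b + 1 + h) := by
      clear ih
      induction b, hab using Nat.le_induction with
      | base => simp
      | succ b hab ih2 =>
        rw [sum_Ioc_succ_top (by omega), sum_Ioc_succ_top (by omega)]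
        rw [add_sub_add_comm, ih2, show b + 1 + (h + 1) = b + 1 + 1 + h by ring]
        ring
    calc _ = ‖(∑ n ∈ Ioc a b, g n - ∑ n ∈ Ioc a b, g (n + h)) +
          (g (a + 1 + h) - g (b + 1 + h))‖ := by
          rw [← h1]
          congr 1
          ring
      _ ≤ 2 * h + (1 + 1) := by
          refine (norm_add_le _ _).trans (add_le_add ih ((norm_sub_le _ _).trans ?_))
          exact add_le_add (hg _) (hg _)
      _ = _ := by push_cast; ring

/-- The phase `n ↦ n ^ (-i t)`, as a value of the additive character. -/
noncomputable def logPhase (t u : ℝ) : ℂ := ex (-(t / (2 * Real.pi)) * Real.log u)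

lemma logPhase_eq_cpow (t : ℝ) {n : ℕ} (hn : n ≠ 0) : logPhase t n = (n : ℂ) ^ (-(t * Complex.I)) := by
  have hn' : (n : ℂ) ≠ 0 := by exact_mod_cast hn
  rw [logPhase, ex, Complex.cpow_def_of_ne_zero hn', ← Complex.natCast_log]
  congr 1
  have : (Real.pi : ℂ) ≠ 0 := by exact_mod_cast Real.pi_ne_zero
  push_cast
  field_simp

lemma norm_logPhase_sub_le {t n z : ℝ} (ht : 0 ≤ t) (hn : 0 < n) (hz : 0 ≤ z) (hzn : z ≤ n / 2) (k : ℕ) :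
    ‖logPhase t (n + z) - logPhase t n * ex (∑ j : Fin k, phaseCoeff k t n j * z ^ (j + 1 : ℕ))‖ ≤
      2 * t * (z / n) ^ (k + 1) := by
  have hw : z / n ≤ 1 / 2 := by
    rw [div_le_div_iff₀ hn (by norm_num)]
    linarith
  have hw0 : 0 ≤ z / n := by positivity
  have habs : |(-(z / n))| = z / n := by rw [abs_neg, abs_of_nonneg hw0]
  have hlog := Real.abs_log_sub_add_sum_range_le (x := -(z / n)) (by rw [habs]; linarith) k
  rw [habs, sub_neg_eq_add] at hlog
  have h1 : Real.log (n + z) = Real.log n + Real.log (1 + z / n) := by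
    rw [← Real.log_mul (by positivity) (by positivity)]
    congr 1
    field_simp
  have h2 : ∑ j : Fin k, phaseCoeff k t n j * z ^ (j + 1 : ℕ) =
      (t / (2 * Real.pi)) * ∑ i ∈ range k, (-(z / n)) ^ (i + 1) / (i + 1) := by
    rw [← Fin.sum_univ_eq_sum_range (fun i => (-(z / n)) ^ (i + 1) / ((i : ℝ) + 1)), mul_sum]
    refine sum_congr rfl fun j _ => ?_
    rw [phaseCoeff, neg_pow (z / n), div_pow, pow_succ (-1 : ℝ)]
    push_cast
    field_simp
  rw [logPhase, logPhase, ← ex_add, h1, h2]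
  refine (norm_ex_sub_le _ _).trans ?_
  have h3 : -(t / (2 * Real.pi)) * (Real.log n + Real.log (1 + z / n)) -
      (-(t / (2 * Real.pi)) * Real.log n +
        (t / (2 * Real.pi)) * ∑ i ∈ range k, (-(z / n)) ^ (i + 1) / (i + 1)) =
      -(t / (2 * Real.pi)) * ((∑ i ∈ range k, (-(z / n)) ^ (i + 1) / (i + 1)) + Real.log (1 + z / n)) := by
    ring
  rw [h3, abs_mul, abs_neg, abs_of_nonneg (by positivity)]
  calc 2 * Real.pi * (t / (2 * Real.pi) * _) ≤ 2 * Real.pi * (t / (2 * Real.pi) *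
        ((z / n) ^ (k + 1) / (1 / 2))) := by
        gcongr
        refine hlog.trans ?_
        gcongr
        linarith
    _ = _ := by
        field_simp

lemma norm_sum_logPhase_shift_le {N l t n : ℝ} {k M : ℕ} (hN : 1 ≤ N) (hl : 1 / 2 ≤ l) (ht : t = N ^ l)
    (hM : N ^ (2 / 5 : ℝ) ≤ 2 * M) (hM0 : M ≠ 0) (hMN : M ≤ N ^ (2 / 5 : ℝ))
    (hN32 : 32 ≤ N)
    (hn : N ≤ n) (hn2 : n ≤ 2 * N) (hk : 5 * l + 5 ≤ k) (hk2 : k ≤ 5 * l + 6) :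
    ‖∑ x ∈ Icc (1 : ℤ) M, ∑ y ∈ Icc (1 : ℤ) M, logPhase t (n + x * y)‖ ≤
      (M : ℝ) ^ 2 * (k * N ^ (-savingConst / l ^ 2) + 2 / N) := by
  have hN0 : 0 < N := by linarith
  have hn0 : 0 < n := by linarith
  have ht0 : 0 ≤ t := by rw [ht]; positivity
  have hB := norm_bilinear_le hN hl ht hM hM0 hMN hn hn2 hk hk2
  have hdecay : (1 / 2 : ℝ) ≥ N ^ (-(1 / 5) : ℝ) := by
    calc N ^ (-(1 / 5) : ℝ) ≤ 32 ^ (-(1 / 5) : ℝ) :=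
          Real.rpow_le_rpow_of_nonpos (by norm_num) hN32 (by norm_num)
      _ = ((2 : ℝ) ^ (5 : ℝ)) ^ (-(1 / 5) : ℝ) := by norm_num
      _ = 1 / 2 := by rw [← Real.rpow_mul (by norm_num)]; norm_num [Real.rpow_neg_one]
  have hpt : ∀ x ∈ Icc (1 : ℤ) M, ∀ y ∈ Icc (1 : ℤ) M,
      ‖logPhase t (n + x * y) - logPhase t n *
        ex (∑ j : Fin k, phaseCoeff k t n j * x ^ (j + 1 : ℕ) * y ^ (j + 1 : ℕ))‖ ≤ 2 / N := by
    intro x hx y hy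
    rw [mem_Icc] at hx hy
    have hx0 : (0 : ℝ) ≤ x := by exact_mod_cast (by omega : 0 ≤ x)
    have hy0 : (0 : ℝ) ≤ y := by exact_mod_cast (by omega : 0 ≤ y)
    have hxM : (x : ℝ) ≤ M := by exact_mod_cast hx.2
    have hyM : (y : ℝ) ≤ M := by exact_mod_cast hy.2
    have hz : (x : ℝ) * y / n ≤ N ^ (-(1 / 5) : ℝ) := by
      calc (x : ℝ) * y / n ≤ N ^ (2 / 5 : ℝ) * N ^ (2 / 5 : ℝ) / N := by
            gcongr
            · exact hxM.trans hMN
            · exact hyM.trans hMN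
        _ = N ^ (2 / 5 + 2 / 5 - 1 : ℝ) := by
            rw [Real.rpow_sub hN0, Real.rpow_add hN0, Real.rpow_one]
        _ = _ := by norm_num
    have hz2 : (x : ℝ) * y ≤ n / 2 := by
      have := hz.trans hdecay
      rw [div_le_div_iff₀ hn0 (by norm_num)] at this
      linarith
    have h1 := norm_logPhase_sub_le ht0 hn0 (mul_nonneg hx0 hy0) hz2 k
    simp only [mul_pow, ← mul_assoc] at h1
    refine h1.trans ?_
    calc 2 * t * ((x : ℝ) * y / n) ^ (k + 1) ≤ 2 * t * (N ^ (-(1 / 5) : ℝ)) ^ (k + 1) := by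
          gcongr
      _ = 2 * N ^ (l - 1 / 5 * (k + 1)) := by
          rw [ht, ← Real.rpow_mul_natCast hN0.le, mul_assoc, ← Real.rpow_add hN0]
          push_cast
          ring_nf
      _ ≤ 2 * N ^ (-1 : ℝ) := by
          gcongr 2 * ?_
          apply Real.rpow_le_rpow_of_exponent_le hN
          linarith
      _ = _ := by rw [Real.rpow_neg_one]; ring
  have hcard : (#(Icc (1 : ℤ) M) : ℝ) = M := by simp
  calc _ = ‖logPhase t n * ∑ x ∈ Icc (1 : ℤ) M, ∑ y ∈ Icc (1 : ℤ) M,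
        ex (∑ j : Fin k, phaseCoeff k t n j * x ^ (j + 1 : ℕ) * y ^ (j + 1 : ℕ)) +
        ∑ x ∈ Icc (1 : ℤ) M, ∑ y ∈ Icc (1 : ℤ) M, (logPhase t (n + x * y) - logPhase t n *
        ex (∑ j : Fin k, phaseCoeff k t n j * x ^ (j + 1 : ℕ) * y ^ (j + 1 : ℕ)))‖ := by
        congr 1
        simp only [sum_sub_distrib, mul_sum]
        ring
    _ ≤ 1 * ((M : ℝ) ^ 2 * k * N ^ (-savingConst / l ^ 2)) + ∑ x ∈ Icc (1 : ℤ) M, ∑ y ∈ Icc (1 : ℤ) M, 2 / N := by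
        refine (norm_add_le _ _).trans (add_le_add ?_ ?_)
        · rw [norm_mul, logPhase, norm_ex]
          gcongr
        · refine norm_sum_le_of_le _ fun x hx => norm_sum_le_of_le _ fun y hy => hpt x hx y hy
    _ = _ := by
        rw [sum_const, sum_const, smul_smul, nsmul_eq_mul, Nat.cast_mul, hcard]
        ring

/-- Vinogradov's estimate for the zeta exponential sum over a dyadic block. -/
theorem norm_sum_cpow_le {t : ℝ} {N N' : ℕ} (ht : 0 < t) (hN : 32 ≤ N) (hNt : (N : ℝ) ≤ t ^ 2)
    (hNN' : N ≤ N') (hN' : N' ≤ 2 * N) :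
    ‖∑ n ∈ Ioc N N', (n : ℂ) ^ (-(t * Complex.I))‖ ≤
      25 * (Real.log t / Real.log N) *
        (N : ℝ) ^ (1 - savingConst * (Real.log N / Real.log t) ^ 2) := by
  have hN32 : (32 : ℝ) ≤ N := by exact_mod_cast hN
  have hN0 : (0 : ℝ) < N := by linarith
  have hlogN : 0 < Real.log N := Real.log_pos (by linarith)
  set l := Real.log t / Real.log N with hldef
  have hl : 1 / 2 ≤ l := by
    rw [hldef, div_le_div_iff₀ (by norm_num) hlogN]
    have := Real.log_le_log hN0 hNt
    rw [Real.log_pow] at this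
    push_cast at this
    linarith
  have hl0 : 0 < l := by linarith
  have htl : t = (N : ℝ) ^ l := by
    rw [Real.rpow_def_of_pos hN0, hldef, mul_div_cancel₀ _ hlogN.ne', Real.exp_log ht]
  have hexp : savingConst * (Real.log N / Real.log t) ^ 2 = savingConst / l ^ 2 := by
    rw [hldef, div_pow, div_pow]
    field_simp
  obtain ⟨k, hk, hk2⟩ : ∃ k : ℕ, 5 * l + 5 ≤ k ∧ (k : ℝ) ≤ 5 * l + 6 :=
    ⟨⌈5 * l + 5⌉₊, Nat.le_ceil _, by
      have := Nat.ceil_lt_add_one (by positivity : 0 ≤ 5 * l + 5)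
      linarith⟩
  obtain ⟨M, hM, hM0, hMN⟩ : ∃ M : ℕ, (N : ℝ) ^ (2 / 5 : ℝ) ≤ 2 * M ∧ M ≠ 0 ∧ (M : ℝ) ≤ (N : ℝ) ^ (2 / 5 : ℝ) := by
    have h1 : (1 : ℝ) ≤ (N : ℝ) ^ (2 / 5 : ℝ) := Real.one_le_rpow (by linarith) (by norm_num)
    have h2 : 1 ≤ ⌊(N : ℝ) ^ (2 / 5 : ℝ)⌋₊ := (Nat.one_le_floor_iff _).2 h1
    have h3 := Nat.lt_floor_add_one ((N : ℝ) ^ (2 / 5 : ℝ))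
    have h4 : (1 : ℝ) ≤ ⌊(N : ℝ) ^ (2 / 5 : ℝ)⌋₊ := by exact_mod_cast h2
    exact ⟨⌊(N : ℝ) ^ (2 / 5 : ℝ)⌋₊, by linarith, by omega, Nat.floor_le (by linarith)⟩
  have hMpos : (0 : ℝ) < M := by exact_mod_cast Nat.pos_of_ne_zero hM0
  have hM2 : (M : ℝ) ^ 2 ≤ (N : ℝ) ^ (4 / 5 : ℝ) := by
    calc (M : ℝ) ^ 2 ≤ ((N : ℝ) ^ (2 / 5 : ℝ)) ^ 2 := by gcongr
      _ = _ := by rw [← Real.rpow_mul_natCast hN0.le]; norm_num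
  set B := (N : ℝ) ^ (-savingConst / l ^ 2) with hB
  have hfun : ∑ n ∈ Ioc N N', (n : ℂ) ^ (-(t * Complex.I)) = ∑ n ∈ Ioc N N', logPhase t n :=
    sum_congr rfl fun n hn => (logPhase_eq_cpow t (by rw [mem_Ioc] at hn; omega)).symm
  rw [hfun, hexp]
  set S := ∑ n ∈ Ioc N N', logPhase t n with hS
  have hcard : (#(Icc (1 : ℤ) M) : ℝ) = M := by simp
  have hshift : ∀ x ∈ Icc (1 : ℤ) M, ∀ y ∈ Icc (1 : ℤ) M,
      ‖S - ∑ n ∈ Ioc N N', logPhase t (n + x * y)‖ ≤ 2 * (M : ℝ) ^ 2 := by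
    intro x hx y hy
    rw [mem_Icc] at hx hy
    obtain ⟨a, rfl⟩ := Int.eq_ofNat_of_zero_le (by omega : 0 ≤ x)
    obtain ⟨b, rfl⟩ := Int.eq_ofNat_of_zero_le (by omega : 0 ≤ y)
    have h1 := norm_sum_sub_sum_shift_le (g := fun n : ℕ => logPhase t n)
      (fun n => by rw [logPhase, norm_ex]) hNN' (a * b)
    push_cast at h1 ⊢
    refine h1.trans ?_
    have ha : (a : ℝ) ≤ M := by exact_mod_cast hx.2
    have hb : (b : ℝ) ≤ M := by exact_mod_cast hy.2
    rw [sq]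
    gcongr
  have hmain : (M : ℝ) ^ 2 * ‖S‖ ≤ (M : ℝ) ^ 2 * (2 * (M : ℝ) ^ 2 + N * (k * B + 2 / N)) := by
    calc (M : ℝ) ^ 2 * ‖S‖ = ‖∑ x ∈ Icc (1 : ℤ) M, ∑ y ∈ Icc (1 : ℤ) M, S‖ := by
          rw [sum_const, sum_const, smul_smul, nsmul_eq_mul, norm_mul, Complex.norm_natCast,
            Nat.cast_mul, hcard, sq]
      _ = ‖∑ x ∈ Icc (1 : ℤ) M, ∑ y ∈ Icc (1 : ℤ) M, (S - ∑ n ∈ Ioc N N', logPhase t (n + x * y)) +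
          ∑ n ∈ Ioc N N', ∑ x ∈ Icc (1 : ℤ) M, ∑ y ∈ Icc (1 : ℤ) M, logPhase t (n + x * y)‖ := by
          congr 1
          have : ∑ n ∈ Ioc N N', ∑ x ∈ Icc (1 : ℤ) M, ∑ y ∈ Icc (1 : ℤ) M, logPhase t (n + x * y) =
            ∑ x ∈ Icc (1 : ℤ) M, ∑ y ∈ Icc (1 : ℤ) M, ∑ n ∈ Ioc N N', logPhase t (n + x * y) := by
            rw [sum_comm]
            exact sum_congr rfl fun x _ => sum_comm
          rw [this]
          simp only [sum_sub_distrib]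
          ring
      _ ≤ ∑ x ∈ Icc (1 : ℤ) M, ∑ y ∈ Icc (1 : ℤ) M, 2 * (M : ℝ) ^ 2 +
          ∑ n ∈ Ioc N N', (M : ℝ) ^ 2 * (k * B + 2 / N) := by
          refine (norm_add_le _ _).trans (add_le_add ?_ ?_)
          · exact norm_sum_le_of_le _ fun x hx => norm_sum_le_of_le _ fun y hy => hshift x hx y hy
          · refine norm_sum_le_of_le _ fun n hn => ?_
            rw [mem_Ioc] at hn
            exact norm_sum_logPhase_shift_le (by linarith) hl htl hM hM0 hMN hN32
              (by exact_mod_cast hn.1.le) (by exact_mod_cast hn.2.trans hN') hk hk2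
      _ ≤ (M : ℝ) ^ 2 * (2 * (M : ℝ) ^ 2) + N * ((M : ℝ) ^ 2 * (k * B + 2 / N)) := by
          rw [sum_const, sum_const, sum_const, smul_smul, nsmul_eq_mul, nsmul_eq_mul,
            Nat.cast_mul, hcard, Nat.card_Ioc, ← sq]
          gcongr
          omega
      _ = _ := by ring
  have hS1 := le_of_mul_le_mul_left hmain (by positivity)
  have hNB : (N : ℝ) ^ (1 - savingConst / l ^ 2) = N * B := by
    rw [hB, sub_eq_add_neg, Real.rpow_add hN0, Real.rpow_one, neg_div]
  have h45 : (N : ℝ) ^ (4 / 5 : ℝ) ≤ N * B := by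
    rw [← hNB]
    apply Real.rpow_le_rpow_of_exponent_le (by linarith)
    have : savingConst / l ^ 2 ≤ 1 / 5 := by
      rw [div_le_div_iff₀ (by positivity) (by norm_num), savingConst]
      nlinarith
    linarith
  have h1B : 1 ≤ (N : ℝ) ^ (4 / 5 : ℝ) := Real.one_le_rpow (by linarith) (by norm_num)
  have hNN : (N : ℝ) * (2 / N) = 2 := by field_simp
  rw [hNB]
  calc ‖S‖ ≤ 2 * (M : ℝ) ^ 2 + N * (k * B + 2 / N) := hS1
    _ = 2 * (M : ℝ) ^ 2 + k * (N * B) + 2 := by rw [mul_add, hNN]; ring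
    _ ≤ 2 * (N * B) + (5 * l + 6) * (N * B) + 2 * (N * B) := by
        have : (k : ℝ) * (N * B) ≤ (5 * l + 6) * (N * B) := by gcongr
        linarith
    _ = (5 * l + 10) * (N * B) := by ring
    _ ≤ _ := by
        gcongr
        linarith

end ExponentialSum

end VinogradovKorobov

namespace VinogradovKorobov

open Finset Filter Topology

section ZetaTruncation

/-- `(s - 1) * ((n + 2)⁻ˢ - ∫ u in (n + 1)..(n + 2), u⁻ˢ)`, in closed form. -/
noncomputable def eulerTerm (n : ℕ) (s : ℂ) : ℂ :=
  (s - 1) * ((n + 1 : ℝ) + 1 : ℝ) ^ (-s) + ((n + 1 : ℝ) + 1 : ℝ) ^ (1 - s) - ((n + 1 : ℝ) : ℂ) ^ (1 - s)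

lemma norm_eulerTerm_le {s : ℂ} {a : ℝ} (ha : 0 < a) (has : a ≤ s.re) (n : ℕ) :
    ‖eulerTerm n s‖ ≤ ‖s‖ * ‖s - 1‖ / a * ((n + 1 : ℝ) ^ (-a) - (n + 1 + 1 : ℝ) ^ (-a)) := by
  set m : ℝ := n + 1 with hm
  have hm0 : 1 ≤ m := by rw [hm]; linarith [Nat.cast_nonneg (α := ℝ) n]
  set H : ℝ → ℂ := fun u => (s - 1) * ((u - m : ℝ) * (u : ℂ) ^ (-s)) + (u : ℂ) ^ (1 - s) - (m : ℂ) ^ (1 - s)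
    with hH
  set H' : ℝ → ℂ := fun u => -(s * (s - 1)) * ((u - m : ℝ) * (u : ℂ) ^ (-s - 1)) with hH'
  set K := ‖s‖ * ‖s - 1‖ / a with hK
  have hcpow : ∀ r : ℂ, ∀ u : ℝ, 1 ≤ u → HasDerivAt (fun u : ℝ => (u : ℂ) ^ r) (r * (u : ℂ) ^ (r - 1)) u := by
    intro r u hu
    have h1 : HasDerivAt (fun z : ℂ => z ^ r) (r * (u : ℂ) ^ (r - 1)) (u : ℂ) := by
      simpa using (hasDerivAt_id (u : ℂ)).cpow_const (c := r)
        (Or.inl (by simp; linarith))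
    exact h1.comp_ofReal
  have hderiv : ∀ u : ℝ, 1 ≤ u → HasDerivAt H (H' u) u := by
    intro u hu
    have h1 := hcpow (-s) u hu
    have h2 := hcpow (1 - s) u hu
    have h3 : HasDerivAt (fun u : ℝ => ((u - m : ℝ) : ℂ)) 1 u := by
      simpa using ((hasDerivAt_id u).sub_const m).ofReal_comp
    convert! (((h3.mul h1).const_mul (s - 1)).add h2).sub_const ((m : ℂ) ^ (1 - s)) using 1
    rw [hH', show 1 - s - 1 = -s by ring]
    ring
  have hB : ∀ u : ℝ, 1 ≤ u → HasDerivAt (fun u : ℝ => K * (m ^ (-a) - u ^ (-a)))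
      (‖s‖ * ‖s - 1‖ * u ^ (-a - 1)) u := by
    intro u hu
    have h1 := (Real.hasDerivAt_rpow_const (x := u) (p := -a) (Or.inl (by linarith)))
    convert! (h1.const_sub (m ^ (-a))).const_mul K using 1
    rw [hK]
    field_simp
  have key := image_norm_le_of_norm_deriv_right_le_deriv_boundary' (f := H) (f' := H') (a := m) (b := m + 1)
    (B := fun u => K * (m ^ (-a) - u ^ (-a))) (B' := fun u => ‖s‖ * ‖s - 1‖ * u ^ (-a - 1))
    (fun u hu => (hderiv u (hm0.trans hu.1)).continuousAt.continuousWithinAt)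
    (fun u hu => (hderiv u (hm0.trans hu.1)).hasDerivWithinAt) (by simp [hH])
    (fun u hu => (hB u (hm0.trans hu.1)).continuousAt.continuousWithinAt)
    (fun u hu => (hB u (hm0.trans hu.1)).hasDerivWithinAt) (fun u hu => ?_) (x := m + 1) (by simp)
  · simpa [hH, eulerTerm, ← hm] using key
  · have hu1 : 1 ≤ u := hm0.trans hu.1
    have hu0 : 0 < u := by linarith
    rw [hH', norm_mul, norm_neg, norm_mul, norm_mul, Complex.norm_cpow_eq_rpow_re_of_pos hu0,
      Complex.norm_real, Real.norm_of_nonneg (sub_nonneg.2 hu.1)]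
    have h5 : u ^ (-s - 1).re ≤ u ^ (-a - 1) := by
      apply Real.rpow_le_rpow_of_exponent_le hu1
      simp
      linarith
    have h6 : u - m ≤ 1 := by linarith [hu.2]
    calc ‖s‖ * ‖s - 1‖ * ((u - m) * u ^ (-s - 1).re) ≤ ‖s‖ * ‖s - 1‖ * (1 * u ^ (-a - 1)) := by
          gcongr
      _ = _ := by ring

lemma sum_range_rpow_sub {a : ℝ} (N M : ℕ) :
    ∑ n ∈ range M, (((n + N : ℕ) + 1 : ℝ) ^ (-a) - ((n + N : ℕ) + 1 + 1 : ℝ) ^ (-a)) =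
      (N + 1 : ℝ) ^ (-a) - (M + N + 1 : ℝ) ^ (-a) := by
  have := sum_range_sub' (fun n : ℕ => ((n + N : ℕ) + 1 : ℝ) ^ (-a)) M
  push_cast at this ⊢
  rw [zero_add] at this
  rw [← this]
  refine sum_congr rfl fun n _ => ?_
  ring_nf

lemma rpow_sub_nonneg {a : ℝ} (ha : 0 < a) (n : ℕ) :
    0 ≤ (n + 1 : ℝ) ^ (-a) - (n + 1 + 1 : ℝ) ^ (-a) := by
  rw [sub_nonneg]
  apply Real.rpow_le_rpow_of_nonpos (by positivity) (by linarith) (by linarith)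

lemma summable_rpow_sub {a : ℝ} (ha : 0 < a) :
    Summable fun n : ℕ => (n + 1 : ℝ) ^ (-a) - (n + 1 + 1 : ℝ) ^ (-a) := by
  refine summable_of_sum_range_le (c := 1) (rpow_sub_nonneg ha) fun M => ?_
  have := sum_range_rpow_sub (a := a) 0 M
  simp only [add_zero] at this
  rw [this]
  have : 0 ≤ ((M : ℝ) + (0 : ℕ) + 1) ^ (-a) := by positivity
  simp at this ⊢
  linarith

lemma summable_eulerTerm {s : ℂ} (hs : 0 < s.re) : Summable fun n => eulerTerm n s :=
  .of_norm_bounded ((summable_rpow_sub hs).mul_left _) (norm_eulerTerm_le hs le_rfl)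

lemma sum_eulerTerm (s : ℂ) (M : ℕ) :
    ∑ n ∈ range M, eulerTerm n s =
      (s - 1) * (∑ n ∈ range (M + 1), 1 / ((n : ℂ) + 1) ^ s) + ((M : ℂ) + 1) ^ (1 - s) - s := by
  induction M with
  | zero => simp
  | succ M ih =>
    rw [sum_range_succ, ih, sum_range_succ _ (M + 1), eulerTerm]
    push_cast
    rw [Complex.cpow_neg]
    ring

lemma differentiableOn_tsum_eulerTerm :
    DifferentiableOn ℂ (fun s => ∑' n, eulerTerm n s) {s | 0 < s.re} := by
  intro s hs
  replace hs : 0 < s.re := hs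
  set U : Set ℂ := {z | s.re / 2 < z.re} ∩ Metric.ball 0 (‖s‖ + 1) with hU
  have hUo : IsOpen U := (isOpen_lt continuous_const Complex.continuous_re).inter Metric.isOpen_ball
  have hsU : s ∈ U := ⟨by simp; linarith, by simp⟩
  have := Complex.differentiableOn_tsum_of_summable_norm (F := eulerTerm) (U := U)
    ((summable_rpow_sub (half_pos hs)).mul_left ((‖s‖ + 1) * (‖s‖ + 2) / (s.re / 2))) ?_ hUo ?_
  · exact ((this s hsU).differentiableAt (hUo.mem_nhds hsU)).differentiableWithinAt
  · intro n
    unfold eulerTerm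
    apply Differentiable.differentiableOn
    have h1 : ((n + 1 : ℝ) : ℂ) ≠ 0 := by exact_mod_cast (by positivity : (n + 1 : ℝ) ≠ 0)
    have h2 : (((n + 1 : ℝ) + 1 : ℝ) : ℂ) ≠ 0 := by exact_mod_cast (by positivity : ((n + 1 : ℝ) + 1) ≠ 0)
    intro z
    exact (((differentiableAt_id.sub_const 1).mul (differentiableAt_id.neg.const_cpow (Or.inl h2))).add
      ((differentiableAt_id.const_sub 1).const_cpow (Or.inl h2))).sub
      ((differentiableAt_id.const_sub 1).const_cpow (Or.inl h1))
  · intro n w hw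
    have hw1 : ‖w‖ ≤ ‖s‖ + 1 := (mem_ball_zero_iff.1 hw.2).le
    refine (norm_eulerTerm_le (half_pos hs) hw.1.le n).trans ?_
    gcongr
    · exact rpow_sub_nonneg (half_pos hs) n
    · refine (norm_sub_le _ _).trans ?_
      simp
      linarith

lemma riemannZeta₁_eq_mul {s : ℂ} (hs : s ≠ 1) : riemannZeta₁ s = (s - 1) * riemannZeta s := by
  rw [riemannZeta_eq_inv_sub_mul hs, mul_inv_cancel_left₀ (sub_ne_zero.2 hs)]

lemma riemannZeta₁_eq_add_tsum {s : ℂ} (hs : 0 < s.re) :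
    riemannZeta₁ s = s + ∑' n, eulerTerm n s := by
  have hopen : IsOpen {s : ℂ | 0 < s.re} := isOpen_lt continuous_const Complex.continuous_re
  have hconv : Convex ℝ {s : ℂ | 0 < s.re} := convex_halfSpace_re_gt 0
  refine AnalyticOnNhd.eqOn_of_preconnected_of_eventuallyEq (f := riemannZeta₁)
    (g := fun s => s + ∑' n, eulerTerm n s) (z₀ := 2)
    (differentiable_riemannZeta₁.differentiableOn.analyticOnNhd hopen)
    ((differentiableOn_id.add differentiableOn_tsum_eulerTerm).analyticOnNhd hopen)
    hconv.isPreconnected (by simp) ?_ hs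
  have h1 : {s : ℂ | 1 < s.re} ∈ 𝓝 (2 : ℂ) :=
    (isOpen_lt continuous_const Complex.continuous_re).mem_nhds (by simp)
  filter_upwards [h1] with z hz
  have hz1 : z ≠ 1 := by
    rintro rfl
    simp at hz
  have hsum := (summable_eulerTerm (by linarith : 0 < z.re)).hasSum.tendsto_sum_nat
  have hzeta : Tendsto (fun M : ℕ => ∑ n ∈ range (M + 1), 1 / ((n : ℂ) + 1) ^ z) atTop (𝓝 (riemannZeta z)) := by
    rw [zeta_eq_tsum_one_div_nat_add_one_cpow hz]
    have h2 : Summable fun n : ℕ => 1 / ((n : ℂ) + 1) ^ z := by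
      have := (summable_nat_add_iff 1).2 (Complex.summable_one_div_nat_cpow.2 hz)
      simpa using this
    exact h2.hasSum.tendsto_sum_nat.comp (tendsto_add_atTop_nat 1)
  have hpow : Tendsto (fun M : ℕ => ((M : ℂ) + 1) ^ (1 - z)) atTop (𝓝 0) := by
    rw [tendsto_zero_iff_norm_tendsto_zero]
    have h3 : ∀ M : ℕ, ‖((M : ℂ) + 1) ^ (1 - z)‖ = ((M + 1 : ℕ) : ℝ) ^ (-(z.re - 1)) := by
      intro M
      have := Complex.norm_natCast_cpow_of_pos (Nat.succ_pos M) (1 - z)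
      push_cast at this ⊢
      rw [this]
      simp
    simp_rw [h3]
    exact ((tendsto_rpow_neg_atTop (by linarith : 0 < z.re - 1)).comp
      tendsto_natCast_atTop_atTop).comp (tendsto_add_atTop_nat 1)
  have h4 := ((hzeta.const_mul (z - 1)).add hpow).sub_const z
  simp_rw [← sum_eulerTerm] at h4
  have h5 := tendsto_nhds_unique hsum h4
  rw [h5, riemannZeta₁_eq_mul hz1]
  ring

/-- Truncation of the zeta series in the half plane `0 < Re s`. -/
theorem norm_riemannZeta₁_sub_le {s : ℂ} (hs : 0 < s.re) (N : ℕ) :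
    ‖riemannZeta₁ s - ((s - 1) * (∑ n ∈ range (N + 1), 1 / ((n : ℂ) + 1) ^ s) + ((N : ℂ) + 1) ^ (1 - s))‖ ≤
      ‖s‖ * ‖s - 1‖ / s.re * (N + 1 : ℝ) ^ (-s.re) := by
  have h1 : riemannZeta₁ s - ((s - 1) * (∑ n ∈ range (N + 1), 1 / ((n : ℂ) + 1) ^ s) + ((N : ℂ) + 1) ^ (1 - s))
      = ∑' n, eulerTerm (n + N) s := by
    rw [riemannZeta₁_eq_add_tsum hs, ← (summable_eulerTerm hs).sum_add_tsum_nat_add N, sum_eulerTerm]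
    ring
  rw [h1]
  have hsum := ((summable_nat_add_iff N).2 ((summable_rpow_sub hs).mul_left (‖s‖ * ‖s - 1‖ / s.re)))
  refine (tsum_of_norm_bounded hsum.hasSum fun n => norm_eulerTerm_le hs le_rfl (n + N)).trans ?_
  rw [tsum_mul_left]
  gcongr
  refine Real.tsum_le_of_sum_range_le (fun n => rpow_sub_nonneg hs (n + N)) fun M => ?_
  rw [sum_range_rpow_sub]
  have : 0 ≤ (M + N + 1 : ℝ) ^ (-s.re) := by positivity
  linarith

end ZetaTruncation

end VinogradovKorobov

namespace VinogradovKorobov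

open Finset

section ZetaGrowth

lemma norm_sum_weighted_le {w : ℕ → ℝ} {f : ℕ → ℂ} {a b : ℕ} {B : ℝ} (hab : a ≤ b)
    (hw : ∀ m, a ≤ m → w (m + 1) ≤ w m) (hw0 : 0 ≤ w b)
    (hf : ∀ m, a ≤ m → m ≤ b → ‖∑ n ∈ Ioc a m, f n‖ ≤ B) :
    ‖∑ n ∈ Ioc a b, (w n : ℂ) * f n‖ ≤ w a * B := by
  have key : ‖∑ n ∈ Ioc a b, (w n : ℂ) * f n - w b * ∑ n ∈ Ioc a b, f n‖ ≤ B * (w a - w b) := by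
    clear hw0
    induction b, hab using Nat.le_induction with
    | base => simp
    | succ b hab ih =>
      have h1 := ih fun m hm hmb => hf m hm (by omega)
      rw [sum_Ioc_succ_top (by omega), sum_Ioc_succ_top (by omega)]
      calc _ = ‖(∑ n ∈ Ioc a b, (w n : ℂ) * f n - w b * ∑ n ∈ Ioc a b, f n) +
            ((w b - w (b + 1) : ℝ) : ℂ) * ∑ n ∈ Ioc a b, f n‖ := by
            congr 1
            push_cast
            ring
        _ ≤ B * (w a - w b) + (w b - w (b + 1)) * B := by
            refine (norm_add_le _ _).trans (add_le_add h1 ?_)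
            rw [norm_mul, Complex.norm_real, Real.norm_of_nonneg (sub_nonneg.2 (hw b hab))]
            exact mul_le_mul_of_nonneg_left (hf b hab (by omega)) (sub_nonneg.2 (hw b hab))
        _ = _ := by ring
  have h2 : ‖(w b : ℂ) * ∑ n ∈ Ioc a b, f n‖ ≤ w b * B := by
    rw [norm_mul, Complex.norm_real, Real.norm_of_nonneg hw0]
    exact mul_le_mul_of_nonneg_left (hf b hab le_rfl) hw0
  calc _ = ‖(∑ n ∈ Ioc a b, (w n : ℂ) * f n - w b * ∑ n ∈ Ioc a b, f n) +
        w b * ∑ n ∈ Ioc a b, f n‖ := by rw [sub_add_cancel]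
    _ ≤ B * (w a - w b) + w b * B := (norm_add_le _ _).trans (add_le_add key h2)
    _ = _ := by ring

/-- Half of the width `(log L / L) ^ (2 / 3)` of the region to the left of `Re s = 1` in which zeta is
bounded by a power of `L`, for ordinates up to `exp L`. -/
noncomputable def growthWidth (L : ℝ) : ℝ := (Real.log L / L) ^ (2 / 3 : ℝ) / 2

lemma growthWidth_pos {L : ℝ} (hL : 3 ≤ L) : 0 < growthWidth L := by
  have := Real.log_pos (by linarith : 1 < L)
  unfold growthWidth
  positivity

lemma growthWidth_le_half {L : ℝ} (hL : 3 ≤ L) : growthWidth L ≤ 1 / 2 := by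
  unfold growthWidth
  have h0 := Real.log_pos (by linarith : 1 < L)
  have : (Real.log L / L) ^ (2 / 3 : ℝ) ≤ 1 := by
    apply Real.rpow_le_one (by positivity) _ (by norm_num)
    rw [div_le_one (by linarith)]
    exact Real.log_le_self (by linarith)
  linarith

lemma saving_exponent_le {L x : ℝ} (hL : 3 ≤ L) (hx : 0 ≤ x) :
    growthWidth L * x - savingConst * x ^ 3 / L ^ 2 ≤ 10000 * Real.log L := by
  have hℓ := Real.log_pos (by linarith : 1 < L)
  have hL0 : 0 < L := by linarith
  set p := (Real.log L / L) ^ (1 / 3 : ℝ) with hp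
  have hp0 : 0 < p := by positivity
  have hp3 : L * p ^ 3 = Real.log L := by
    rw [hp, ← Real.rpow_mul_natCast (by positivity)]
    norm_num
    field_simp
  have hp2 : growthWidth L = p ^ 2 / 2 := by
    rw [hp, ← Real.rpow_mul_natCast (by positivity), growthWidth]
    norm_num
  obtain ⟨z, rfl⟩ : ∃ z, x = L * z := ⟨x / L, by field_simp⟩
  have hz : 0 ≤ z := nonneg_of_mul_nonneg_right hx hL0
  rw [hp2, ← hp3, savingConst]
  have h1 : 1 / 668168000 * (L * z) ^ 3 / L ^ 2 = L * (1 / 668168000 * z ^ 3) := by field_simp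
  have h2 : p ^ 2 / 2 * z ≤ 10000 * p ^ 3 + 1 / 668168000 * z ^ 3 := by
    rcases le_total z (20000 * p) with h | h
    · have : p ^ 2 / 2 * z ≤ p ^ 2 / 2 * (20000 * p) := by gcongr
      have : 0 ≤ z ^ 3 := by positivity
      nlinarith
    · have h3 : p ≤ z / 20000 := by linarith
      have h4 : p ^ 2 / 2 * z ≤ (z / 20000) ^ 2 / 2 * z := by gcongr
      have h5 : 0 ≤ z ^ 3 := by positivity
      have h6 : 0 ≤ p ^ 3 := by positivity
      nlinarith
  rw [h1]
  nlinarith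

lemma norm_sum_block_le {L : ℝ} {s : ℂ} (hL : 3 ≤ L) (ht : 2 ≤ s.im) (htL : Real.log s.im ≤ L)
    (hσ : 1 - growthWidth L ≤ s.re) {a b : ℕ} (ha : 32 ≤ a) (hat : (a : ℝ) ≤ s.im ^ 2)
    (hab : a ≤ b) (hb : b ≤ 2 * a) :
    ‖∑ n ∈ Ioc a b, 1 / (n : ℂ) ^ s‖ ≤ 25 * L * L ^ (10000 : ℝ) := by
  have ha32 : (32 : ℝ) ≤ a := by exact_mod_cast ha
  have ha0 : (0 : ℝ) < a := by linarith
  have hL0 : 0 < L := by linarith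
  have hσ0 : 0 < s.re := by linarith [growthWidth_le_half hL]
  have hτ : 0 < Real.log s.im := Real.log_pos (by linarith)
  have hx1 : 1 ≤ Real.log a := by
    rw [Real.le_log_iff_exp_le ha0]
    linarith [Real.exp_one_lt_d9]
  set x := Real.log a with hx
  set τ := Real.log s.im with hτd
  set B := 25 * (τ / x) * (a : ℝ) ^ (1 - savingConst * (x / τ) ^ 2) with hB
  have h1 := norm_sum_weighted_le (w := fun n => (n : ℝ) ^ (-s.re))
    (f := fun n => (n : ℂ) ^ (-(s.im * Complex.I))) (B := B) hab ?_ (by positivity) ?_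
  · have h2 : ∀ n ∈ Ioc a b, 1 / (n : ℂ) ^ s =
        (((n : ℝ) ^ (-s.re) : ℝ) : ℂ) * (n : ℂ) ^ (-(s.im * Complex.I)) := by
      intro n hn
      rw [mem_Ioc] at hn
      have hn0 : (n : ℂ) ≠ 0 := by exact_mod_cast (by omega : n ≠ 0)
      rw [Complex.ofReal_cpow (Nat.cast_nonneg n), one_div, ← Complex.cpow_neg]
      push_cast
      rw [← Complex.cpow_add _ _ hn0]
      congr 1
      conv_lhs => rw [← Complex.re_add_im s]
      ring
    rw [sum_congr rfl h2]
    refine h1.trans ?_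
    have h3 : (a : ℝ) ^ (-s.re) * B = 25 * (τ / x) * (a : ℝ) ^ (1 - s.re - savingConst * (x / τ) ^ 2) := by
      rw [hB, show 1 - s.re - savingConst * (x / τ) ^ 2 = -s.re + (1 - savingConst * (x / τ) ^ 2) by ring,
        Real.rpow_add ha0]
      ring
    rw [h3]
    gcongr ?_ * ?_
    · have : τ / x ≤ L := by
        rw [div_le_iff₀ (by linarith)]
        nlinarith
      linarith
    · rw [Real.rpow_def_of_pos ha0, Real.rpow_def_of_pos hL0, ← hx]
      apply Real.exp_le_exp.2
      have h4 := saving_exponent_le hL (by linarith : 0 ≤ x)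
      have h5 : savingConst * x ^ 3 / L ^ 2 ≤ savingConst * x ^ 3 / τ ^ 2 := by
        have := savingConst_pos
        gcongr
      have h6 : x * (savingConst * (x / τ) ^ 2) = savingConst * x ^ 3 / τ ^ 2 := by
        field_simp
      have h7 : x * (1 - s.re) ≤ x * growthWidth L := by
        gcongr
        linarith
      linarith
  · intro m hm
    apply Real.rpow_le_rpow_of_nonpos _ _ (by linarith)
    · exact_mod_cast (by omega : 0 < m)
    · push_cast; linarith
  · intro m hm hmb
    exact norm_sum_cpow_le (by linarith) ha hat hm (by omega)

lemma norm_sum_dyadic_le {L : ℝ} {s : ℂ} (hL : 3 ≤ L) (ht : 2 ≤ s.im) (htL : Real.log s.im ≤ L)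
    (hσ : 1 - growthWidth L ≤ s.re) (j m : ℕ) (hm : (m : ℝ) ≤ s.im ^ 2) (hmj : m ≤ 32 * 2 ^ j) :
    ‖∑ n ∈ Ioc 0 m, 1 / (n : ℂ) ^ s‖ ≤ 32 + j * (25 * L * L ^ (10000 : ℝ)) := by
  have hσ0 : 0 < s.re := by linarith [growthWidth_le_half hL]
  have hL0 : 0 < L := by linarith
  have hB : 0 ≤ 25 * L * L ^ (10000 : ℝ) := by positivity
  induction j generalizing m with
  | zero =>
    calc ‖∑ n ∈ Ioc 0 m, 1 / (n : ℂ) ^ s‖ ≤ ∑ n ∈ Ioc 0 m, (1 : ℝ) := by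
          refine norm_sum_le_of_le _ fun n hn => ?_
          rw [mem_Ioc] at hn
          rw [norm_div, norm_one, Complex.norm_natCast_cpow_of_pos hn.1]
          rw [div_le_one (by have := hn.1; positivity)]
          exact Real.one_le_rpow (by exact_mod_cast hn.1) hσ0.le
      _ = m := by simp
      _ ≤ 32 := by exact_mod_cast (by simpa using hmj)
      _ = _ := by simp
  | succ j ih =>
    rcases le_or_gt m (32 * 2 ^ j) with h | h
    · refine (ih m hm h).trans ?_
      push_cast
      linarith
    · have h1 : ((32 * 2 ^ j : ℕ) : ℝ) ≤ s.im ^ 2 := le_trans (by exact_mod_cast h.le) hm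
      have h2 : 32 ≤ 32 * 2 ^ j := Nat.le_mul_of_pos_right _ (by positivity)
      rw [← sum_Ioc_consecutive _ (Nat.zero_le (32 * 2 ^ j)) h.le]
      refine (norm_add_le _ _).trans ((add_le_add (ih _ h1 le_rfl)
        (norm_sum_block_le hL ht htL hσ h2 h1 h.le (by rw [pow_succ] at hmj; omega))).trans ?_)
      push_cast
      linarith

/-- The Vinogradov–Korobov bound: `ζ` grows at most like a power of `L` up to height `exp L` and
to the left of the line `Re s = 1` by `growthWidth L`. -/
theorem exists_norm_riemannZeta_le : ∃ A : ℝ, 1 ≤ A ∧ ∀ L : ℝ, 3 ≤ L → ∀ s : ℂ, 2 ≤ s.im →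
    Real.log s.im ≤ L → 1 - growthWidth L ≤ s.re → s.re ≤ 2 → ‖riemannZeta s‖ ≤ L ^ A := by
  refine ⟨10007, by norm_num, fun L hL s ht htL hσ hσ2 => ?_⟩
  have hL0 : 0 < L := by linarith
  have hσh : 1 / 2 ≤ s.re := by linarith [growthWidth_le_half hL]
  have hσ0 : 0 < s.re := by linarith
  have ht0 : 0 < s.im := by linarith
  set N := ⌊s.im ^ 2⌋₊ with hN
  have hNle : (N : ℝ) ≤ s.im ^ 2 := Nat.floor_le (by positivity)
  have hNlt : s.im ^ 2 < N + 1 := Nat.lt_floor_add_one _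
  have hNge : (s.im / 2) ^ 2 ≤ N := by nlinarith
  have hN0 : (0 : ℝ) < N := lt_of_lt_of_le (by positivity) hNge
  have hN1 : N ≠ 0 := by
    intro h
    rw [h] at hN0
    simp at hN0
  have hN1' : (1 : ℝ) ≤ N := by exact_mod_cast Nat.one_le_iff_ne_zero.2 hN1
  have hs1 : s ≠ 1 := by
    rintro rfl
    simp at ht0
  have hs1' : 0 < ‖s - 1‖ := norm_pos_iff.2 (sub_ne_zero.2 hs1)
  have hts : s.im ≤ ‖s - 1‖ := by
    have := Complex.abs_im_le_norm (s - 1)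
    simp only [Complex.sub_im, Complex.one_im, sub_zero] at this
    exact (le_abs_self _).trans this
  have htr := norm_riemannZeta₁_sub_le hσ0 (N - 1)
  have hNc : ((N - 1 : ℕ) : ℝ) + 1 = N := by
    rw [Nat.cast_sub (Nat.one_le_iff_ne_zero.2 hN1)]
    push_cast
    ring
  have hNcc : ((N - 1 : ℕ) : ℂ) + 1 = N := by exact_mod_cast hNc
  have hsum : ∑ n ∈ range (N - 1 + 1), 1 / ((n : ℂ) + 1) ^ s = ∑ n ∈ Ioc 0 N, 1 / (n : ℂ) ^ s := by
    rw [Nat.sub_add_cancel (Nat.one_le_iff_ne_zero.2 hN1), range_eq_Ico,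
      ← Finset.Ico_add_one_add_one_eq_Ioc, ← sum_Ico_add' (fun n : ℕ => 1 / (n : ℂ) ^ s) 0 N 1]
    simp
  rw [hNc, hNcc, hsum, riemannZeta₁_eq_mul hs1] at htr
  set S := ∑ n ∈ Ioc 0 N, 1 / (n : ℂ) ^ s with hS
  have hsq1 : (N : ℝ) ^ (1 / 2 : ℝ) ≤ s.im := by
    rw [← Real.sqrt_eq_rpow, Real.sqrt_le_left ht0.le]
    exact hNle
  have hsq2 : s.im / 2 ≤ (N : ℝ) ^ (1 / 2 : ℝ) := by
    rw [← Real.sqrt_eq_rpow]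
    exact Real.le_sqrt_of_sq_le hNge
  have hp1 : ‖(N : ℂ) ^ (1 - s)‖ ≤ ‖s - 1‖ := by
    rw [Complex.norm_natCast_cpow_of_pos (Nat.pos_of_ne_zero hN1)]
    refine le_trans (Real.rpow_le_rpow_of_exponent_le hN1' ?_) (hsq1.trans hts)
    simp
    linarith
  have hp2 : ‖s‖ * ‖s - 1‖ / s.re * (N : ℝ) ^ (-s.re) ≤ 8 * ‖s - 1‖ := by
    have hs : ‖s‖ ≤ 2 * s.im := by
      refine (Complex.norm_le_abs_re_add_abs_im s).trans ?_
      rw [abs_of_pos hσ0, abs_of_pos ht0]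
      linarith
    have hNs : (N : ℝ) ^ (-s.re) ≤ 2 / s.im := by
      calc (N : ℝ) ^ (-s.re) ≤ (N : ℝ) ^ (-(1 / 2) : ℝ) :=
            Real.rpow_le_rpow_of_exponent_le hN1' (by linarith)
        _ = ((N : ℝ) ^ (1 / 2 : ℝ))⁻¹ := Real.rpow_neg hN0.le _
        _ ≤ (s.im / 2)⁻¹ := by gcongr
        _ = _ := by rw [inv_div]
    calc ‖s‖ * ‖s - 1‖ / s.re * (N : ℝ) ^ (-s.re) ≤ (2 * s.im) * ‖s - 1‖ / (1 / 2) * (2 / s.im) := by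
          gcongr
      _ = _ := by field_simp; ring
  have hj : N ≤ 32 * 2 ^ ⌈4 * L⌉₊ := by
    have h1 : (N : ℝ) ≤ 2 ^ ⌈4 * L⌉₊ := by
      calc (N : ℝ) ≤ s.im ^ 2 := hNle
        _ = Real.exp (2 * Real.log s.im) := by
          rw [two_mul, Real.exp_add, Real.exp_log ht0, sq]
        _ ≤ Real.exp (Real.log 2 * ⌈4 * L⌉₊) := by
          apply Real.exp_le_exp.2
          have h3 := Nat.le_ceil (4 * L)
          have h4 := Real.log_two_gt_d9
          nlinarith
        _ = _ := by
          rw [← Real.rpow_natCast, Real.rpow_def_of_pos (by norm_num)]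
    have h2 : N ≤ 2 ^ ⌈4 * L⌉₊ := by exact_mod_cast h1
    omega
  have hSb := norm_sum_dyadic_le hL ht htL hσ ⌈4 * L⌉₊ N hNle hj
  have hceil := Nat.ceil_lt_add_one (by positivity : 0 ≤ 4 * L)
  have hmul : ‖s - 1‖ * ‖riemannZeta s‖ ≤ ‖s - 1‖ * (‖S‖ + 9) := by
    calc ‖s - 1‖ * ‖riemannZeta s‖ = ‖((s - 1) * riemannZeta s - ((s - 1) * S + (N : ℂ) ^ (1 - s))) +
          ((s - 1) * S + (N : ℂ) ^ (1 - s))‖ := by rw [sub_add_cancel, norm_mul]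
      _ ≤ 8 * ‖s - 1‖ + (‖s - 1‖ * ‖S‖ + ‖s - 1‖) := by
          refine (norm_add_le _ _).trans (add_le_add (htr.trans hp2) ((norm_add_le _ _).trans
            (add_le_add (norm_mul _ _).le hp1)))
      _ = _ := by ring
  have hζ := le_of_mul_le_mul_left hmul hs1'
  have hP1 : 1 ≤ L ^ (10000 : ℝ) := Real.one_le_rpow (by linarith) (by norm_num)
  set P := L ^ (10000 : ℝ) with hP
  have h7 : L ^ (10007 : ℝ) = P * L ^ 7 := by
    rw [hP, ← Real.rpow_natCast, ← Real.rpow_add hL0]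
    norm_num
  rw [h7]
  have h5 : (243 : ℝ) ≤ L ^ 5 := by
    calc (243 : ℝ) = 3 ^ 5 := by norm_num
      _ ≤ _ := by gcongr
  calc ‖riemannZeta s‖ ≤ 32 + (4 * L + 1) * (25 * L * P) + 9 := by
        refine hζ.trans ?_
        gcongr
        refine hSb.trans ?_
        gcongr
    _ ≤ P * (41 + 100 * L ^ 2 + 25 * L) := by nlinarith
    _ ≤ P * (243 * L ^ 2) := by
        gcongr
        nlinarith
    _ ≤ P * (L ^ 5 * L ^ 2) := by gcongr
    _ = _ := by ring

end ZetaGrowth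

end VinogradovKorobov

namespace VinogradovKorobov

section LocalLemmas

open Metric Filter Topology

theorem norm_logDeriv_le_of_ne_zero {g : ℂ → ℂ} {R M : ℝ} (hR : 0 < R) (hM : 0 < M)
    (hg : DifferentiableOn ℂ g (ball 0 R)) (h0 : ∀ z ∈ ball (0 : ℂ) R, g z ≠ 0)
    (hb : ∀ z ∈ ball (0 : ℂ) R, ‖g z‖ ≤ Real.exp M * ‖g 0‖) {z : ℂ} (hz : z ∈ ball (0 : ℂ) R) :
    ‖deriv g z / g z‖ ≤ 8 * M * R / (R - ‖z‖) ^ 2 := by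
  have hdiff : DifferentiableOn ℂ (fun z => deriv g z / g z) (ball 0 R) :=
    (hg.deriv isOpen_ball).div hg h0
  have h0mem : (0 : ℂ) ∈ ball (0 : ℂ) R := mem_ball_self hR
  obtain ⟨G, hG0, hG⟩ := hdiff.isExactOn_ball.with_val_at 0 0
  have hGd : DifferentiableOn ℂ G (ball 0 R) := fun x hx =>
    (hG x hx).differentiableAt.differentiableWithinAt
  have hconst : ∀ w ∈ ball (0 : ℂ) R, g w * Complex.exp (-G w) = g 0 := by
    have hd : ∀ w ∈ ball (0 : ℂ) R, HasDerivAt (fun w => g w * Complex.exp (-G w)) 0 w := by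
      intro w hw
      have h1 := (hg.differentiableAt (isOpen_ball.mem_nhds hw)).hasDerivAt
      have h2 := h1.mul ((hG w hw).neg.cexp)
      rw [show deriv g w * Complex.exp ((-G) w) +
        g w * (Complex.exp ((-G) w) * -(deriv g w / g w)) = 0 by
          have := h0 w hw
          field_simp
          ring] at h2
      exact h2
    intro w hw
    have h1 := isOpen_ball.is_const_of_deriv_eq_zero (convex_ball (0 : ℂ) R).isPreconnected
      (fun w hw => (hd w hw).differentiableAt.differentiableWithinAt)
      (fun w hw => (hd w hw).deriv) hw h0mem
    simpa [hG0] using h1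
  have hre : Set.MapsTo G (ball 0 R) {z | z.re ≤ M} := by
    intro w hw
    have h1 : g w = g 0 * Complex.exp (G w) := by
      rw [← hconst w hw, mul_assoc, ← Complex.exp_add]
      simp
    have h2 := hb w hw
    rw [h1, norm_mul, Complex.norm_exp, mul_comm] at h2
    have h3 := le_of_mul_le_mul_right h2 (norm_pos_iff.2 (h0 0 h0mem))
    exact Real.exp_le_exp.1 h3
  have hzR : ‖z‖ < R := mem_ball_zero_iff.1 hz
  have hρ : 0 < (R - ‖z‖) / 2 := by linarith
  have hsub : closedBall z ((R - ‖z‖) / 2) ⊆ ball 0 R := by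
    intro w hw
    rw [mem_closedBall, dist_eq_norm] at hw
    rw [mem_ball_zero_iff]
    have := norm_add_le (w - z) z
    rw [sub_add_cancel] at this
    linarith
  have hC := Complex.norm_deriv_le_of_forall_mem_sphere_norm_le (f := G) (c := z)
    (C := 4 * M * R / (R - ‖z‖)) hρ
    ((hGd.mono hsub).diffContOnCl_ball subset_rfl) (by
      intro w hw
      have hw' := hsub (sphere_subset_closedBall hw)
      refine (Complex.borelCaratheodory_zero hM hGd hre hR hw' hG0).trans ?_
      have hwR := mem_ball_zero_iff.1 hw'
      rw [mem_sphere, dist_eq_norm] at hw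
      have h1 := norm_add_le (w - z) z
      rw [sub_add_cancel] at h1
      have h2 : (R - ‖z‖) / 2 ≤ R - ‖w‖ := by linarith
      calc 2 * M * ‖w‖ / (R - ‖w‖) ≤ 2 * M * R / ((R - ‖z‖) / 2) := by gcongr
        _ = _ := by field_simp; ring)
  rw [(hG z hz).deriv] at hC
  refine hC.trans_eq ?_
  field_simp
  ring

theorem exists_blaschke_factor {f : ℂ → ℂ} {U : Set ℂ} {r B : ℝ} {w : ℂ} (hU : IsOpen U) (hr : 0 < r)
    (hUr : closedBall 0 r ⊆ U) (hf : DifferentiableOn ℂ f U)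
    (hB : ∀ z ∈ closedBall (0 : ℂ) r, ‖f z‖ ≤ B) (hw : ‖w‖ ≤ r / 2) (hfw : f w = 0)
    (hf0 : f 0 ≠ 0) :
    ∃ g : ℂ → ℂ, DifferentiableOn ℂ g U ∧ (∀ z ∈ closedBall (0 : ℂ) r, ‖g z‖ ≤ B) ∧
      2 * ‖f 0‖ ≤ ‖g 0‖ ∧ (∀ z ∈ ball (0 : ℂ) r, g z = 0 → f z = 0) ∧
      deriv f 0 / f 0 = deriv g 0 / g 0 + (starRingEnd ℂ w / r ^ 2 - 1 / w) := by
  have hw0 : w ≠ 0 := by rintro rfl; exact hf0 hfw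
  have hwU : w ∈ U := hUr (by simp; linarith)
  have h0U : (0 : ℂ) ∈ U := hUr (by simp; linarith)
  have hr0 : (r : ℂ) ≠ 0 := by exact_mod_cast hr.ne'
  set h := dslope f w with hh
  have hhd : DifferentiableOn ℂ h U := (Complex.differentiableOn_dslope (hU.mem_nhds hwU)).2 hf
  have hfh : ∀ z, f z = (z - w) * h z := fun z => by
    have := sub_smul_dslope f w z
    rw [hfw, sub_zero, smul_eq_mul] at this
    exact this.symm
  set b : ℂ → ℂ := fun z => (r ^ 2 - starRingEnd ℂ w * z) / r with hb
  have hbd : Differentiable ℂ b := by fun_prop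
  have hb0 : b 0 = r := by simp [hb]; field_simp
  refine ⟨fun z => h z * b z, hhd.mul hbd.differentiableOn, ?_, ?_, ?_, ?_⟩
  · intro z hz
    have hdc : DiffContOnCl ℂ (fun z => h z * b z) (ball 0 r) :=
      ((hhd.mul hbd.differentiableOn).mono hUr).diffContOnCl_ball subset_rfl
    refine Complex.norm_le_of_forall_mem_frontier_norm_le isBounded_ball hdc (C := B) ?_
      (by rwa [closure_ball 0 hr.ne'])
    intro u hu
    rw [frontier_ball 0 hr.ne'] at hu
    have hun : ‖u‖ = r := by simpa using hu
    refine le_trans (le_of_eq ?_) (hB u (sphere_subset_closedBall hu))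
    rw [hfh u, norm_mul, norm_mul, mul_comm]
    congr 1
    have hu2 : (r : ℂ) ^ 2 = u * starRingEnd ℂ u := by
      rw [Complex.mul_conj, Complex.normSq_eq_norm_sq, hun]; push_cast; rfl
    rw [hb, norm_div, hu2, show u * starRingEnd ℂ u - starRingEnd ℂ w * u =
      u * starRingEnd ℂ (u - w) by rw [map_sub]; ring, norm_mul, Complex.norm_conj, hun,
      Complex.norm_real, Real.norm_of_nonneg hr.le]
    field_simp
  · beta_reduce
    rw [hfh 0, hb0]
    simp only [zero_sub, norm_mul, norm_neg, Complex.norm_real, Real.norm_of_nonneg hr.le]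
    nlinarith [norm_nonneg (h 0)]
  · intro z hz hgz
    rcases mul_eq_zero.1 hgz with h1 | h1
    · rw [hfh, h1, mul_zero]
    · exfalso
      have h2 : (r : ℂ) ^ 2 = starRingEnd ℂ w * z := by
        simpa [hb, hr0, sub_eq_zero] using h1
      have h3 := congrArg norm h2
      rw [norm_pow, Complex.norm_real, Real.norm_of_nonneg hr.le, norm_mul, Complex.norm_conj] at h3
      have hzr : ‖z‖ < r := mem_ball_zero_iff.1 hz
      nlinarith [norm_nonneg z, norm_nonneg w]
  · have hh0 : h 0 ≠ 0 := by
      intro h1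
      exact hf0 (by rw [hfh, h1, mul_zero])
    have d1 : HasDerivAt h (deriv h 0) 0 := (hhd.differentiableAt (hU.mem_nhds h0U)).hasDerivAt
    have d2 : HasDerivAt f (1 * h 0 + (0 - w) * deriv h 0) 0 := by
      rw [show f = fun z => (z - w) * h z from funext hfh]
      exact ((hasDerivAt_id' (0 : ℂ)).sub_const w).mul d1
    have d3 : HasDerivAt b (-starRingEnd ℂ w / r) 0 := by
      have := ((((hasDerivAt_id' (0 : ℂ)).const_mul (starRingEnd ℂ w)).const_sub
        ((r : ℂ) ^ 2)).div_const (r : ℂ))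
      simpa [hb] using this
    have d4 : HasDerivAt (fun z => h z * b z) _ 0 := d1.mul d3
    beta_reduce
    rw [d2.deriv, d4.deriv, hfh 0, hb0]
    field_simp
    ring

theorem re_conj_div_sub_le {r : ℝ} {w : ℂ} (hw : ‖w‖ ≤ r / 2) (hre : w.re ≤ 0) :
    (1 / w - starRingEnd ℂ w / r ^ 2).re ≤ 0 := by
  rcases eq_or_ne w 0 with rfl | hw0
  · simp
  have h1 : (1 / w - starRingEnd ℂ w / r ^ 2).re = w.re * (1 / ‖w‖ ^ 2 - 1 / r ^ 2) := by
    rw [Complex.sub_re, one_div, Complex.inv_re, Complex.normSq_eq_norm_sq,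
      show (starRingEnd ℂ w / (r : ℂ) ^ 2) = starRingEnd ℂ w / ((r ^ 2 : ℝ) : ℂ) by push_cast; rfl,
      Complex.div_ofReal_re, Complex.conj_re]
    ring
  rw [h1]
  refine mul_nonpos_of_nonpos_of_nonneg hre (sub_nonneg.2 ?_)
  have := norm_pos_iff.2 hw0
  gcongr
  linarith

theorem neg_re_logDeriv_le {U : Set ℂ} {r : ℝ} (hU : IsOpen U) (hr : 0 < r)
    (hUr : closedBall 0 r ⊆ U) {f : ℂ → ℂ} {M : ℝ} (hM : 0 < M)
    (hf : DifferentiableOn ℂ f U) (hf0 : f 0 ≠ 0)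
    (hB : ∀ z ∈ closedBall (0 : ℂ) r, ‖f z‖ ≤ Real.exp M * ‖f 0‖)
    (hz : ∀ z ∈ ball (0 : ℂ) r, f z = 0 → z.re ≤ 0) :
    -(deriv f 0 / f 0).re ≤ 16 * M / r := by
  obtain ⟨n, hn⟩ : ∃ n : ℕ, M ≤ n * Real.log 2 := by
    obtain ⟨n, hn⟩ := exists_nat_ge (M / Real.log 2)
    exact ⟨n, (div_le_iff₀ (Real.log_pos one_lt_two)).1 hn⟩
  induction n generalizing f M with
  | zero => simp at hn; linarith
  | succ n ih =>
    by_cases hex : ∃ w : ℂ, ‖w‖ < r / 2 ∧ f w = 0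
    · obtain ⟨w, hw, hfw⟩ := hex
      obtain ⟨g, hg, hgB, hg0, hgz, hgd⟩ := exists_blaschke_factor hU hr hUr hf hB hw.le hfw hf0
      have hf0' := norm_pos_iff.2 hf0
      have hwre : w.re ≤ 0 := hz w (by rw [mem_ball_zero_iff]; linarith) hfw
      have hre := re_conj_div_sub_le hw.le hwre
      have hgB' : ∀ z ∈ closedBall (0 : ℂ) r, ‖g z‖ ≤ Real.exp (M - Real.log 2) * ‖g 0‖ := by
        intro z hz
        refine (hgB z hz).trans ?_
        rw [Real.exp_sub, Real.exp_log two_pos]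
        have := Real.exp_pos M
        rw [div_mul_eq_mul_div, le_div_iff₀ two_pos]
        nlinarith
      have hg0' : g 0 ≠ 0 := norm_pos_iff.1 (by linarith)
      have hexp0 : 0 ≤ M - Real.log 2 := by
        have := hgB' 0 (by simp [hr.le])
        have h1 := norm_pos_iff.2 hg0'
        have h2 : 1 ≤ Real.exp (M - Real.log 2) := by
          by_contra! h
          nlinarith
        exact Real.one_le_exp_iff.1 h2
      have hmain : -(deriv g 0 / g 0).re ≤ 16 * M / r := by
        rcases hexp0.lt_or_eq with hpos | hzero
        · have h1 := ih hpos hg hg0' hgB' (fun z hz' hgz' => hz z hz' (hgz z hz' hgz'))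
            (by push_cast at hn; linarith)
          refine h1.trans ?_
          have := Real.log_pos one_lt_two
          gcongr
          linarith
        · rw [← hzero, Real.exp_zero, one_mul] at hgB'
          have h1 : deriv g 0 = 0 := by
            have hmax : IsMaxOn (norm ∘ g) (ball 0 r) 0 := fun z hz =>
              hgB' z (ball_subset_closedBall hz)
            have h2 := Complex.eqOn_of_isPreconnected_of_isMaxOn_norm
              (convex_ball (0 : ℂ) r).isPreconnected isOpen_ball
              (hg.mono (ball_subset_closedBall.trans hUr)) (mem_ball_self hr) hmax
            have h3 : g =ᶠ[𝓝 0] fun _ => g 0 := by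
              filter_upwards [ball_mem_nhds (0 : ℂ) hr] with z hz using h2 hz
            rw [h3.deriv_eq, deriv_const]
          rw [h1]
          simp
          positivity
      rw [hgd]
      rw [Complex.add_re]
      rw [Complex.sub_re] at hre ⊢
      linarith
    · push Not at hex
      have hsub : ball (0 : ℂ) (r / 2) ⊆ closedBall 0 r := fun z hz => by
        rw [mem_ball_zero_iff] at hz
        rw [mem_closedBall_zero_iff]
        linarith
      have h1 := norm_logDeriv_le_of_ne_zero (half_pos hr) hM (hf.mono (hsub.trans hUr))
        (fun z hz => hex z (mem_ball_zero_iff.1 hz)) (fun z hz => hB z (hsub hz))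
        (mem_ball_self (half_pos hr))
      have h2 := (abs_le.1 ((Complex.abs_re_le_norm (deriv f 0 / f 0)).trans h1)).1
      have h3 : 8 * M * (r / 2) / (r / 2 - ‖(0 : ℂ)‖) ^ 2 = 16 * M / r := by
        rw [norm_zero, sub_zero]
        field_simp
        ring
      linarith

theorem neg_re_logDeriv_add_le {U : Set ℂ} {r : ℝ} (hU : IsOpen U) (hr : 0 < r)
    (hUr : closedBall 0 r ⊆ U) {f : ℂ → ℂ} {M : ℝ} (hM : 0 < M)
    (hf : DifferentiableOn ℂ f U) (hf0 : f 0 ≠ 0)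
    (hB : ∀ z ∈ closedBall (0 : ℂ) r, ‖f z‖ ≤ Real.exp M * ‖f 0‖)
    (hz : ∀ z ∈ ball (0 : ℂ) r, f z = 0 → z.re ≤ 0) {x : ℝ} (hx : 0 < x) (hxr : x ≤ r / 2)
    (hfx : f (-x) = 0) :
    -(deriv f 0 / f 0).re ≤ (16 * M + 1) / r - 1 / x := by
  have hxn : ‖(-x : ℂ)‖ ≤ r / 2 := by
    rwa [norm_neg, Complex.norm_real, Real.norm_of_nonneg hx.le]
  obtain ⟨g, hg, hgB, hg0, hgz, hgd⟩ := exists_blaschke_factor hU hr hUr hf hB hxn hfx hf0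
  have hf0' := norm_pos_iff.2 hf0
  have hg0' : g 0 ≠ 0 := norm_pos_iff.1 (by linarith)
  have h1 := neg_re_logDeriv_le hU hr hUr hM hg hg0' (fun z hz => (hgB z hz).trans (by
    gcongr
    linarith)) (fun z hz' hgz' => hz z hz' (hgz z hz' hgz'))
  rw [hgd, Complex.add_re]
  have h2 : (starRingEnd ℂ (-x : ℂ) / r ^ 2 - 1 / (-x : ℂ)).re = 1 / x - x / r ^ 2 := by
    rw [show (starRingEnd ℂ (-x : ℂ) / r ^ 2 - 1 / (-x : ℂ)) = ((1 / x - x / r ^ 2 : ℝ) : ℂ) by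
      rw [map_neg, Complex.conj_ofReal]
      push_cast
      rw [div_neg]
      ring, Complex.ofReal_re]
  have h3 : x / r ^ 2 ≤ 1 / r := by
    rw [div_le_div_iff₀ (by positivity) hr]
    nlinarith
  rw [h2, add_div]
  linarith

end LocalLemmas

end VinogradovKorobov

namespace VinogradovKorobov

section ZetaRightHalfPlane

open Complex ArithmeticFunction
open scoped ArithmeticFunction.Moebius

theorem norm_LSeries_le_re {f : ℕ → ℂ} {g : ℕ → ℝ} (hg : ∀ n, n ≠ 0 → ‖f n‖ ≤ g n) {s : ℂ}
    (hs : LSeriesSummable (fun n => (g n : ℂ)) (s.re : ℂ)) :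
    ‖LSeries f s‖ ≤ (LSeries (fun n => (g n : ℂ)) (s.re : ℂ)).re := by
  have hterm : ∀ n, ‖LSeries.term f s n‖ ≤ (LSeries.term (fun n => (g n : ℂ)) (s.re : ℂ) n).re := by
    intro n
    rcases eq_or_ne n 0 with rfl | hn
    · simp
    rw [LSeries.norm_term_eq, if_neg hn, LSeries.term_of_ne_zero hn]
    have h1 : ((n : ℂ) ^ (s.re : ℂ)) = (((n : ℝ) ^ s.re : ℝ) : ℂ) := by
      rw [ofReal_cpow (Nat.cast_nonneg n), ofReal_natCast]
    rw [h1, ← ofReal_div, ofReal_re]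
    gcongr
    exact hg n hn
  have hsum : Summable fun n => (LSeries.term (fun n => (g n : ℂ)) (s.re : ℂ) n).re :=
    (Complex.hasSum_re hs.hasSum).summable
  rw [LSeries, LSeries, Complex.re_tsum hs]
  exact tsum_of_norm_bounded hsum.hasSum hterm

theorem norm_inv_riemannZeta_le {s : ℂ} (hs : 1 < s.re) :
    ‖(riemannZeta s)⁻¹‖ ≤ ‖riemannZeta (s.re : ℂ)‖ := by
  have h1 := LSeries_zeta_mul_Lseries_moebius hs
  rw [LSeries_zeta_eq_riemannZeta hs] at h1
  have h2 : (riemannZeta s)⁻¹ = LSeries (fun n => (μ n : ℂ)) s := by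
    rw [inv_eq_of_mul_eq_one_right h1]
  have hs' : 1 < ((s.re : ℝ) : ℂ).re := by simpa
  rw [h2]
  refine (norm_LSeries_le_re (g := fun _ => 1) (fun n hn => ?_) ?_).trans ?_
  · rw [Complex.norm_intCast]
    exact_mod_cast abs_moebius_le_one
  · have := LSeriesSummable_one_iff.2 hs'
    convert this using 2
    simp
  · refine (Complex.re_le_norm _).trans_eq ?_
    rw [← LSeries_one_eq_riemannZeta hs']
    congr 2

theorem norm_logDeriv_riemannZeta_le {s : ℂ} (hs : 1 < s.re) :
    ‖deriv riemannZeta s / riemannZeta s‖ ≤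
      -(deriv riemannZeta (s.re : ℂ) / riemannZeta (s.re : ℂ)).re := by
  have hs' : 1 < ((s.re : ℝ) : ℂ).re := by simpa
  rw [← norm_neg, ← neg_div, ← LSeries_vonMangoldt_eq_deriv_riemannZeta_div hs, ← Complex.neg_re,
    ← neg_div, ← LSeries_vonMangoldt_eq_deriv_riemannZeta_div hs']
  refine norm_LSeries_le_re (g := fun n => Λ n) (fun n _ => ?_) (LSeriesSummable_vonMangoldt hs')
  rw [Complex.norm_real, Real.norm_of_nonneg vonMangoldt_nonneg]

theorem three_four_one_nonneg {σ : ℝ} (hσ : 1 < σ) (t : ℝ) :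
    0 ≤ 3 * -(deriv riemannZeta (σ : ℂ) / riemannZeta (σ : ℂ)).re +
      4 * -(deriv riemannZeta (σ + t * I) / riemannZeta (σ + t * I)).re +
      -(deriv riemannZeta (σ + (2 * t : ℝ) * I) / riemannZeta (σ + (2 * t : ℝ) * I)).re := by
  have h0 : 1 < ((σ : ℝ) : ℂ).re := by simpa
  have h1 : 1 < ((σ : ℂ) + t * I).re := by simpa
  have h2 : 1 < ((σ : ℂ) + (2 * t : ℝ) * I).re := by simpa using hσ
  simp only [← Complex.neg_re, ← neg_div]
  rw [← LSeries_vonMangoldt_eq_deriv_riemannZeta_div h0,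
    ← LSeries_vonMangoldt_eq_deriv_riemannZeta_div h1,
    ← LSeries_vonMangoldt_eq_deriv_riemannZeta_div h2]
  have s0 := Complex.hasSum_re (LSeriesSummable_vonMangoldt h0).hasSum
  have s1 := Complex.hasSum_re (LSeriesSummable_vonMangoldt h1).hasSum
  have s2 := Complex.hasSum_re (LSeriesSummable_vonMangoldt h2).hasSum
  refine ((((s0.mul_left 3).add (s1.mul_left 4)).add s2).nonneg fun n => ?_)
  rcases eq_or_ne n 0 with rfl | hn
  · simp
  have hn' : (n : ℂ) ≠ 0 := by exact_mod_cast hn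
  set z : ℂ := (n : ℂ) ^ (-(t * I)) with hz
  have hzn : ‖z‖ = 1 := by
    rw [hz, show -(t * I : ℂ) = ((-t : ℝ) : ℂ) * I by push_cast; ring,
      ← ofReal_natCast, Complex.norm_cpow_eq_rpow_re_of_pos (by positivity)]
    simp
  have e0 : LSeries.term (fun n => (Λ n : ℂ)) (σ : ℂ) n = ((Λ n / (n : ℝ) ^ σ : ℝ) : ℂ) := by
    rw [LSeries.term_of_ne_zero hn]
    push_cast
    rw [ofReal_cpow (Nat.cast_nonneg n), ofReal_natCast]
  have e1 : LSeries.term (fun n => (Λ n : ℂ)) (σ + t * I) n = LSeries.term (fun n => (Λ n : ℂ)) (σ : ℂ) n * z := by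
    rw [LSeries.term_of_ne_zero hn, LSeries.term_of_ne_zero hn, hz, cpow_add _ _ hn', cpow_neg]
    ring
  have e2 : LSeries.term (fun n => (Λ n : ℂ)) (σ + (2 * t : ℝ) * I) n = LSeries.term (fun n => (Λ n : ℂ)) (σ : ℂ) n * z ^ 2 := by
    rw [LSeries.term_of_ne_zero hn, LSeries.term_of_ne_zero hn, hz, cpow_add _ _ hn',
      show ((2 * t : ℝ) : ℂ) * I = t * I + t * I by push_cast; ring, cpow_add _ _ hn', cpow_neg]
    ring
  rw [e1, e2, e0, Complex.re_ofReal_mul, Complex.re_ofReal_mul, ofReal_re]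
  have hpos : 0 ≤ Λ n / (n : ℝ) ^ σ := div_nonneg vonMangoldt_nonneg (by positivity)
  have hz2 : (z ^ 2).re = 2 * z.re ^ 2 - 1 := by
    have h3 : z.re ^ 2 + z.im ^ 2 = 1 := by
      have := Complex.sq_norm z
      rw [hzn, Complex.normSq_apply] at this
      nlinarith
    rw [sq, Complex.mul_re]
    nlinarith
  rw [hz2]
  have : 3 * (Λ n / (n : ℝ) ^ σ) + 4 * (Λ n / (n : ℝ) ^ σ * z.re) +
      Λ n / (n : ℝ) ^ σ * (2 * z.re ^ 2 - 1) = 2 * (Λ n / (n : ℝ) ^ σ) * (1 + z.re) ^ 2 := by ring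
  rw [this]
  positivity

theorem logDeriv_riemannZeta₁ {s : ℂ} (hs : s ≠ 1) (hz : riemannZeta s ≠ 0) :
    deriv riemannZeta₁ s / riemannZeta₁ s = deriv riemannZeta s / riemannZeta s + (s - 1)⁻¹ := by
  have h1 := sub_ne_zero.2 hs
  have h2 := riemannZeta_eq_inv_sub_mul hs
  have h3 : riemannZeta₁ s ≠ 0 := by
    rw [riemannZeta₁_eq_mul hs]
    exact mul_ne_zero h1 hz
  rw [deriv_riemannZeta_eq_neg_inv_sub_sq_mul_add hs, h2]
  field_simp
  ring

theorem exists_riemannZeta_near_one_bounds : ∃ B : ℝ, 1 ≤ B ∧ ∀ d : ℝ, 0 < d → d ≤ 1 →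
    ‖riemannZeta (1 + d : ℝ)‖ ≤ B / d ∧
    -(deriv riemannZeta (1 + d : ℝ) / riemannZeta (1 + d : ℝ)).re ≤ 1 / d + B := by
  have hK : IsCompact (Set.Icc (1 : ℝ) 2) := isCompact_Icc
  have hne : ∀ x ∈ Set.Icc (1 : ℝ) 2, riemannZeta₁ x ≠ 0 := by
    intro x hx
    rcases eq_or_ne x 1 with rfl | h1
    · simp
    · have h2 : (x : ℂ) ≠ 1 := by exact_mod_cast h1
      rw [riemannZeta₁_eq_mul h2]
      exact mul_ne_zero (sub_ne_zero.2 h2) (riemannZeta_ne_zero_of_one_le_re (by simpa using hx.1))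
  have c1 : ContinuousOn (fun x : ℝ => riemannZeta₁ x) (Set.Icc 1 2) :=
    (differentiable_riemannZeta₁.continuous.comp continuous_ofReal).continuousOn
  have c2 : ContinuousOn (fun x : ℝ => deriv riemannZeta₁ x / riemannZeta₁ x) (Set.Icc 1 2) :=
    ((differentiable_riemannZeta₁.deriv.continuous.comp continuous_ofReal).continuousOn).div c1 hne
  obtain ⟨B1, hB1⟩ := hK.exists_bound_of_continuousOn c1
  obtain ⟨B2, hB2⟩ := hK.exists_bound_of_continuousOn c2
  refine ⟨max 1 (max B1 B2), le_max_left _ _, fun d hd hd1 => ?_⟩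
  have hmem : 1 + d ∈ Set.Icc (1 : ℝ) 2 := ⟨by linarith, by linarith⟩
  have hx1 : ((1 + d : ℝ) : ℂ) ≠ 1 := by
    have : (1 + d : ℝ) ≠ 1 := by linarith
    exact_mod_cast this
  have hz : riemannZeta (1 + d : ℝ) ≠ 0 :=
    riemannZeta_ne_zero_of_one_le_re (by rw [ofReal_re]; linarith)
  have hsub : ((1 + d : ℝ) : ℂ) - 1 = (d : ℂ) := by push_cast; ring
  constructor
  · rw [riemannZeta_eq_inv_sub_mul hx1, hsub, norm_mul, norm_inv, Complex.norm_real,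
      Real.norm_of_nonneg hd.le, inv_mul_eq_div]
    gcongr
    exact (hB1 _ hmem).trans ((le_max_left _ _).trans (le_max_right _ _))
  · have h1 := logDeriv_riemannZeta₁ hx1 hz
    rw [hsub] at h1
    have h2 := congrArg re h1
    rw [add_re, ← ofReal_inv, ofReal_re] at h2
    have h3 := (abs_le.1 ((Complex.abs_re_le_norm _).trans (hB2 _ hmem))).1
    beta_reduce at h3
    rw [h2, inv_eq_one_div] at h3
    have h4 : B2 ≤ max 1 (max B1 B2) := (le_max_right _ _).trans (le_max_right _ _)
    linarith

end ZetaRightHalfPlane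

end VinogradovKorobov

namespace VinogradovKorobov

section ZeroFreeRegion

open Complex Metric

noncomputable def zeroFreeWidth (c L : ℝ) : ℝ := c * growthWidth L / Real.log L

theorem one_le_log_of_three_le {L : ℝ} (hL : 3 ≤ L) : 1 ≤ Real.log L := by
  rw [Real.le_log_iff_exp_le (by linarith)]
  linarith [Real.exp_one_lt_d9]

theorem zeroFreeWidth_pos {c L : ℝ} (hc : 0 < c) (hL : 3 ≤ L) : 0 < zeroFreeWidth c L := by
  have := one_le_log_of_three_le hL
  have := growthWidth_pos hL
  unfold zeroFreeWidth
  positivity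

theorem zeroFreeWidth_le {c L : ℝ} (hc : 0 < c) (hL : 3 ≤ L) :
    zeroFreeWidth c L ≤ c * growthWidth L :=
  div_le_self (mul_nonneg hc.le (growthWidth_pos hL).le) (one_le_log_of_three_le hL)

theorem inv_pow_le_zeroFreeWidth {c L : ℝ} (hc : 0 < c) (hL : 3 ≤ L) (hcL : 2 / c ≤ L) :
    1 / L ^ 4 ≤ zeroFreeWidth c L := by
  have h1 := one_le_log_of_three_le hL
  have hL0 : 0 < L := by linarith
  have h2 : 1 / (2 * L) ≤ growthWidth L := by
    unfold growthWidth
    have h3 : 1 / L ≤ (Real.log L / L) ^ (2 / 3 : ℝ) := by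
      calc 1 / L = (1 / L) ^ (1 : ℝ) := (Real.rpow_one _).symm
        _ ≤ (1 / L) ^ (2 / 3 : ℝ) := by
          refine Real.rpow_le_rpow_of_exponent_ge (by positivity) ?_ (by norm_num)
          rw [div_le_one hL0]
          linarith
        _ ≤ _ := by gcongr
    calc 1 / (2 * L) = 1 / L / 2 := by field_simp
      _ ≤ _ := by gcongr
  have h4 : Real.log L ≤ L := (Real.log_le_sub_one_of_pos hL0).trans (by linarith)
  have h5 : 2 ≤ c * L := by
    rw [div_le_iff₀ hc] at hcL
    linarith
  calc 1 / L ^ 4 ≤ c * (1 / (2 * L)) / L := by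
        rw [mul_one_div, div_div, div_le_div_iff₀ (by positivity) (by positivity)]
        nlinarith [pow_pos hL0 2, pow_pos hL0 3, mul_le_mul_of_nonneg_right h5 (pow_pos hL0 3).le]
    _ ≤ c * growthWidth L / Real.log L := by
        have := growthWidth_pos hL
        gcongr

def ZetaGrowthBound (A : ℝ) : Prop :=
  ∀ L : ℝ, 3 ≤ L → ∀ s : ℂ, 2 ≤ s.im → Real.log s.im ≤ L → 1 - growthWidth L ≤ s.re →
    s.re ≤ 2 → ‖riemannZeta s‖ ≤ L ^ A

def ZetaNearOneBound (B : ℝ) : Prop :=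
  ∀ d : ℝ, 0 < d → d ≤ 1 → ‖riemannZeta (1 + d : ℝ)‖ ≤ B / d ∧
    -(deriv riemannZeta (1 + d : ℝ) / riemannZeta (1 + d : ℝ)).re ≤ 1 / d + B

theorem norm_riemannZeta_le_exp_mul {A B L d t : ℝ} (hA : ZetaGrowthBound A) (hB1 : 1 ≤ B)
    (hB : ZetaNearOneBound B) (hL : 3 ≤ L) (hd0 : 1 / L ^ 4 ≤ d) (hd1 : d ≤ 1 / 2) (ht : 3 ≤ t)
    (htL : Real.log (t + 1) ≤ L) {z : ℂ} (hz : ‖z‖ ≤ 1 / 2)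
    (hre : 1 - growthWidth L ≤ 1 + d + z.re) :
    ‖riemannZeta ((1 + d : ℝ) + t * I + z)‖ ≤
      Real.exp ((A + 4 + B) * Real.log L) * ‖riemannZeta ((1 + d : ℝ) + t * I)‖ := by
  have hL0 : 0 < L := by linarith
  have hd : 0 < d := lt_of_lt_of_le (by positivity) hd0
  have him := Complex.abs_im_le_norm z
  have hrz := Complex.abs_re_le_norm z
  rw [abs_le] at him hrz
  have h1 : ‖riemannZeta ((1 + d : ℝ) + t * I + z)‖ ≤ L ^ A := by
    apply hA L hL
    · simp
      linarith
    · refine le_trans (Real.log_le_log ?_ ?_) htL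
      · simp
        linarith
      · simp
        linarith
    · simpa using hre
    · simp
      linarith
  set z0 : ℂ := (1 + d : ℝ) + t * I with hz0
  have hre0 : z0.re = 1 + d := by simp [hz0]
  have h2 := norm_inv_riemannZeta_le (s := z0) (by linarith)
  rw [hre0, norm_inv] at h2
  have h3 := (hB d hd (by linarith)).1
  have hne : riemannZeta z0 ≠ 0 := riemannZeta_ne_zero_of_one_le_re (by linarith)
  have hpos := norm_pos_iff.2 hne
  have h4 : 1 ≤ L ^ 4 * L ^ B * ‖riemannZeta z0‖ := by
    have h5 : B ≤ L ^ B := by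
      calc B ≤ Real.exp B := by linarith [Real.add_one_le_exp B]
        _ ≤ Real.exp (Real.log L * B) := by
          gcongr
          nlinarith [one_le_log_of_three_le hL]
        _ = L ^ B := (Real.rpow_def_of_pos hL0 _).symm
    have h6 : ‖riemannZeta z0‖⁻¹ ≤ B / d := h2.trans h3
    rw [inv_le_iff_one_le_mul₀ hpos] at h6
    refine h6.trans ?_
    gcongr
    calc B / d ≤ B / (1 / L ^ 4) := by gcongr
      _ = L ^ 4 * B := by field_simp
      _ ≤ _ := by gcongr
  have h7 : Real.exp ((A + 4 + B) * Real.log L) = L ^ A * (L ^ 4 * L ^ B) := by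
    rw [mul_comm, ← Real.rpow_def_of_pos hL0, Real.rpow_add hL0, Real.rpow_add hL0,
      ← Real.rpow_natCast]
    push_cast
    ring
  rw [h7, mul_assoc]
  exact h1.trans (le_mul_of_one_le_right (by positivity) h4)

theorem differentiableOn_riemannZeta_add (z0 : ℂ) :
    DifferentiableOn ℂ (fun z => riemannZeta (z0 + z)) {z | z0 + z ≠ 1} := fun z hz =>
  ((differentiableAt_riemannZeta hz).comp z (by fun_prop)).differentiableWithinAt

theorem isOpen_add_ne_one (z0 : ℂ) : IsOpen {z : ℂ | z0 + z ≠ 1} :=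
  isOpen_ne.preimage (continuous_const.add continuous_id)

theorem closedBall_subset_add_ne_one {d t r : ℝ} (ht : 3 ≤ t) (hr : r ≤ 1 / 2) :
    closedBall 0 r ⊆ {z : ℂ | ((1 + d : ℝ) + t * I) + z ≠ 1} := by
  intro z hz h
  rw [mem_closedBall_zero_iff] at hz
  have h1 := congrArg im h
  simp at h1
  have := (abs_le.1 ((Complex.abs_im_le_norm z).trans hz)).1
  linarith

theorem neg_re_logDeriv_riemannZeta_le {A B L d t : ℝ} (hA1 : 1 ≤ A) (hA : ZetaGrowthBound A)
    (hB1 : 1 ≤ B) (hB : ZetaNearOneBound B) (hL : 3 ≤ L) (hd0 : 1 / L ^ 4 ≤ d) (hd1 : d ≤ 1 / 2)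
    (ht : 3 ≤ t) (htL : Real.log (t + 1) ≤ L) :
    (-(deriv riemannZeta ((1 + d : ℝ) + t * I) / riemannZeta ((1 + d : ℝ) + t * I)).re ≤
      16 * ((A + 4 + B) * Real.log L) / growthWidth L) ∧
    ∀ x : ℝ, 0 < x → x ≤ growthWidth L / 2 → riemannZeta ((1 + d - x : ℝ) + t * I) = 0 →
      -(deriv riemannZeta ((1 + d : ℝ) + t * I) / riemannZeta ((1 + d : ℝ) + t * I)).re ≤
        (16 * ((A + 4 + B) * Real.log L) + 1) / growthWidth L - 1 / x := by
  have hlog := one_le_log_of_three_le hL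
  have hd : 0 < d := lt_of_lt_of_le (by positivity) hd0
  set z0 : ℂ := (1 + d : ℝ) + t * I with hz0
  have hre0 : z0.re = 1 + d := by simp [hz0]
  have hsub := closedBall_subset_add_ne_one (d := d) ht (growthWidth_le_half hL)
  have hM : 0 < (A + 4 + B) * Real.log L := by positivity
  have hf0 : riemannZeta (z0 + 0) ≠ 0 := by
    rw [add_zero]
    exact riemannZeta_ne_zero_of_one_le_re (by linarith)
  have hbound : ∀ z ∈ closedBall (0 : ℂ) (growthWidth L), ‖riemannZeta (z0 + z)‖ ≤
      Real.exp ((A + 4 + B) * Real.log L) * ‖riemannZeta (z0 + 0)‖ := by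
    intro z hz
    rw [mem_closedBall_zero_iff] at hz
    rw [add_zero]
    have h1 := (abs_le.1 ((Complex.abs_re_le_norm z).trans hz)).1
    exact norm_riemannZeta_le_exp_mul hA hB1 hB hL hd0 hd1 ht htL
      (hz.trans (growthWidth_le_half hL)) (by linarith)
  have hzeros : ∀ z ∈ ball (0 : ℂ) (growthWidth L), riemannZeta (z0 + z) = 0 → z.re ≤ 0 := by
    intro z _ hz
    by_contra! h
    exact riemannZeta_ne_zero_of_one_le_re (by rw [add_re, hre0]; linarith) hz
  have hder : deriv (fun z => riemannZeta (z0 + z)) 0 = deriv riemannZeta z0 := by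
    rw [deriv_comp_const_add, add_zero]
  constructor
  · have h := neg_re_logDeriv_le (isOpen_add_ne_one z0) (growthWidth_pos hL) hsub hM
      (differentiableOn_riemannZeta_add z0) hf0 hbound hzeros
    simpa only [hder, add_zero] using h
  · intro x hx hxr hzero
    have h := neg_re_logDeriv_add_le (isOpen_add_ne_one z0) (growthWidth_pos hL) hsub hM
      (differentiableOn_riemannZeta_add z0) hf0 hbound hzeros hx hxr (by
        rw [← hzero, hz0]
        congr 1
        push_cast
        ring)
    simpa only [hder, add_zero] using h

theorem riemannZeta_ne_zero_of_zeroFreeWidth {A B L : ℝ} (hA1 : 1 ≤ A) (hA : ZetaGrowthBound A)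
    (hB1 : 1 ≤ B) (hB : ZetaNearOneBound B) (hL : 3 ≤ L)
    (hL2 : 400 * (A + 4 + B) ≤ L) {s : ℂ} (hs : 3 ≤ s.im) (hsL : Real.log (2 * s.im + 1) ≤ L)
    (hre : 1 - zeroFreeWidth (1 / (1400 * (A + 4 + B))) L ≤ s.re) : riemannZeta s ≠ 0 := by
  intro hzero
  have hD : 6 ≤ A + 4 + B := by linarith
  set D := A + 4 + B with hDdef
  set d := zeroFreeWidth (1 / (200 * D)) L with hd
  have hlog := one_le_log_of_three_le hL
  have hr := growthWidth_pos hL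
  have hr2 := growthWidth_le_half hL
  have hwd : zeroFreeWidth (1 / (1400 * D)) L = d / 7 := by
    rw [hd]
    unfold zeroFreeWidth
    field_simp
    ring
  rw [hwd] at hre
  have hd0 : 1 / L ^ 4 ≤ d := inv_pow_le_zeroFreeWidth (by positivity) hL (by
    rw [div_div_eq_mul_div]
    linarith)
  have hdpos : 0 < d := lt_of_lt_of_le (by positivity) hd0
  have hdr : d ≤ growthWidth L / 4 := by
    refine (zeroFreeWidth_le (by positivity) hL).trans ?_
    have : 1 / (200 * D) ≤ 1 / 4 := by gcongr; linarith
    nlinarith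
  have hs1 : s.re < 1 := by
    by_contra! h
    exact riemannZeta_ne_zero_of_one_le_re h hzero
  set x := 1 + d - s.re with hx
  have hs_eq : s = (1 + d - x : ℝ) + s.im * I := by
    rw [hx, sub_sub_cancel]
    exact (Complex.re_add_im s).symm
  have hlog1 : Real.log (s.im + 1) ≤ L :=
    (Real.log_le_log (by linarith) (by linarith)).trans hsL
  have h1 := (neg_re_logDeriv_riemannZeta_le hA1 hA hB1 hB hL hd0 (by linarith) hs hlog1).2 x
    (by linarith) (by linarith) (by rw [← hs_eq]; exact hzero)
  have h2 := (neg_re_logDeriv_riemannZeta_le hA1 hA hB1 hB hL hd0 (by linarith)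
    (t := 2 * s.im) (by linarith) hsL).1
  have h0 := (hB d hdpos (by linarith)).2
  have h341 := three_four_one_nonneg (σ := 1 + d) (by linarith) s.im
  have hx78 : 7 / (8 * d) ≤ 1 / x := by
    rw [div_le_div_iff₀ (by positivity) (by linarith)]
    linarith
  have hkey : 1 / (2 * d) ≤ 3 * B + (80 * (D * Real.log L) + 4) / growthWidth L := by
    have e1 : 1 / (2 * d) = 4 * (7 / (8 * d)) - 3 * (1 / d) := by field_simp; ring
    have e2 : (80 * (D * Real.log L) + 4) / growthWidth L =
      4 * ((16 * (D * Real.log L) + 1) / growthWidth L) +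
        16 * (D * Real.log L) / growthWidth L := by ring
    rw [e1, e2]
    linarith
  have e3 : 1 / (2 * d) = 100 * D * Real.log L / growthWidth L := by
    rw [hd]
    unfold zeroFreeWidth
    field_simp
    ring
  rw [e3, ← sub_le_iff_le_add, ← sub_nonneg] at hkey
  have e4 : 3 * B * growthWidth L ≤ 3 * B * (1 / 2) := by gcongr
  have h5 : 3 * B - (100 * D * Real.log L / growthWidth L -
    (80 * (D * Real.log L) + 4) / growthWidth L) =
      (3 * B * growthWidth L - 20 * D * Real.log L + 4) / growthWidth L := by
    field_simp
    ring
  rw [h5] at hkey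
  have h6 : 3 * B * growthWidth L - 20 * D * Real.log L + 4 < 0 := by nlinarith
  exact absurd hkey (not_le.2 (div_neg_of_neg_of_pos h6 hr))

theorem norm_logDeriv_riemannZeta_le_of_zeroFreeWidth {A B L : ℝ} (hA1 : 1 ≤ A)
    (hA : ZetaGrowthBound A) (hB1 : 1 ≤ B) (hB : ZetaNearOneBound B) (hL : 3 ≤ L)
    (hL2 : 2800 * (A + 4 + B) ≤ L) {s : ℂ} (hs : 4 ≤ s.im) (hsL : Real.log (2 * s.im + 3) ≤ L)
    (hre : 1 - zeroFreeWidth (1 / (1400 * (A + 4 + B))) L / 2 ≤ s.re) (h2 : s.re ≤ 2) :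
    ‖deriv riemannZeta s / riemannZeta s‖ ≤ L ^ 6 := by
  have hD : 6 ≤ A + 4 + B := by linarith
  have hzf : ∀ {s : ℂ}, 3 ≤ s.im → Real.log (2 * s.im + 1) ≤ L →
    1 - zeroFreeWidth (1 / (1400 * (A + 4 + B))) L ≤ s.re → riemannZeta s ≠ 0 := fun h1 h2 h3 =>
      riemannZeta_ne_zero_of_zeroFreeWidth hA1 hA hB1 hB hL (by linarith) h1 h2 h3
  set D := A + 4 + B with hDdef
  set d := zeroFreeWidth (1 / (1400 * D)) L with hd
  have hlog := one_le_log_of_three_le hL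
  have hr := growthWidth_pos hL
  have hr2 := growthWidth_le_half hL
  have hL0 : 0 < L := by linarith
  have hd0 : 1 / L ^ 4 ≤ d := inv_pow_le_zeroFreeWidth (by positivity) hL (by
    rw [div_div_eq_mul_div]
    linarith)
  have hdpos : 0 < d := lt_of_lt_of_le (by positivity) hd0
  have hdr : d ≤ growthWidth L / 4 := by
    refine (zeroFreeWidth_le (by positivity) hL).trans ?_
    have : 1 / (1400 * D) ≤ 1 / 4 := by gcongr; linarith
    nlinarith
  have hdinv : 1 / d ≤ L ^ 4 := by
    rw [one_div_le hdpos (by positivity)]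
    exact hd0
  rcases le_total (1 + d) s.re with hsd | hsd
  · refine (norm_logDeriv_riemannZeta_le (by linarith)).trans ?_
    have h1 := (hB (s.re - 1) (by linarith) (by linarith)).2
    rw [add_sub_cancel] at h1
    refine h1.trans ?_
    have h3 : 1 / (s.re - 1) ≤ 1 / d := by gcongr; linarith
    have h4 : B ≤ L ^ 4 := by
      calc B ≤ L ^ 1 := by linarith
        _ ≤ L ^ 4 := by gcongr <;> linarith
    have h5 : 9 * L ^ 4 ≤ L ^ 6 := by
      calc 9 * L ^ 4 = 3 ^ 2 * L ^ 4 := by norm_num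
        _ ≤ L ^ 2 * L ^ 4 := by gcongr
        _ = _ := by ring
    have : 0 < L ^ 4 := by positivity
    linarith
  · set z0 : ℂ := (1 + d : ℝ) + s.im * I with hz0
    have hre0 : z0.re = 1 + d := by simp [hz0]
    have him0 : z0.im = s.im := by simp [hz0]
    have hsub := closedBall_subset_add_ne_one (d := d) (t := s.im) (r := 2 * d)
      (by linarith) (by linarith)
    set z : ℂ := ((s.re - (1 + d) : ℝ) : ℂ) with hz
    have hzn : ‖z‖ ≤ 3 / 2 * d := by
      rw [hz, Complex.norm_real, Real.norm_eq_abs, abs_le]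
      constructor <;> linarith
    have hz0z : z0 + z = s := by
      apply Complex.ext <;> simp [hz0, hz]
    have hcoord : ∀ w ∈ ball (0 : ℂ) (2 * d), |w.re| ≤ 2 * d ∧ |w.im| ≤ 2 * d := by
      intro w hw
      rw [mem_ball_zero_iff] at hw
      exact ⟨(Complex.abs_re_le_norm w).trans hw.le, (Complex.abs_im_le_norm w).trans hw.le⟩
    have h1 := norm_logDeriv_le_of_ne_zero (g := fun z => riemannZeta (z0 + z)) (R := 2 * d)
      (M := D * Real.log L) (z := z)
      (by positivity) (by positivity)
      ((differentiableOn_riemannZeta_add z0).mono (ball_subset_closedBall.trans hsub))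
      (by
        intro w hw
        obtain ⟨h1, h2⟩ := hcoord w hw
        rw [abs_le] at h1 h2
        apply hzf
        · rw [add_im, him0]; linarith
        · refine (Real.log_le_log ?_ ?_).trans hsL <;> rw [add_im, him0] <;> linarith
        · rw [add_re, hre0]; linarith)
      (by
        intro w hw
        obtain ⟨h1, h2⟩ := hcoord w hw
        rw [abs_le] at h1 h2
        rw [mem_ball_zero_iff] at hw
        simp only [add_zero]
        refine norm_riemannZeta_le_exp_mul hA hB1 hB hL hd0 (by linarith) (by linarith)
          ((Real.log_le_log ?_ ?_).trans hsL) ?_ ?_ <;> linarith)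
      (by rw [mem_ball_zero_iff]; linarith)
    simp only [deriv_comp_const_add, hz0z] at h1
    refine h1.trans ?_
    calc 8 * (D * Real.log L) * (2 * d) / (2 * d - ‖z‖) ^ 2
        ≤ 8 * (D * Real.log L) * (2 * d) / (d / 2) ^ 2 := by
          gcongr
          linarith
      _ = 64 * D * Real.log L * (1 / d) := by field_simp; ring
      _ ≤ L * L * L ^ 4 := by
          gcongr
          · linarith
          · exact (Real.log_le_sub_one_of_pos hL0).trans (by linarith)
      _ = _ := by ring

end ZeroFreeRegion

end VinogradovKorobov

namespace VinogradovKorobov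

section LogDerivBound

open Complex ComplexConjugate ArithmeticFunction

/-- The negative of the logarithmic derivative of zeta, minus zeta, with its removable
singularity at `1` filled in. -/
noncomputable def primeError (s : ℂ) : ℂ :=
  -(deriv riemannZeta₁ s / riemannZeta₁ s) - riemannZeta₀ s

theorem riemannZeta₁_ne_zero_iff {s : ℂ} (hs : s ≠ 1) : riemannZeta₁ s ≠ 0 ↔ riemannZeta s ≠ 0 := by
  rw [riemannZeta₁_eq_mul hs]
  simp [sub_ne_zero.2 hs]

theorem riemannZeta₁_ne_zero_of_one_le_re {s : ℂ} (hs : 1 ≤ s.re) : riemannZeta₁ s ≠ 0 := by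
  rcases eq_or_ne s 1 with rfl | h1
  · simp
  · exact (riemannZeta₁_ne_zero_iff h1).2 (riemannZeta_ne_zero_of_one_le_re hs)

theorem primeError_eq {s : ℂ} (hs : s ≠ 1) (hz : riemannZeta s ≠ 0) :
    primeError s = -(deriv riemannZeta s / riemannZeta s) - riemannZeta s := by
  rw [primeError, logDeriv_riemannZeta₁ hs hz, riemannZeta_eq_inv_sub_add hs]
  ring

theorem differentiableAt_primeError {s : ℂ} (hs : riemannZeta₁ s ≠ 0) :
    DifferentiableAt ℂ primeError s :=
  ((differentiable_riemannZeta₁.deriv s).div (differentiable_riemannZeta₁ s) hs).neg.sub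
    (differentiable_riemannZeta₀ s)

theorem primeError_conj {s : ℂ} (hs : s ≠ 1) (hz : riemannZeta s ≠ 0) :
    primeError (conj s) = conj (primeError s) := by
  have h1 : conj s ≠ 1 := fun h => hs (by simpa using congrArg conj h)
  have h2 : riemannZeta (conj s) ≠ 0 := by
    rw [riemannZeta_conj]
    simpa using hz
  have h3 : deriv riemannZeta (conj s) = conj (deriv riemannZeta s) := by
    have h4 : (conj ∘ riemannZeta ∘ conj) = riemannZeta := by
      ext z
      simp [riemannZeta_conj]
    have h5 := (differentiableAt_riemannZeta hs).hasDerivAt.conj_conj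
    rw [h4] at h5
    exact h5.deriv
  rw [primeError_eq hs hz, primeError_eq h1 h2, h3, riemannZeta_conj]
  simp

theorem exists_primeError_bound_near_real_axis : ∃ η : ℝ, 0 < η ∧ ∃ K : ℝ, ∀ s : ℂ, |s.im| ≤ 4 →
    1 - η ≤ s.re → s.re ≤ 2 → riemannZeta₁ s ≠ 0 ∧ ‖primeError s‖ ≤ K := by
  have hη : ∃ η : ℝ, 0 < η ∧ ∀ s : ℂ, |s.im| ≤ 4 → 1 - η ≤ s.re → s.re ≤ 2 →
      riemannZeta₁ s ≠ 0 := by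
    set Z : Set ℂ := (Set.Icc (0 : ℝ) 2 ×ℂ Set.Icc (-4 : ℝ) 4) ∩ riemannZeta₁ ⁻¹' {0} with hZ
    have hZc : IsCompact Z := (isCompact_Icc.reProdIm isCompact_Icc).inter_right
      (isClosed_singleton.preimage differentiable_riemannZeta₁.continuous)
    rcases Z.eq_empty_or_nonempty with hemp | hne
    · refine ⟨1, one_pos, fun s h1 h2 h3 h4 => ?_⟩
      have : s ∈ Z := ⟨⟨⟨by linarith, h3⟩, abs_le.1 h1⟩, h4⟩
      rw [hemp] at this
      exact this
    · obtain ⟨z, hz, hmax⟩ := hZc.exists_isMaxOn hne Complex.continuous_re.continuousOn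
      have hz1 : z.re < 1 := by
        by_contra! h
        exact riemannZeta₁_ne_zero_of_one_le_re h hz.2
      refine ⟨(1 - z.re) / 2, by linarith, fun s h1 h2 h3 h4 => ?_⟩
      have h0 : 0 ≤ z.re := hz.1.1.1
      have hs : s ∈ Z := ⟨⟨⟨by linarith, h3⟩, abs_le.1 h1⟩, h4⟩
      have := hmax hs
      simp only [Set.mem_ofPred_eq] at this
      linarith
  obtain ⟨η, hη0, hη⟩ := hη
  have hc : IsCompact (Set.Icc (1 - η) 2 ×ℂ Set.Icc (-4 : ℝ) 4) :=
    isCompact_Icc.reProdIm isCompact_Icc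
  have hcont : ContinuousOn primeError (Set.Icc (1 - η) 2 ×ℂ Set.Icc (-4 : ℝ) 4) := fun s hs =>
    (differentiableAt_primeError
      (hη s (abs_le.2 hs.2) hs.1.1 hs.1.2)).continuousAt.continuousWithinAt
  obtain ⟨K, hK⟩ := hc.exists_bound_of_continuousOn hcont
  exact ⟨η, hη0, K, fun s h1 h2 h3 => ⟨hη s h1 h2 h3, hK s ⟨⟨h2, h3⟩, abs_le.1 h1⟩⟩⟩

theorem exists_primeError_bound : ∃ c : ℝ, 0 < c ∧ c ≤ 1 ∧ ∃ A : ℝ, 0 < A ∧ ∃ L₀ : ℝ, 3 ≤ L₀ ∧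
    ∀ L : ℝ, L₀ ≤ L → ∀ s : ℂ, |s.im| ≤ Real.exp L / 4 → 1 - zeroFreeWidth c L ≤ s.re →
      s.re ≤ 2 → riemannZeta₁ s ≠ 0 ∧ ‖primeError s‖ ≤ L ^ A := by
  obtain ⟨A, hA1, hA⟩ := exists_norm_riemannZeta_le
  obtain ⟨B, hB1, hB⟩ := exists_riemannZeta_near_one_bounds
  obtain ⟨η, hη0, K, hK⟩ := exists_primeError_bound_near_real_axis
  set c := min (1 / (2800 * (A + 4 + B))) η with hc
  have hc0 : 0 < c := lt_min (by positivity) hη0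
  have hc1 : c ≤ 1 := (min_le_left _ _).trans (by
    rw [div_le_one (by positivity)]
    linarith)
  refine ⟨c, hc0, hc1, A + 7, by linarith, max (max 3 K) (2800 * (A + 4 + B)),
    (le_max_left _ _).trans (le_max_left _ _), ?_⟩
  intro L hL
  have hL3 : 3 ≤ L := ((le_max_left _ _).trans (le_max_left _ _)).trans hL
  have hLK : K ≤ L := ((le_max_right _ _).trans (le_max_left _ _)).trans hL
  have hLD : 2800 * (A + 4 + B) ≤ L := (le_max_right _ _).trans hL
  have hL0 : 0 < L := by linarith
  have hw : zeroFreeWidth c L ≤ zeroFreeWidth (1 / (1400 * (A + 4 + B))) L / 2 := by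
    have h1 : zeroFreeWidth (1 / (1400 * (A + 4 + B))) L / 2 =
        zeroFreeWidth (1 / (2800 * (A + 4 + B))) L := by
      unfold zeroFreeWidth
      field_simp
      ring
    rw [h1]
    unfold zeroFreeWidth
    have := growthWidth_pos hL3
    have := one_le_log_of_three_le hL3
    gcongr
    exact min_le_left _ _
  have hwη : zeroFreeWidth c L ≤ η := by
    have h1 := zeroFreeWidth_le hc0 hL3
    have h2 := growthWidth_le_half hL3
    have h3 : c ≤ η := min_le_right _ _
    nlinarith [growthWidth_pos hL3]
  have hwg : zeroFreeWidth c L ≤ growthWidth L := by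
    have h1 := zeroFreeWidth_le hc0 hL3
    nlinarith [growthWidth_pos hL3]
  have hpos : ∀ s : ℂ, 4 ≤ s.im → s.im ≤ Real.exp L / 4 → 1 - zeroFreeWidth c L ≤ s.re →
      s.re ≤ 2 → riemannZeta s ≠ 0 ∧ ‖primeError s‖ ≤ L ^ (A + 7) := by
    intro s h4 him hre hre2
    have hlog3 : Real.log (2 * s.im + 3) ≤ L := by
      rw [Real.log_le_iff_le_exp (by linarith)]
      linarith
    have hlog1 : Real.log (2 * s.im + 1) ≤ L :=
      (Real.log_le_log (by linarith) (by linarith)).trans hlog3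
    have hlog0 : Real.log s.im ≤ L := (Real.log_le_log (by linarith) (by linarith)).trans hlog3
    have hwpos : 0 < zeroFreeWidth (1 / (1400 * (A + 4 + B))) L :=
      zeroFreeWidth_pos (by positivity) hL3
    have hz : riemannZeta s ≠ 0 := riemannZeta_ne_zero_of_zeroFreeWidth hA1 hA hB1 hB hL3
      (by linarith) (by linarith) hlog1 (by linarith)
    have hs1 : s ≠ 1 := by
      rintro rfl
      simp at h4
      linarith
    refine ⟨hz, ?_⟩
    have h1 := norm_logDeriv_riemannZeta_le_of_zeroFreeWidth hA1 hA hB1 hB hL3 hLD h4 hlog3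
      (by linarith) hre2
    have h2 := hA L hL3 s (by linarith) hlog0 (by linarith) hre2
    rw [primeError_eq hs1 hz]
    have h3 : L ^ (6 : ℕ) ≤ L ^ (A + 6) := by
      rw [← Real.rpow_natCast]
      exact Real.rpow_le_rpow_of_exponent_le (by linarith) (by push_cast; linarith)
    have h5 : L ^ A ≤ L ^ (A + 6) := Real.rpow_le_rpow_of_exponent_le (by linarith) (by linarith)
    have h6 : L ^ (A + 7) = L ^ (A + 6) * L := by
      rw [show A + 7 = A + 6 + 1 by ring, Real.rpow_add_one hL0.ne']
    calc ‖-(deriv riemannZeta s / riemannZeta s) - riemannZeta s‖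
        ≤ ‖deriv riemannZeta s / riemannZeta s‖ + ‖riemannZeta s‖ := by
          refine (norm_sub_le _ _).trans_eq ?_
          rw [norm_neg]
      _ ≤ L ^ (A + 6) + L ^ (A + 6) := add_le_add (h1.trans h3) (h2.trans h5)
      _ ≤ L ^ (A + 7) := by
        rw [h6]
        have : 0 < L ^ (A + 6) := by positivity
        nlinarith
  intro s him hre hre2
  rcases le_total |s.im| 4 with h4 | h4
  · obtain ⟨h1, h2⟩ := hK s h4 (by linarith) hre2
    refine ⟨h1, h2.trans (hLK.trans ?_)⟩
    calc L = L ^ (1 : ℝ) := (Real.rpow_one _).symm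
      _ ≤ _ := Real.rpow_le_rpow_of_exponent_le (by linarith) (by linarith)
  · have hs1 : s ≠ 1 := by
      rintro rfl
      simp at h4
      linarith
    rcases le_total 0 s.im with hs | hs
    · rw [abs_of_nonneg hs] at h4 him
      obtain ⟨h1, h2⟩ := hpos s h4 him hre hre2
      exact ⟨(riemannZeta₁_ne_zero_iff hs1).2 h1, h2⟩
    · rw [abs_of_nonpos hs] at h4 him
      obtain ⟨h1, h2⟩ := hpos (conj s) (by simpa using h4) (by simpa using him) (by simpa using hre)
        (by simpa using hre2)
      have hz : riemannZeta s ≠ 0 := by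
        rw [riemannZeta_conj] at h1
        simpa using h1
      rw [primeError_conj hs1 hz, Complex.norm_conj] at h2
      exact ⟨(riemannZeta₁_ne_zero_iff hs1).2 hz, h2⟩

theorem primeError_eq_LSeries {s : ℂ} (hs : 1 < s.re) :
    LSeriesSummable (fun n => ((Λ n - 1 : ℝ) : ℂ)) s ∧
      primeError s = LSeries (fun n => ((Λ n - 1 : ℝ) : ℂ)) s := by
  have hs1 : s ≠ 1 := by
    rintro rfl
    simp at hs
  have hfun : (fun n => ((Λ n - 1 : ℝ) : ℂ)) = (fun n => (Λ n : ℂ)) - 1 := by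
    ext n
    simp
  have h1 := LSeriesSummable_vonMangoldt hs
  have h2 := LSeriesSummable_one_iff.2 hs
  rw [hfun]
  refine ⟨h1.sub h2, ?_⟩
  rw [LSeries_sub h1 h2, LSeries_vonMangoldt_eq_deriv_riemannZeta_div hs,
    LSeries_one_eq_riemannZeta hs,
    primeError_eq hs1 (riemannZeta_ne_zero_of_one_le_re hs.le), neg_div]

theorem norm_primeError_le {B : ℝ} (hB : ZetaNearOneBound B) {d : ℝ} (hd : 0 < d) (hd1 : d ≤ 1)
    {s : ℂ} (hs : s.re = 1 + d) : ‖primeError s‖ ≤ 1 / d + B + B / d := by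
  have hs1 : s ≠ 1 := by
    rintro rfl
    simp at hs
    linarith
  have hs' : 1 < s.re := by linarith
  have hz := riemannZeta_ne_zero_of_one_le_re hs'.le
  rw [primeError_eq hs1 hz]
  refine (norm_sub_le _ _).trans (add_le_add ?_ ?_)
  · rw [norm_neg]
    refine (norm_logDeriv_riemannZeta_le hs').trans ?_
    rw [hs]
    exact (hB d hd hd1).2
  · rw [← LSeries_one_eq_riemannZeta hs']
    refine (norm_LSeries_le_re (g := fun _ => 1) (fun n hn => by simp) ?_).trans
      ((Complex.re_le_norm _).trans ?_)
    · have := LSeriesSummable_one_iff.2 (show 1 < ((s.re : ℝ) : ℂ).re by simpa)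
      convert this using 2
      simp
    · have h1 := (hB d hd hd1).1
      rw [← hs, ← LSeries_one_eq_riemannZeta (by simpa)] at h1
      have h2 : (fun _ : ℕ => ((1 : ℝ) : ℂ)) = 1 := by
        ext n
        simp
      rw [h2]
      exact h1

end LogDerivBound

end VinogradovKorobov

namespace VinogradovKorobov

section Perron

open Complex MeasureTheory

/-- The Mellin transform of `u ↦ max (1 - u) 0`. -/
noncomputable def rieszKernel (s : ℂ) : ℂ := 1 / s - 1 / (s + 1)

theorem rieszKernel_eq {s : ℂ} (hs : 0 < s.re) : rieszKernel s = (s * (s + 1))⁻¹ := by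
  have h1 : s ≠ 0 := by
    rintro rfl
    simp at hs
  have h2 : s + 1 ≠ 0 := by
    intro h
    have := congrArg re h
    simp at this
    linarith
  unfold rieszKernel
  field_simp
  ring

theorem norm_rieszKernel_le_inv {s : ℂ} (hs : 0 < s.re) :
    ‖rieszKernel s‖ ≤ (s.re ^ 2 + s.im ^ 2)⁻¹ := by
  have h1 : 0 < ‖s‖ := by
    refine norm_pos_iff.2 ?_
    rintro rfl
    simp at hs
  have h2 : ‖s‖ ≤ ‖s + 1‖ := by
    refine le_of_sq_le_sq ?_ (norm_nonneg _)
    rw [← normSq_eq_norm_sq, ← normSq_eq_norm_sq, normSq_apply, normSq_apply]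
    simp
    nlinarith
  have h3 : s.re ^ 2 + s.im ^ 2 = ‖s‖ * ‖s‖ := by
    rw [← sq, ← normSq_eq_norm_sq, normSq_apply]
    ring
  rw [rieszKernel_eq hs, norm_inv, norm_mul, h3]
  gcongr

theorem norm_rieszKernel_le_of_one_le {s : ℂ} (hs : 1 ≤ s.re) :
    ‖rieszKernel s‖ ≤ (1 + s.im ^ 2)⁻¹ := by
  refine (norm_rieszKernel_le_inv (by linarith)).trans ?_
  gcongr
  nlinarith

theorem norm_rieszKernel_le_of_half_le {s : ℂ} (hs : 1 / 2 ≤ s.re) :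
    ‖rieszKernel s‖ ≤ 4 * (1 + s.im ^ 2)⁻¹ := by
  refine (norm_rieszKernel_le_inv (by linarith)).trans ?_
  rw [← div_eq_mul_inv, ← one_div, div_le_div_iff₀ (by nlinarith [sq_nonneg s.im])
    (by positivity)]
  nlinarith [sq_nonneg s.im]

theorem differentiableAt_rieszKernel {s : ℂ} (hs : 0 < s.re) :
    DifferentiableAt ℂ rieszKernel s := by
  have h1 : s ≠ 0 := by
    rintro rfl
    simp at hs
  have h2 : s + 1 ≠ 0 := by
    intro h
    have := congrArg re h
    simp at this
    linarith
  unfold rieszKernel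
  fun_prop (disch := assumption)

theorem continuous_rieszKernel_vertical {c : ℝ} (hc : 0 < c) :
    Continuous fun y : ℝ => rieszKernel (c + y * I) := by
  refine continuous_iff_continuousAt.2 fun y => ?_
  have h1 : ContinuousAt rieszKernel (c + y * I) :=
    (differentiableAt_rieszKernel (by simpa)).continuousAt
  exact ContinuousAt.comp (f := fun y : ℝ => (c + y * I : ℂ)) h1 (by fun_prop)

theorem integrable_rieszKernel_vertical {c : ℝ} (hc : 1 ≤ c) :
    Integrable fun y : ℝ => rieszKernel (c + y * I) := by
  refine integrable_inv_one_add_sq.mono'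
    (continuous_rieszKernel_vertical (by linarith)).aestronglyMeasurable
    (Filter.Eventually.of_forall fun y => ?_)
  simpa using norm_rieszKernel_le_of_one_le (s := c + y * I) (by simpa)

theorem integral_cpow_mul_rieszKernel {c : ℝ} (hc : 1 ≤ c) {x : ℝ} (hx : 0 < x) :
    ∫ y : ℝ, (x : ℂ) ^ (-(c + y * I : ℂ)) * rieszKernel (c + y * I) =
      2 * Real.pi * ((max (1 - x) 0 : ℝ) : ℂ) := by
  set f : ℝ → ℂ := fun t => (Set.Ioc (0 : ℝ) 1).indicator (fun _ => (1 : ℂ)) t -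
    (Set.Ioc (0 : ℝ) 1).indicator (fun t => (t : ℂ) ^ (1 : ℂ)) t with hf
  have hmel : ∀ s : ℂ, 0 < s.re → HasMellin f s (rieszKernel s) := by
    intro s hs
    have h1 := hasMellin_one_Ioc hs
    have h2 := hasMellin_cpow_Ioc 1 (s := s) (by simp; linarith)
    have h3 := hasMellin_sub h1.1 h2.1
    rw [h1.2, h2.2] at h3
    exact h3
  have hfval : ∀ t : ℝ, 0 < t → f t = ((max (1 - t) 0 : ℝ) : ℂ) := by
    intro t ht
    by_cases h : t ≤ 1
    · have hm : t ∈ Set.Ioc (0 : ℝ) 1 := ⟨ht, h⟩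
      simp [hf, hm, max_eq_left (sub_nonneg.2 h)]
    · have hm : t ∉ Set.Ioc (0 : ℝ) 1 := fun h' => h h'.2
      rw [max_eq_right (by linarith)]
      simp [hf, hm]
  have hcont : ContinuousAt f x := by
    have h1 : Continuous fun t : ℝ => ((max (1 - t) 0 : ℝ) : ℂ) := by fun_prop
    refine h1.continuousAt.congr ?_
    filter_upwards [lt_mem_nhds hx] with t ht
    exact (hfval t ht).symm
  have hintegrable : VerticalIntegrable (mellin f) c := by
    have h1 := integrable_rieszKernel_vertical hc
    refine h1.congr (Filter.Eventually.of_forall fun y => ?_)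
    exact (hmel (c + y * I) (by simp; linarith)).2.symm
  have key := mellinInv_mellin_eq c f hx (hmel c (by simp; linarith)).1 hintegrable hcont
  rw [hfval x hx, mellinInv] at key
  rw [← key]
  have h2 : (fun y : ℝ => (x : ℂ) ^ (-(c + y * I : ℂ)) • mellin f (c + y * I)) =
      fun y : ℝ => (x : ℂ) ^ (-(c + y * I : ℂ)) * rieszKernel (c + y * I) := by
    ext y
    rw [(hmel (c + y * I) (by simp; linarith)).2, smul_eq_mul]
  have h3 : (2 * Real.pi : ℂ) * ((1 / (2 * Real.pi) : ℝ) : ℂ) = 1 := by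
    push_cast
    field_simp
  rw [h2, real_smul, ← mul_assoc, h3, one_mul]

/-- Perron's formula with the weight `max (1 - n / X) 0`. -/
theorem integral_LSeries_mul_cpow_mul_rieszKernel {a : ℕ → ℂ} {c : ℝ} (hc : 1 ≤ c)
    (ha : LSeriesSummable a c) {X : ℝ} (hX : 0 < X) :
    ∫ y : ℝ, LSeries a (c + y * I) * ((X : ℂ) ^ (c + y * I : ℂ) * rieszKernel (c + y * I)) =
      2 * Real.pi * ∑ n ∈ Finset.Icc 1 ⌊X⌋₊, a n * ((1 - n / X : ℝ) : ℂ) := by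
  have hXn : ∀ y : ℝ, ‖(X : ℂ) ^ (c + y * I : ℂ)‖ = X ^ c := by
    intro y
    rw [norm_cpow_eq_rpow_re_of_pos hX]
    simp
  have hX0 : (X : ℂ) ≠ 0 := by exact_mod_cast hX.ne'
  set G : ℝ → ℂ := fun y => (X : ℂ) ^ (c + y * I : ℂ) * rieszKernel (c + y * I) with hG
  have hGc : Continuous G := by
    refine Continuous.mul ?_ (continuous_rieszKernel_vertical (by linarith))
    exact Continuous.const_cpow (by fun_prop) (Or.inl hX0)
  have hGn : ∀ y, ‖G y‖ = X ^ c * ‖rieszKernel (c + y * I)‖ := by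
    intro y
    rw [hG, norm_mul, hXn]
  have hGi : Integrable G := by
    refine ((integrable_rieszKernel_vertical hc).norm.const_mul (X ^ c)).mono'
      hGc.aestronglyMeasurable (Filter.Eventually.of_forall fun y => (hGn y).le)
  set F : ℕ → ℝ → ℂ := fun n y => LSeries.term a (c + y * I) n * G y with hF
  have hterm : ∀ n (y : ℝ), ‖LSeries.term a (c + y * I) n‖ = ‖LSeries.term a c n‖ := by
    intro n y
    rw [LSeries.norm_term_eq, LSeries.norm_term_eq]
    simp
  have htermc : ∀ n, Continuous fun y : ℝ => LSeries.term a (c + y * I) n := by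
    intro n
    rcases eq_or_ne n 0 with rfl | hn
    · simp only [LSeries.term_zero]
      exact continuous_const
    · simp only [LSeries.term_of_ne_zero hn]
      have hn' : (n : ℂ) ≠ 0 := by exact_mod_cast hn
      refine Continuous.div continuous_const
        (Continuous.const_cpow (by fun_prop) (Or.inl hn')) fun y => ?_
      simp [cpow_eq_zero_iff, hn']
  have hFn : ∀ n y, ‖F n y‖ = ‖LSeries.term a c n‖ * ‖G y‖ := by
    intro n y
    rw [hF, norm_mul, hterm]
  have hFi : ∀ n, Integrable (F n) := fun n =>
    (hGi.norm.const_mul ‖LSeries.term a c n‖).mono' ((htermc n).mul hGc).aestronglyMeasurable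
      (Filter.Eventually.of_forall fun y => (hFn n y).le)
  have hsum : Summable fun n => ∫ y, ‖F n y‖ := by
    simp only [hFn, integral_const_mul]
    exact ha.norm.mul_right _
  have key := hasSum_integral_of_summable_integral_norm hFi hsum
  have hval : ∀ n, ∫ y, F n y =
      if n ∈ Finset.Icc 1 ⌊X⌋₊ then 2 * Real.pi * (a n * ((1 - n / X : ℝ) : ℂ)) else 0 := by
    intro n
    rcases eq_or_ne n 0 with rfl | hn
    · simp [hF]
    have hn0 : (0 : ℝ) < n := by positivity
    have h1 : ∀ y, F n y = a n * (((n / X : ℝ) : ℂ) ^ (-(c + y * I : ℂ)) *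
        rieszKernel (c + y * I)) := by
      intro y
      simp only [hF, hG, LSeries.term_of_ne_zero hn]
      rw [ofReal_div, div_cpow_ofReal_nonneg hn0.le hX.le, cpow_neg, cpow_neg, ofReal_natCast]
      rw [div_inv_eq_mul]
      ring
    simp only [h1]
    rw [integral_const_mul, integral_cpow_mul_rieszKernel hc (by positivity)]
    split_ifs with h
    · have h2 : (n : ℝ) ≤ X := (Nat.le_floor_iff hX.le).1 (Finset.mem_Icc.1 h).2
      rw [max_eq_left (by rw [sub_nonneg, div_le_one hX]; exact h2)]
      ring
    · have h2 : X < n := by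
        by_contra! h3
        exact h (Finset.mem_Icc.2 ⟨Nat.one_le_iff_ne_zero.2 hn, Nat.le_floor h3⟩)
      rw [max_eq_right (by rw [sub_nonpos, one_le_div hX]; exact h2.le)]
      simp
  have hleft : ∀ y : ℝ, ∑' n, F n y = LSeries a (c + y * I) * G y := by
    intro y
    rw [LSeries, ← tsum_mul_right]
  simp only [hleft] at key
  rw [← key.tsum_eq]
  simp only [hval]
  rw [tsum_eq_sum (s := Finset.Icc 1 ⌊X⌋₊) (fun n hn => by rw [if_neg hn]), Finset.mul_sum]
  exact Finset.sum_congr rfl fun n hn => by rw [if_pos hn]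

theorem norm_integral_compl_Ioc_le {f : ℝ → ℂ} {M T : ℝ} (hM : 0 ≤ M) (hT : 0 < T)
    (hf : ∀ y, ‖f y‖ ≤ M * (1 + y ^ 2)⁻¹) : ‖∫ y in (Set.Ioc (-T) T)ᶜ, f y‖ ≤ 2 * M / T := by
  have hi : Integrable fun y : ℝ => M * (1 + y ^ 2)⁻¹ := integrable_inv_one_add_sq.const_mul M
  refine (norm_integral_le_of_norm_le hi.integrableOn
    (Filter.Eventually.of_forall hf)).trans ?_
  rw [integral_const_mul]
  have h1 := integral_add_compl (μ := volume) (measurableSet_Ioc (a := -T) (b := T))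
    integrable_inv_one_add_sq
  rw [integral_univ_inv_one_add_sq, ← intervalIntegral.integral_of_le (by linarith),
    integral_inv_one_add_sq, Real.arctan_neg] at h1
  have h2 := Real.arctan_inv_of_pos hT
  have h3 : Real.arctan T⁻¹ ≤ T⁻¹ := by
    have h4 := Real.le_tan (Real.arctan_pos.2 (inv_pos.2 hT)).le (Real.arctan_lt_pi_div_two _)
    rwa [Real.tan_arctan] at h4
  have h5 : ∫ y in (Set.Ioc (-T) T)ᶜ, (1 + y ^ 2)⁻¹ ≤ 2 * T⁻¹ := by linarith
  calc M * ∫ y in (Set.Ioc (-T) T)ᶜ, (1 + y ^ 2)⁻¹ ≤ M * (2 * T⁻¹) := by gcongr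
    _ = 2 * M / T := by ring

/-- Moving the line of integration in Perron's formula, truncated at height `T`. -/
theorem norm_integral_vertical_mul_rieszKernel_le {F : ℂ → ℂ} {c σ T X M M₁ : ℝ} (hc : 1 < c)
    (hc2 : c ≤ 2) (hσ : 1 / 2 ≤ σ) (hσ1 : σ ≤ 1) (hT : 0 < T) (hX : 1 ≤ X)
    (hd : ∀ s : ℂ, |s.im| ≤ T → σ ≤ s.re → s.re ≤ 2 → DifferentiableAt ℂ F s)
    (hM₁ : ∀ s : ℂ, |s.im| ≤ T → σ ≤ s.re → s.re ≤ 2 → ‖F s‖ ≤ M₁)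
    (hcont : Continuous fun y : ℝ => F (c + y * I)) (hM : ∀ y : ℝ, ‖F (c + y * I)‖ ≤ M) :
    ‖∫ y : ℝ, F (c + y * I) * ((X : ℂ) ^ (c + y * I : ℂ) * rieszKernel (c + y * I))‖ ≤
      2 * (M * X ^ c) / T + 4 * Real.pi * (M₁ * X ^ σ) + 4 * (M₁ * X ^ c) / T ^ 2 := by
  have hX0 : 0 < X := by linarith
  have hXc : (X : ℂ) ≠ 0 := by exact_mod_cast hX0.ne'
  have hM0 : 0 ≤ M := (norm_nonneg _).trans (hM 0)
  have hM₁0 : 0 ≤ M₁ := (norm_nonneg _).trans (hM₁ 1 (by simpa using hT.le) (by simpa) (by simp))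
  set Φ : ℂ → ℂ := fun s => F s * ((X : ℂ) ^ s * rieszKernel s) with hΦ
  have hΦn : ∀ s : ℂ, ‖Φ s‖ = ‖F s‖ * (X ^ s.re * ‖rieszKernel s‖) := by
    intro s
    rw [hΦ, norm_mul, norm_mul, norm_cpow_eq_rpow_re_of_pos hX0]
  have hΦc : ∀ y : ℝ, ‖Φ (c + y * I)‖ ≤ M * X ^ c * (1 + y ^ 2)⁻¹ := by
    intro y
    have h1 := norm_rieszKernel_le_of_one_le (s := c + y * I) (by simpa using hc.le)
    simp only [add_im, ofReal_im, mul_im, ofReal_re, I_im, I_re, mul_one, mul_zero, add_zero,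
      zero_add] at h1
    rw [hΦn, mul_assoc]
    have h2 : (c + y * I : ℂ).re = c := by simp
    rw [h2]
    gcongr
    exact hM y
  have hΦi : Integrable fun y : ℝ => Φ (c + y * I) := by
    refine (integrable_inv_one_add_sq.const_mul (M * X ^ c)).mono'
      (Continuous.aestronglyMeasurable ?_) (Filter.Eventually.of_forall hΦc)
    refine hcont.mul (Continuous.mul ?_ (continuous_rieszKernel_vertical (by linarith)))
    exact Continuous.const_cpow (by fun_prop) (Or.inl hXc)
  have hdΦ : DifferentiableOn ℂ Φ (Set.uIcc σ c ×ℂ Set.uIcc (-T) T) := by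
    intro s hs
    rw [Set.uIcc_of_le (by linarith), Set.uIcc_of_le (by linarith)] at hs
    refine DifferentiableAt.differentiableWithinAt ?_
    refine (hd s (abs_le.2 hs.2) hs.1.1 (hs.1.2.trans hc2)).mul (DifferentiableAt.mul ?_
      (differentiableAt_rieszKernel (by linarith [hs.1.1])))
    exact differentiableAt_id.const_cpow (Or.inl hXc)
  have hrect := integral_boundary_rect_eq_zero_of_differentiableOn Φ (σ + (-T : ℝ) * I) (c + T * I)
    (by simpa using hdΦ)
  simp only [add_re, ofReal_re, mul_re, I_re, mul_zero, ofReal_im, I_im, mul_one, sub_self,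
    add_zero, add_im, mul_im, zero_add] at hrect
  have hhor : ∀ t : ℝ, |t| = T → ‖∫ x : ℝ in σ..c, Φ (x + t * I)‖ ≤ 2 * (M₁ * X ^ c) / T ^ 2 := by
    intro t ht
    have h1 : ∀ x ∈ Set.uIoc σ c, ‖Φ (x + t * I)‖ ≤ M₁ * X ^ c / T ^ 2 := by
      intro x hx
      rw [Set.uIoc_of_le (by linarith)] at hx
      have h2 : (x + t * I : ℂ).re = x := by simp
      have h3 : (x + t * I : ℂ).im = t := by simp
      have h4 : ‖rieszKernel (x + t * I)‖ ≤ (T ^ 2)⁻¹ := by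
        refine (norm_rieszKernel_le_inv (by rw [h2]; linarith [hx.1])).trans ?_
        rw [h2, h3, ← sq_abs t, ht]
        gcongr
        nlinarith [sq_nonneg x]
      have h5 := hM₁ (x + t * I) (by rw [h3, ht]) (by rw [h2]; exact hx.1.le)
        (by rw [h2]; linarith [hx.2])
      rw [hΦn, h2, div_eq_mul_inv, mul_assoc]
      gcongr
      exact hx.2
    refine (intervalIntegral.norm_integral_le_of_norm_le_const h1).trans ?_
    rw [abs_of_nonneg (by linarith)]
    have h6 : 0 ≤ M₁ * X ^ c / T ^ 2 := by positivity
    calc M₁ * X ^ c / T ^ 2 * (c - σ) ≤ M₁ * X ^ c / T ^ 2 * 2 := by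
          gcongr
          linarith
      _ = _ := by ring
  have hvert : ‖∫ y : ℝ in (-T)..T, Φ (σ + y * I)‖ ≤ 4 * Real.pi * (M₁ * X ^ σ) := by
    have h1 : ∀ y ∈ Set.Ioc (-T) T, ‖Φ (σ + y * I)‖ ≤ 4 * (M₁ * X ^ σ) * (1 + y ^ 2)⁻¹ := by
      intro y hy
      have h2 : (σ + y * I : ℂ).re = σ := by simp
      have h3 : (σ + y * I : ℂ).im = y := by simp
      have h4 := norm_rieszKernel_le_of_half_le (s := σ + y * I) (by rw [h2]; exact hσ)
      have h5 := hM₁ (σ + y * I) (by rw [h3, abs_le]; exact ⟨hy.1.le, hy.2⟩) (by rw [h2])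
        (by rw [h2]; linarith)
      rw [h3] at h4
      rw [hΦn, h2]
      calc ‖F (σ + y * I)‖ * (X ^ σ * ‖rieszKernel (σ + y * I)‖)
          ≤ M₁ * (X ^ σ * (4 * (1 + y ^ 2)⁻¹)) := by gcongr
        _ = _ := by ring
    have h6 : Integrable fun y : ℝ => 4 * (M₁ * X ^ σ) * (1 + y ^ 2)⁻¹ :=
      integrable_inv_one_add_sq.const_mul _
    rw [intervalIntegral.integral_of_le (by linarith)]
    refine (norm_integral_le_of_norm_le h6.integrableOn
      ((ae_restrict_iff' measurableSet_Ioc).2 (Filter.Eventually.of_forall h1))).trans ?_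
    refine (setIntegral_le_integral h6 (Filter.Eventually.of_forall fun y => ?_)).trans_eq ?_
    · dsimp
      positivity
    · rw [integral_const_mul, integral_univ_inv_one_add_sq]
      ring
  have hsplit := integral_add_compl (measurableSet_Ioc (a := -T) (b := T)) hΦi
  rw [← intervalIntegral.integral_of_le (by linarith)] at hsplit
  have htail := norm_integral_compl_Ioc_le (by positivity) hT hΦc
  have h1 := hhor (-T) (by rw [abs_neg, abs_of_pos hT])
  have h2 := hhor T (abs_of_pos hT)
  set a := ∫ x : ℝ in σ..c, Φ (x + (-T : ℝ) * I)
  set b := ∫ x : ℝ in σ..c, Φ (x + T * I)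
  set e := ∫ y : ℝ in (-T)..T, Φ (c + y * I)
  set g := ∫ y : ℝ in (-T)..T, Φ (σ + y * I)
  have h3 : e = g + I * (a - b) := by
    have : a - b + I * e - I * g = 0 := hrect
    linear_combination (-I) * this + (e - g) * I_mul_I
  rw [← hsplit, h3]
  calc ‖g + I * (a - b) + ∫ y in (Set.Ioc (-T) T)ᶜ, Φ (c + y * I)‖
      ≤ ‖g‖ + (‖a‖ + ‖b‖) + ‖∫ y in (Set.Ioc (-T) T)ᶜ, Φ (c + y * I)‖ := by
        refine (norm_add_le _ _).trans ?_
        gcongr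
        refine (norm_add_le _ _).trans ?_
        gcongr
        rw [norm_mul, norm_I, one_mul]
        exact norm_sub_le _ _
    _ ≤ 4 * Real.pi * (M₁ * X ^ σ) + (2 * (M₁ * X ^ c) / T ^ 2 + 2 * (M₁ * X ^ c) / T ^ 2) +
        2 * (M * X ^ c) / T := by gcongr
    _ = _ := by ring

end Perron

end VinogradovKorobov

namespace VinogradovKorobov

section RieszMean

open Complex MeasureTheory ArithmeticFunction

theorem exists_riesz_mean_bound : ∃ c : ℝ, 0 < c ∧ c ≤ 1 ∧ ∃ A : ℝ, 0 < A ∧ ∃ C : ℝ, 0 < C ∧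
    ∃ L₀ : ℝ, 3 ≤ L₀ ∧ ∀ L : ℝ, L₀ ≤ L → ∀ X : ℝ, Real.exp 1 ≤ X →
      |∑ n ∈ Finset.Icc 1 ⌊X⌋₊, (Λ n - 1) * (1 - n / X)| ≤
        C * X * (Real.log X * Real.exp (-L) +
          L ^ A * (Real.exp (-L) + X ^ (-zeroFreeWidth c L))) := by
  obtain ⟨c, hc0, hc1, A, hA0, L₀, hL₀, hL⟩ := exists_primeError_bound
  obtain ⟨B, hB1, hB⟩ := exists_riemannZeta_near_one_bounds
  refine ⟨c, hc0, hc1, A, hA0, 200 * (1 + 2 * B), by linarith, L₀, hL₀, fun L hL0 X hX => ?_⟩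
  have hL3 : 3 ≤ L := hL₀.trans hL0
  have hX0 : 0 < X := (Real.exp_pos 1).trans_le hX
  have hX1 : 1 ≤ X := (Real.one_le_exp (by norm_num)).trans hX
  have hlog : 1 ≤ Real.log X := (Real.le_log_iff_exp_le hX0).2 hX
  set d := 1 / Real.log X with hd
  have hd0 : 0 < d := by positivity
  have hd1 : d ≤ 1 := (div_le_one (by linarith)).2 hlog
  set w := zeroFreeWidth c L with hw
  have hw0 : 0 < w := zeroFreeWidth_pos hc0 hL3
  have hw2 : w ≤ 1 / 2 := by
    have h1 := zeroFreeWidth_le hc0 hL3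
    have h2 := growthWidth_le_half hL3
    nlinarith [growthWidth_pos hL3]
  set T := Real.exp L / 4 with hT
  have hT0 : 0 < T := by positivity
  have hcast : ∀ y : ℝ, (((1 + d : ℝ) : ℂ) + y * I).re = 1 + d := fun y => by simp
  have hXc : X ^ (1 + d) = Real.exp 1 * X := by
    rw [Real.rpow_add hX0, Real.rpow_one, mul_comm]
    congr 1
    rw [Real.rpow_def_of_pos hX0, hd]
    congr 1
    field_simp
  have hFM : ∀ y : ℝ, ‖primeError (((1 + d : ℝ) : ℂ) + y * I)‖ ≤ (1 + 2 * B) * Real.log X := by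
    intro y
    refine (norm_primeError_le hB hd0 hd1 (hcast y)).trans ?_
    rw [hd, one_div_one_div, div_div_eq_mul_div, div_one]
    nlinarith
  have hFc : Continuous fun y : ℝ => primeError (((1 + d : ℝ) : ℂ) + y * I) := by
    refine continuous_iff_continuousAt.2 fun y => ?_
    have h1 : ContinuousAt primeError (((1 + d : ℝ) : ℂ) + y * I) :=
      (differentiableAt_primeError (riemannZeta₁_ne_zero_of_one_le_re
        (by rw [hcast]; linarith))).continuousAt
    exact ContinuousAt.comp (f := fun y : ℝ => (((1 + d : ℝ) : ℂ) + y * I)) h1 (by fun_prop)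
  have hbound := norm_integral_vertical_mul_rieszKernel_le (F := primeError) (c := 1 + d)
    (σ := 1 - w) (T := T) (X := X) (by linarith) (by linarith) (by linarith) (by linarith) hT0 hX1
    (fun s h1 h2 h3 => differentiableAt_primeError (hL L hL0 s h1 h2 h3).1)
    (fun s h1 h2 h3 => (hL L hL0 s h1 h2 h3).2) hFc hFM
  have hsum : LSeriesSummable (fun n => ((Λ n - 1 : ℝ) : ℂ)) ((1 + d : ℝ) : ℂ) :=
    (primeError_eq_LSeries (by simpa using hd0)).1
  have hperron := integral_LSeries_mul_cpow_mul_rieszKernel (by linarith) hsum hX0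
  have heq : ∀ y : ℝ, LSeries (fun n => ((Λ n - 1 : ℝ) : ℂ)) (((1 + d : ℝ) : ℂ) + y * I) =
      primeError (((1 + d : ℝ) : ℂ) + y * I) := fun y =>
    (primeError_eq_LSeries (by rw [hcast]; linarith)).2.symm
  simp only [heq] at hperron
  rw [hperron] at hbound
  have hcastsum : ∑ n ∈ Finset.Icc 1 ⌊X⌋₊, ((Λ n - 1 : ℝ) : ℂ) * ((1 - n / X : ℝ) : ℂ) =
      ((∑ n ∈ Finset.Icc 1 ⌊X⌋₊, (Λ n - 1) * (1 - n / X) : ℝ) : ℂ) := by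
    push_cast
    rfl
  rw [hcastsum] at hbound
  set S := ∑ n ∈ Finset.Icc 1 ⌊X⌋₊, (Λ n - 1) * (1 - n / X)
  have hpi := Real.pi_gt_three
  have hpi' := Real.pi_lt_four
  have hnorm : ‖(2 * Real.pi : ℂ) * (S : ℂ)‖ = 2 * Real.pi * |S| := by
    rw [norm_mul, norm_real, Real.norm_eq_abs]
    congr 1
    rw [norm_mul, norm_real, Real.norm_eq_abs, abs_of_pos Real.pi_pos]
    simp
  rw [hnorm] at hbound
  have he := Real.exp_one_lt_three
  have hTi : ∀ a : ℝ, a / T = 4 * a * Real.exp (-L) := by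
    intro a
    rw [hT, Real.exp_neg]
    field_simp
  have hTi2 : ∀ a : ℝ, a / T ^ 2 = 16 * a * Real.exp (-L) * Real.exp (-L) := by
    intro a
    rw [hT, Real.exp_neg]
    field_simp
    ring
  have hXσ : X ^ (1 - w) = X * X ^ (-w) := by
    rw [sub_eq_add_neg, Real.rpow_add hX0, Real.rpow_one]
  rw [hTi, hTi2, hXc, hXσ] at hbound
  have hE1 : Real.exp (-L) ≤ 1 := Real.exp_le_one_iff.2 (by linarith)
  set E := Real.exp (-L)
  have hE0 : 0 < E := Real.exp_pos _
  have hLA : 0 < L ^ A := by positivity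
  have hXw : 0 < X ^ (-w) := by positivity
  set P := L ^ A
  set V := X ^ (-w)
  set ℓ := Real.log X
  have t1 : 4 * (2 * ((1 + 2 * B) * ℓ * (Real.exp 1 * X))) * E ≤ 24 * (1 + 2 * B) * X * (ℓ * E) := by
    have : 0 ≤ (1 + 2 * B) * ℓ * X * E := by positivity
    nlinarith
  have t2 : 4 * Real.pi * (P * (X * V)) ≤ 16 * X * (P * V) := by
    have : 0 ≤ X * (P * V) := by positivity
    nlinarith
  have t3 : 16 * (4 * (P * (Real.exp 1 * X))) * E * E ≤ 192 * X * (P * E) := by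
    have h1 : 0 ≤ P * X * E := by positivity
    calc 16 * (4 * (P * (Real.exp 1 * X))) * E * E = 64 * Real.exp 1 * E * (P * X * E) := by ring
      _ ≤ 64 * 3 * 1 * (P * X * E) := by gcongr
      _ = _ := by ring
  have t4 : |S| ≤ 2 * Real.pi * |S| := by nlinarith [abs_nonneg S]
  have u1 : 0 ≤ X * (ℓ * E) := by positivity
  have u2 : 0 ≤ X * (P * V) := by positivity
  have u3 : 0 ≤ X * (P * E) := by positivity
  have hBB : 1 ≤ 1 + 2 * B := by linarith
  calc |S| ≤ 24 * (1 + 2 * B) * X * (ℓ * E) + 16 * X * (P * V) + 192 * X * (P * E) := by linarith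
    _ ≤ 200 * (1 + 2 * B) * (X * (ℓ * E)) + 200 * (1 + 2 * B) * (X * (P * V)) +
        200 * (1 + 2 * B) * (X * (P * E)) := by
      have v1 := mul_le_mul_of_nonneg_right hBB u1
      have v2 := mul_le_mul_of_nonneg_right hBB u2
      have v3 := mul_le_mul_of_nonneg_right hBB u3
      nlinarith
    _ = _ := by ring

end RieszMean

section Exponent

/-- The exponent `(log x)^(3/5) (log log x)^(-1/5)` of the error term. -/
noncomputable def errorExponent (x : ℝ) : ℝ :=
  Real.log x ^ ((3 : ℝ) / 5) * Real.log (Real.log x) ^ (-(1 : ℝ) / 5)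

theorem errorExponent_eq {x : ℝ} (hx : Real.exp (Real.exp 1) ≤ x) :
    errorExponent x = Real.log x ^ ((2 : ℝ) / 5) *
      (Real.log x / Real.log (Real.log x)) ^ ((1 : ℝ) / 5) := by
  have hx0 : 0 < x := (Real.exp_pos _).trans_le hx
  have h1 : Real.exp 1 ≤ Real.log x := (Real.le_log_iff_exp_le hx0).2 hx
  have h0 : 0 < Real.log x := (Real.exp_pos _).trans_le h1
  have h2 : 1 ≤ Real.log (Real.log x) := (Real.le_log_iff_exp_le h0).2 h1
  rw [errorExponent, Real.div_rpow h0.le (by linarith), neg_div, Real.rpow_neg (by linarith),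
    ← div_eq_mul_inv, ← mul_div_assoc, ← Real.rpow_add h0]
  norm_num

theorem errorExponent_mono {x y : ℝ} (hx : Real.exp (Real.exp 1) ≤ x) (hxy : x ≤ y) :
    errorExponent x ≤ errorExponent y := by
  have hx0 : 0 < x := (Real.exp_pos _).trans_le hx
  have h1 : Real.exp 1 ≤ Real.log x := (Real.le_log_iff_exp_le hx0).2 hx
  have h0 : 0 < Real.log x := (Real.exp_pos _).trans_le h1
  have h2 : 1 ≤ Real.log (Real.log x) := (Real.le_log_iff_exp_le h0).2 h1
  have h3 : Real.log x ≤ Real.log y := Real.log_le_log hx0 hxy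
  have h4 : Real.log (Real.log x) ≤ Real.log (Real.log y) := Real.log_le_log h0 h3
  rw [errorExponent_eq hx, errorExponent_eq (hx.trans hxy)]
  have h5 : Real.log x / Real.log (Real.log x) ≤ Real.log y / Real.log (Real.log y) := by
    have h6 := Real.log_div_self_antitoneOn (show Real.exp 1 ≤ Real.log x from h1)
      (show Real.exp 1 ≤ Real.log y from h1.trans h3) h3
    rw [div_le_div_iff₀ (by linarith) (by linarith)] at h6 ⊢
    linarith
  have h7 : 0 ≤ Real.log y := by linarith
  gcongr

theorem errorExponent_pos {x : ℝ} (hx : Real.exp (Real.exp 1) ≤ x) : 0 < errorExponent x := by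
  have hx0 : 0 < x := (Real.exp_pos _).trans_le hx
  have h1 : Real.exp 1 ≤ Real.log x := (Real.le_log_iff_exp_le hx0).2 hx
  have h0 : 0 < Real.log x := (Real.exp_pos _).trans_le h1
  have h2 : 1 ≤ Real.log (Real.log x) := (Real.le_log_iff_exp_le h0).2 h1
  unfold errorExponent
  positivity

theorem errorExponent_le_log {x : ℝ} (hx : Real.exp (Real.exp 1) ≤ x) :
    errorExponent x ≤ Real.log x := by
  have hx0 : 0 < x := (Real.exp_pos _).trans_le hx
  have h1 : Real.exp 1 ≤ Real.log x := (Real.le_log_iff_exp_le hx0).2 hx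
  have h0 : 1 ≤ Real.log x := (Real.one_le_exp (by norm_num)).trans h1
  have h2 : 1 ≤ Real.log (Real.log x) := (Real.le_log_iff_exp_le (by linarith)).2 h1
  calc errorExponent x ≤ Real.log x ^ (1 : ℝ) * 1 := by
        unfold errorExponent
        gcongr
        · norm_num
        · exact Real.rpow_le_one_of_one_le_of_nonpos h2 (by norm_num)
    _ = Real.log x := by simp

theorem sqrt_log_le_errorExponent {x : ℝ} (hx : Real.exp (Real.exp 1) ≤ x) :
    Real.log x ^ ((1 : ℝ) / 2) ≤ errorExponent x := by
  have hx0 : 0 < x := (Real.exp_pos _).trans_le hx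
  have h1 : Real.exp 1 ≤ Real.log x := (Real.le_log_iff_exp_le hx0).2 hx
  have h0 : 0 < Real.log x := (Real.exp_pos _).trans_le h1
  have h2 : 1 ≤ Real.log (Real.log x) := (Real.le_log_iff_exp_le h0).2 h1
  have h3 : Real.log (Real.log x) ≤ Real.log x ^ ((1 : ℝ) / 2) := by
    have h4 : Real.log (Real.log x) = 2 * Real.log (Real.log x ^ ((1 : ℝ) / 2)) := by
      rw [Real.log_rpow h0]
      ring
    have h5 := Real.two_mul_le_exp (x := Real.log (Real.log x ^ ((1 : ℝ) / 2)))
    rwa [Real.exp_log (by positivity), ← h4] at h5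
  have h6 : (Real.log x ^ ((1 : ℝ) / 2)) ^ (-(1 : ℝ) / 5) ≤
      Real.log (Real.log x) ^ (-(1 : ℝ) / 5) :=
    Real.rpow_le_rpow_of_nonpos (by linarith) h3 (by norm_num)
  rw [← Real.rpow_mul h0.le] at h6
  calc Real.log x ^ ((1 : ℝ) / 2) =
        Real.log x ^ ((3 : ℝ) / 5) * Real.log x ^ ((1 : ℝ) / 2 * (-(1 : ℝ) / 5)) := by
        rw [← Real.rpow_add h0]
        norm_num
    _ ≤ errorExponent x := by
        unfold errorExponent
        gcongr

theorem half_errorExponent_le_errorExponent_sqrt {x : ℝ}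
    (hx : Real.exp (2 * Real.exp 1) ≤ x) : errorExponent x / 2 ≤ errorExponent (√x) := by
  have hx0 : 0 < x := (Real.exp_pos _).trans_le hx
  have h1 : 2 * Real.exp 1 ≤ Real.log x := (Real.le_log_iff_exp_le hx0).2 hx
  have he := Real.exp_one_gt_d9
  have h3 : Real.log (√x) = Real.log x / 2 := Real.log_sqrt hx0.le
  have h4 : 1 ≤ Real.log (Real.log x / 2) :=
    (Real.le_log_iff_exp_le (by linarith)).2 (by linarith)
  have h5 : Real.log (Real.log x / 2) ≤ Real.log (Real.log x) :=
    Real.log_le_log (by linarith) (by linarith)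
  have h6 : Real.log (Real.log x) ^ (-(1 : ℝ) / 5) ≤
      Real.log (Real.log x / 2) ^ (-(1 : ℝ) / 5) :=
    Real.rpow_le_rpow_of_nonpos (by linarith) h5 (by norm_num)
  have h7 : Real.log x ^ ((3 : ℝ) / 5) / 2 ≤ (Real.log x / 2) ^ ((3 : ℝ) / 5) := by
    rw [Real.div_rpow (by linarith) (by norm_num)]
    have h8 : (2 : ℝ) ^ ((3 : ℝ) / 5) ≤ 2 ^ (1 : ℝ) :=
      Real.rpow_le_rpow_of_exponent_le (by norm_num) (by norm_num)
    rw [Real.rpow_one] at h8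
    have : 0 ≤ Real.log x := by linarith
    gcongr
  have h9 : 0 ≤ Real.log (Real.log x) ^ (-(1 : ℝ) / 5) := Real.rpow_nonneg (by linarith) _
  have h10 : 0 ≤ (Real.log x / 2) ^ ((3 : ℝ) / 5) := Real.rpow_nonneg (by linarith) _
  unfold errorExponent
  rw [h3, mul_div_right_comm]
  gcongr

end Exponent

end VinogradovKorobov

namespace VinogradovKorobov

section ChebyshevPsi

open Filter ArithmeticFunction

theorem mul_errorExponent_le_zeroFreeWidth_mul_log {c x : ℝ} (hc : 0 < c)
    (hx : Real.exp (Real.exp 1) ≤ x) (hg : 3 ≤ errorExponent x) :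
    c / 2 * errorExponent x ≤ zeroFreeWidth c (errorExponent x) * Real.log x := by
  have hx0 : 0 < x := (Real.exp_pos _).trans_le hx
  have h1 : Real.exp 1 ≤ Real.log x := (Real.le_log_iff_exp_le hx0).2 hx
  have h0 : 0 < Real.log x := (Real.exp_pos _).trans_le h1
  have h2 : 1 ≤ Real.log (Real.log x) := (Real.le_log_iff_exp_le h0).2 h1
  have hlg : 1 ≤ Real.log (errorExponent x) := one_le_log_of_three_le hg
  have hlgle : Real.log (errorExponent x) ≤ Real.log (Real.log x) :=
    Real.log_le_log (by linarith) (errorExponent_le_log hx)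
  set ℓ := Real.log x with hℓ
  set g := errorExponent x with hgdef
  have hgval : g = ℓ ^ ((3 : ℝ) / 5) * Real.log ℓ ^ (-(1 : ℝ) / 5) := rfl
  set m := Real.log ℓ
  have hg0 : 0 < g := by linarith
  have hm0 : 0 < m := by linarith
  have h3 : (Real.log g / g) ^ ((2 : ℝ) / 3) / Real.log g =
      Real.log g ^ (-(1 : ℝ) / 3) * g ^ (-(2 : ℝ) / 3) := by
    have hp : Real.log g ^ (-(1 : ℝ) / 3) = Real.log g ^ ((2 : ℝ) / 3) / Real.log g := by
      rw [← Real.rpow_sub_one (by linarith)]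
      norm_num
    rw [hp, Real.div_rpow (by linarith) hg0.le, neg_div, Real.rpow_neg hg0.le]
    ring
  have h4 : m ^ (-(1 : ℝ) / 3) ≤ Real.log g ^ (-(1 : ℝ) / 3) :=
    Real.rpow_le_rpow_of_nonpos (by linarith) hlgle (by norm_num)
  have h5 : g ^ (-(2 : ℝ) / 3) = ℓ ^ (-(2 : ℝ) / 5) * m ^ ((2 : ℝ) / 15) := by
    rw [hgval, Real.mul_rpow (by positivity) (by positivity), ← Real.rpow_mul h0.le,
      ← Real.rpow_mul hm0.le]
    norm_num
  have h6 : g = m ^ (-(1 : ℝ) / 3) * g ^ (-(2 : ℝ) / 3) * ℓ := by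
    have e1 : ℓ ^ ((3 : ℝ) / 5) = ℓ ^ (-(2 : ℝ) / 5) * ℓ := by
      rw [← Real.rpow_add_one h0.ne']
      norm_num
    have e2 : m ^ (-(1 : ℝ) / 5) = m ^ (-(1 : ℝ) / 3) * m ^ ((2 : ℝ) / 15) := by
      rw [← Real.rpow_add hm0]
      norm_num
    rw [h5, hgval, e1, e2]
    ring
  have h7 : zeroFreeWidth c g * ℓ =
      c / 2 * ((Real.log g / g) ^ ((2 : ℝ) / 3) / Real.log g * ℓ) := by
    unfold zeroFreeWidth growthWidth
    ring
  rw [h7, h3]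
  refine mul_le_mul_of_nonneg_left ?_ (by positivity)
  calc g = m ^ (-(1 : ℝ) / 3) * g ^ (-(2 : ℝ) / 3) * ℓ := h6
    _ ≤ _ := by gcongr

theorem eventually_mul_log_rpow_le_exp_errorExponent (K A : ℝ) {c : ℝ} (hc : 0 < c) :
    ∀ᶠ x in atTop, K * Real.log x ^ A ≤ Real.exp (c * errorExponent x) := by
  have h1 := (tendsto_rpow_mul_exp_neg_mul_atTop_nhds_zero (2 * A) c hc).const_mul K
  rw [mul_zero] at h1
  have h2 : Tendsto (fun x : ℝ => Real.log x ^ ((1 : ℝ) / 2)) atTop atTop :=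
    (tendsto_rpow_atTop (by norm_num)).comp Real.tendsto_log_atTop
  filter_upwards [h2.eventually (h1.eventually (ge_mem_nhds one_pos)),
    eventually_ge_atTop (Real.exp (Real.exp 1))] with x h3 hx
  have h0 : 0 ≤ Real.log x :=
    (Real.exp_pos 1).le.trans ((Real.le_log_iff_exp_le ((Real.exp_pos _).trans_le hx)).2 hx)
  rw [← Real.rpow_mul h0, neg_mul, Real.exp_neg, ← mul_assoc, ← div_eq_mul_inv,
    div_le_one (Real.exp_pos _)] at h3
  rw [show (1 : ℝ) / 2 * (2 * A) = A by ring] at h3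
  refine h3.trans (Real.exp_le_exp.2 ?_)
  have := sqrt_log_le_errorExponent hx
  gcongr

theorem exists_riesz_mean_le_exp : ∃ c : ℝ, 0 < c ∧ c ≤ 1 ∧ ∀ᶠ X : ℝ in atTop,
    |∑ n ∈ Finset.Icc 1 ⌊X⌋₊, (Λ n - 1) * (1 - n / X)| ≤
      X * Real.exp (-c * errorExponent X) := by
  obtain ⟨c, hc0, hc1, A, hA, C, hC, L₀, hL₀, H⟩ := exists_riesz_mean_bound
  refine ⟨c / 4, by positivity, by linarith, ?_⟩
  have h2 : Tendsto (fun x : ℝ => Real.log x ^ ((1 : ℝ) / 2)) atTop atTop :=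
    (tendsto_rpow_atTop (by norm_num)).comp Real.tendsto_log_atTop
  filter_upwards [eventually_mul_log_rpow_le_exp_errorExponent (3 * C) (A + 1)
      (show 0 < c / 4 by positivity), eventually_ge_atTop (Real.exp (Real.exp 1)),
    h2.eventually_ge_atTop L₀] with X hX hXe hXL
  have hX0 : 0 < X := (Real.exp_pos _).trans_le hXe
  have h1 : Real.exp 1 ≤ Real.log X := (Real.le_log_iff_exp_le hX0).2 hXe
  have hℓ1 : 1 ≤ Real.log X := (Real.one_le_exp (by norm_num)).trans h1
  have hg : L₀ ≤ errorExponent X := hXL.trans (sqrt_log_le_errorExponent hXe)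
  have hX1 : Real.exp 1 ≤ X := (Real.exp_le_exp.2 (Real.one_le_exp (by norm_num))).trans hXe
  refine (H _ hg X hX1).trans ?_
  have hw := mul_errorExponent_le_zeroFreeWidth_mul_log hc0 hXe (hL₀.trans hg)
  have hgl := errorExponent_le_log hXe
  set g := errorExponent X
  set ℓ := Real.log X with hℓ
  have hg0 : 0 < g := by linarith
  have e1 : Real.exp (-g) ≤ Real.exp (-(c / 2 * g)) := by
    refine Real.exp_le_exp.2 ?_
    nlinarith
  have e2 : X ^ (-zeroFreeWidth c g) ≤ Real.exp (-(c / 2 * g)) := by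
    rw [Real.rpow_def_of_pos hX0]
    refine Real.exp_le_exp.2 ?_
    linarith
  have e3 : g ^ A ≤ ℓ ^ A := by gcongr
  have e4 : ℓ ^ A ≤ ℓ ^ (A + 1) := Real.rpow_le_rpow_of_exponent_le hℓ1 (by linarith)
  have e5 : ℓ ≤ ℓ ^ (A + 1) := by
    calc ℓ = ℓ ^ (1 : ℝ) := (Real.rpow_one _).symm
      _ ≤ _ := Real.rpow_le_rpow_of_exponent_le hℓ1 (by linarith)
  have e6 : Real.exp (-(c / 2 * g)) = Real.exp (-(c / 4) * g) * (Real.exp (c / 4 * g))⁻¹ := by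
    rw [← Real.exp_neg, ← Real.exp_add]
    congr 1
    ring
  set E := Real.exp (-(c / 2 * g))
  calc C * X * (ℓ * Real.exp (-g) + g ^ A * (Real.exp (-g) + X ^ (-zeroFreeWidth c g)))
      ≤ C * X * (ℓ ^ (A + 1) * E + ℓ ^ (A + 1) * (E + E)) := by
        gcongr
        exact e3.trans e4
    _ = X * (3 * C * ℓ ^ (A + 1)) * E := by ring
    _ ≤ X * Real.exp (c / 4 * g) * E := by gcongr
    _ = _ := by
        rw [e6]
        field_simp

/-- Differencing the Riesz means of a sequence bounded below recovers its partial sums. -/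
theorem abs_sum_le_of_riesz_mean_le {a : ℕ → ℝ} (ha : ∀ n, -1 ≤ a n) {X h M : ℝ} (hh : 0 < h)
    (hhX : h ≤ X)
    (h₁ : |∑ n ∈ Finset.Icc 1 ⌊X - h⌋₊, a n * (X - h - n)| ≤ M)
    (h₂ : |∑ n ∈ Finset.Icc 1 ⌊X⌋₊, a n * (X - n)| ≤ M)
    (h₃ : |∑ n ∈ Finset.Icc 1 ⌊X + h⌋₊, a n * (X + h - n)| ≤ M) :
    |∑ n ∈ Finset.Icc 1 ⌊X⌋₊, a n| ≤ 2 * M / h + h + 1 := by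
  have hstep : ∀ Y : ℝ, 0 ≤ Y → ∀ w : ℕ → ℝ,
      ∑ n ∈ Finset.Icc 1 ⌊Y + h⌋₊, w n =
        ∑ n ∈ Finset.Icc 1 ⌊Y⌋₊, w n + ∑ n ∈ Finset.Ioc ⌊Y⌋₊ ⌊Y + h⌋₊, w n := by
    intro Y hY w
    have hle : ⌊Y⌋₊ ≤ ⌊Y + h⌋₊ := Nat.floor_mono (by linarith)
    have hd : Finset.Icc 1 ⌊Y + h⌋₊ = Finset.Icc 1 ⌊Y⌋₊ ∪ Finset.Ioc ⌊Y⌋₊ ⌊Y + h⌋₊ := by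
      ext n
      simp only [Finset.mem_union, Finset.mem_Icc, Finset.mem_Ioc]
      omega
    rw [hd, Finset.sum_union]
    refine Finset.disjoint_left.2 fun n hn hn' => ?_
    simp only [Finset.mem_Icc, Finset.mem_Ioc] at hn hn'
    omega
  have hcard : ∀ Y : ℝ, 0 ≤ Y → ∀ w : ℕ → ℝ,
      (∀ n ∈ Finset.Ioc ⌊Y⌋₊ ⌊Y + h⌋₊, -h ≤ w n) →
      -(h * (h + 1)) ≤ ∑ n ∈ Finset.Ioc ⌊Y⌋₊ ⌊Y + h⌋₊, w n := by
    intro Y hY w hw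
    have hle : ⌊Y⌋₊ ≤ ⌊Y + h⌋₊ := Nat.floor_mono (by linarith)
    have h4 := Finset.card_nsmul_le_sum _ w (-h) hw
    rw [nsmul_eq_mul, Nat.card_Ioc, Nat.cast_sub hle] at h4
    have h5 := Nat.floor_le (show 0 ≤ Y + h by linarith)
    have h6 := Nat.lt_floor_add_one Y
    have h7 : ((⌊Y + h⌋₊ : ℝ) - ⌊Y⌋₊) * h ≤ (h + 1) * h := by
      gcongr
      linarith
    linarith
  have hbd : ∀ Y : ℝ, 0 ≤ Y → ∀ n ∈ Finset.Ioc ⌊Y⌋₊ ⌊Y + h⌋₊, Y ≤ n ∧ (n : ℝ) ≤ Y + h := by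
    intro Y hY n hn
    rw [Finset.mem_Ioc] at hn
    exact ⟨((Nat.floor_lt hY).1 hn.1).le, (Nat.le_floor_iff (by linarith)).1 hn.2⟩
  have up : h * ∑ n ∈ Finset.Icc 1 ⌊X⌋₊, a n ≤ 2 * M + h * (h + 1) := by
    have e1 := hstep X (by linarith) fun n => a n * (X + h - n)
    have e2 := hcard X (by linarith) (fun n => a n * (X + h - n)) fun n hn => by
      have := hbd X (by linarith) n hn
      nlinarith [ha n]
    have e3 : ∑ n ∈ Finset.Icc 1 ⌊X⌋₊, a n * (X + h - n) =
        ∑ n ∈ Finset.Icc 1 ⌊X⌋₊, a n * (X - n) + h * ∑ n ∈ Finset.Icc 1 ⌊X⌋₊, a n := by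
      rw [Finset.mul_sum, ← Finset.sum_add_distrib]
      exact Finset.sum_congr rfl fun n _ => by ring
    have := abs_le.1 h₂
    have := abs_le.1 h₃
    linarith
  have low : -(2 * M + h * (h + 1)) ≤ h * ∑ n ∈ Finset.Icc 1 ⌊X⌋₊, a n := by
    have e1 := hstep (X - h) (by linarith) fun n => a n * (X - n)
    have e2 := hcard (X - h) (by linarith) (fun n => a n * (h - (X - n))) fun n hn => by
      have := hbd (X - h) (by linarith) n hn
      nlinarith [ha n]
    have e3 : ∑ n ∈ Finset.Icc 1 ⌊X - h⌋₊, a n * (X - n) =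
        ∑ n ∈ Finset.Icc 1 ⌊X - h⌋₊, a n * (X - h - n) +
          h * ∑ n ∈ Finset.Icc 1 ⌊X - h⌋₊, a n := by
      rw [Finset.mul_sum, ← Finset.sum_add_distrib]
      exact Finset.sum_congr rfl fun n _ => by ring
    have e4 := hstep (X - h) (by linarith) a
    have e5 : ∑ n ∈ Finset.Ioc ⌊X - h⌋₊ ⌊X - h + h⌋₊, a n * (h - (X - n)) =
        h * ∑ n ∈ Finset.Ioc ⌊X - h⌋₊ ⌊X - h + h⌋₊, a n -
          ∑ n ∈ Finset.Ioc ⌊X - h⌋₊ ⌊X - h + h⌋₊, a n * (X - n) := by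
      rw [Finset.mul_sum, ← Finset.sum_sub_distrib]
      exact Finset.sum_congr rfl fun n _ => by ring
    rw [sub_add_cancel] at e1 e2 e4 e5
    have e6 := congrArg (h * ·) e4
    simp only [mul_add] at e6
    have := abs_le.1 h₁
    have := abs_le.1 h₂
    linarith
  have hfin : h * |∑ n ∈ Finset.Icc 1 ⌊X⌋₊, a n| ≤ 2 * M + h * (h + 1) := by
    rw [← abs_of_pos hh, ← abs_mul, abs_of_pos hh]
    exact abs_le.2 ⟨low, up⟩
  rw [← mul_le_mul_iff_right₀ hh]
  refine hfin.trans_eq ?_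
  field_simp
  ring

end ChebyshevPsi

end VinogradovKorobov

namespace VinogradovKorobov

section ChebyshevTheta

open Filter ArithmeticFunction

theorem exists_abs_psi_sub_le_exp : ∃ c : ℝ, 0 < c ∧ c ≤ 1 / 8 ∧ ∀ᶠ x : ℝ in atTop,
    |Chebyshev.psi x - x| ≤ x * Real.exp (-c * errorExponent x) := by
  obtain ⟨c, hc0, hc1, H⟩ := exists_riesz_mean_le_exp
  obtain ⟨X₁, hX₁⟩ := eventually_atTop.1 H
  refine ⟨c / 8, by positivity, by linarith, ?_⟩
  have hsq : Tendsto (fun x : ℝ => √x) atTop atTop := Real.tendsto_sqrt_atTop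
  filter_upwards [eventually_mul_log_rpow_le_exp_errorExponent 19 0
      (show 0 < c / 8 by positivity), eventually_ge_atTop (Real.exp (2 * Real.exp 1)),
    hsq.eventually_ge_atTop (max X₁ (Real.exp (Real.exp 1)))] with X h19 hXe hXs
  rw [Real.rpow_zero, mul_one] at h19
  have hX0 : 0 < X := (Real.exp_pos _).trans_le hXe
  have hXe' : Real.exp (Real.exp 1) ≤ X :=
    (Real.exp_le_exp.2 (by linarith [Real.exp_pos 1])).trans hXe
  have hsqe : Real.exp (Real.exp 1) ≤ √X := (le_max_right _ _).trans hXs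
  have hsq2 : 2 ≤ √X := by
    refine le_trans ?_ hsqe
    have := Real.add_one_le_exp (Real.exp 1)
    have := Real.add_one_le_exp 1
    linarith
  have hsqh : √X ≤ X / 2 := by
    have := Real.mul_self_sqrt hX0.le
    nlinarith
  have hghalf := half_errorExponent_le_errorExponent_sqrt hXe
  have hgpos := errorExponent_pos hXe'
  have hglog := errorExponent_le_log hXe'
  set g := errorExponent X with hg
  set e := Real.exp (-(c / 4) * g) with he
  have he0 : 0 < e := Real.exp_pos _
  have he1 : e ≤ 1 := Real.exp_le_one_iff.2 (by nlinarith)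
  have hee : Real.exp (-(c / 2) * g) = e ^ 2 := by
    rw [he, ← Real.exp_nat_mul]
    congr 1
    push_cast
    ring
  have hXe1 : 1 ≤ X * e := by
    have h1 : Real.exp (-Real.log X) ≤ e := Real.exp_le_exp.2 (by nlinarith)
    rw [Real.exp_neg, Real.exp_log hX0] at h1
    calc 1 = X * X⁻¹ := (mul_inv_cancel₀ hX0.ne').symm
      _ ≤ X * e := by gcongr
  have hB : ∀ Y : ℝ, X / 2 ≤ Y → Y ≤ 2 * X →
      |∑ n ∈ Finset.Icc 1 ⌊Y⌋₊, (Λ n - 1) * (Y - n)| ≤ 4 * X ^ 2 * e ^ 2 := by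
    intro Y hY1 hY2
    have hY0 : 0 < Y := by linarith
    have h1 := hX₁ Y ((le_max_left _ _).trans (hXs.trans (hsqh.trans hY1)))
    have h2 : errorExponent (√X) ≤ errorExponent Y :=
      errorExponent_mono hsqe (hsqh.trans hY1)
    have h3 : ∑ n ∈ Finset.Icc 1 ⌊Y⌋₊, (Λ n - 1) * (Y - n) =
        Y * ∑ n ∈ Finset.Icc 1 ⌊Y⌋₊, (Λ n - 1) * (1 - n / Y) := by
      rw [Finset.mul_sum]
      refine Finset.sum_congr rfl fun n _ => ?_
      field_simp
    have h4 : Real.exp (-c * errorExponent Y) ≤ e ^ 2 := by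
      rw [← hee]
      refine Real.exp_le_exp.2 ?_
      nlinarith
    rw [h3, abs_mul, abs_of_pos hY0]
    calc Y * |∑ n ∈ Finset.Icc 1 ⌊Y⌋₊, (Λ n - 1) * (1 - n / Y)|
        ≤ (2 * X) * ((2 * X) * e ^ 2) := by
          gcongr
          refine h1.trans ?_
          gcongr
      _ = _ := by ring
  have hXe2 : X * e ≤ X := by nlinarith
  have hmain := abs_sum_le_of_riesz_mean_le (a := fun n => Λ n - 1)
    (fun n => by linarith [vonMangoldt_nonneg (n := n)]) (X := X) (h := X * e / 2)
    (by positivity) (by linarith) (hB _ (by linarith) (by linarith))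
    (hB _ (by linarith) (by linarith)) (hB _ (by linarith) (by linarith))
  have hdiv : 2 * (4 * X ^ 2 * e ^ 2) / (X * e / 2) = 16 * (X * e) := by
    field_simp
    ring
  rw [hdiv] at hmain
  have hpsi : ∑ n ∈ Finset.Icc 1 ⌊X⌋₊, (Λ n - 1) = Chebyshev.psi X - ⌊X⌋₊ := by
    rw [Finset.sum_sub_distrib, Chebyshev.psi]
    simp
    rfl
  rw [hpsi] at hmain
  have hf1 := Nat.floor_le hX0.le
  have hf2 := Nat.lt_floor_add_one X
  have hfl : |(⌊X⌋₊ : ℝ) - X| ≤ 1 := abs_le.2 ⟨by linarith, by linarith⟩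
  have h8 : e = Real.exp (-(c / 8) * g) * (Real.exp (c / 8 * g))⁻¹ := by
    rw [he, ← Real.exp_neg, ← Real.exp_add]
    congr 1
    ring
  calc |Chebyshev.psi X - X| ≤ |Chebyshev.psi X - ⌊X⌋₊| + |(⌊X⌋₊ : ℝ) - X| := abs_sub_le _ _ _
    _ ≤ X * (19 * e) := by linarith
    _ ≤ X * (Real.exp (c / 8 * g) * e) := by gcongr
    _ = _ := by
        rw [h8]
        field_simp

theorem exists_abs_theta_sub_le_exp : ∃ c : ℝ, 0 < c ∧ c ≤ 1 / 8 ∧ ∀ᶠ x : ℝ in atTop,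
    |Chebyshev.theta x - x| ≤ x * Real.exp (-c * errorExponent x) := by
  obtain ⟨c, hc0, hc1, H⟩ := exists_abs_psi_sub_le_exp
  refine ⟨c / 2, by positivity, by linarith, ?_⟩
  filter_upwards [H, eventually_mul_log_rpow_le_exp_errorExponent 2 0
      (show 0 < c / 2 by positivity), eventually_mul_log_rpow_le_exp_errorExponent 4 1
      (show 0 < c / 2 by positivity), eventually_ge_atTop (Real.exp (Real.exp 1))] with X hX h2 h4 hXe
  rw [Real.rpow_zero, mul_one] at h2
  rw [Real.rpow_one] at h4
  have hX0 : 0 < X := (Real.exp_pos _).trans_le hXe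
  have h1 : Real.exp 1 ≤ Real.log X := (Real.le_log_iff_exp_le hX0).2 hXe
  have hX1 : 1 ≤ X := (Real.one_le_exp (Real.exp_pos 1).le).trans hXe
  have hpt := Chebyshev.abs_psi_sub_theta_le_sqrt_mul_log hX1
  have hgpos := errorExponent_pos hXe
  have hglog := errorExponent_le_log hXe
  set g := errorExponent X with hg
  have hℓ : 0 < Real.log X := (Real.exp_pos 1).trans_le h1
  have hsqrt : √X = Real.exp (Real.log X / 2) := by
    rw [Real.sqrt_eq_rpow, Real.rpow_def_of_pos hX0]
    congr 1
    ring
  have e1 : Real.exp (-c * g) = Real.exp (-(c / 2) * g) * (Real.exp (c / 2 * g))⁻¹ := by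
    rw [← Real.exp_neg, ← Real.exp_add]
    congr 1
    ring
  have t1 : X * Real.exp (-c * g) ≤ X * Real.exp (-(c / 2) * g) / 2 := by
    rw [e1, ← mul_assoc, ← div_eq_mul_inv]
    gcongr
  have t2 : 2 * √X * Real.log X ≤ X * Real.exp (-(c / 2) * g) / 2 := by
    have h5 : 4 * Real.log X * √X ≤ X * Real.exp (-(c / 2) * g) := by
      calc 4 * Real.log X * √X ≤ Real.exp (c / 2 * g) * √X := by gcongr
        _ ≤ Real.exp (Real.log X) * Real.exp (-(c / 2) * g) := by
          rw [hsqrt, ← Real.exp_add, ← Real.exp_add]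
          refine Real.exp_le_exp.2 ?_
          nlinarith
        _ = _ := by rw [Real.exp_log hX0]
    linarith
  calc |Chebyshev.theta X - X| ≤ |Chebyshev.psi X - X| + |Chebyshev.psi X - Chebyshev.theta X| := by
        have := abs_sub_le (Chebyshev.theta X) (Chebyshev.psi X) X
        rw [abs_sub_comm (Chebyshev.theta X) (Chebyshev.psi X)] at this
        linarith
    _ ≤ X * Real.exp (-(c / 2) * g) / 2 + X * Real.exp (-(c / 2) * g) / 2 :=
        add_le_add (hX.trans t1) (hpt.trans t2)
    _ = _ := by ring

end ChebyshevTheta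

end VinogradovKorobov

namespace VinogradovKorobov

section PrimeCounting

open Filter MeasureTheory

theorem primePi_eq_primeCounting {x : ℝ} (hx : 0 ≤ x) : primePi x = Nat.primeCounting ⌊x⌋₊ := by
  rw [primePi, Nat.primeCounting, Nat.primeCounting', Nat.count_eq_card_filter_range,
    ← Set.ncard_coe_finset]
  congr 1
  ext p
  simp [Nat.le_floor_iff hx, and_comm]

theorem intervalIntegrable_inv_log_sq {x : ℝ} (hx : 2 ≤ x) :
    IntervalIntegrable (fun t => 1 / Real.log t ^ 2) volume 2 x := by
  refine ContinuousOn.intervalIntegrable fun t ht => ?_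
  rw [Set.uIcc_of_le hx] at ht
  have h1 : 0 < Real.log t := Real.log_pos (by linarith [ht.1])
  have h2 : t ≠ 0 := by linarith [ht.1]
  refine ContinuousAt.continuousWithinAt ?_
  fun_prop (disch := positivity)

theorem li_eq {x : ℝ} (hx : 2 ≤ x) :
    li x = x / Real.log x - 2 / Real.log 2 + ∫ t in (2 : ℝ)..x, 1 / Real.log t ^ 2 := by
  have hpos : ∀ t ∈ Set.uIcc 2 x, 0 < t ∧ 0 < Real.log t := by
    intro t ht
    rw [Set.uIcc_of_le hx] at ht
    exact ⟨by linarith [ht.1], Real.log_pos (by linarith [ht.1])⟩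
  have hi1 : IntervalIntegrable (fun t => 1 / Real.log t) volume 2 x := by
    refine ContinuousOn.intervalIntegrable fun t ht => ContinuousAt.continuousWithinAt ?_
    have h1 := (hpos t ht).2
    have h2 := (hpos t ht).1.ne'
    fun_prop (disch := positivity)
  have hi2 := intervalIntegrable_inv_log_sq hx
  have hd : ∀ t ∈ Set.uIcc 2 x,
      HasDerivAt (fun t => t / Real.log t) (1 / Real.log t - 1 / Real.log t ^ 2) t := by
    intro t ht
    obtain ⟨h1, h2⟩ := hpos t ht
    have h3 := (hasDerivAt_id t).div (Real.hasDerivAt_log h1.ne') h2.ne'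
    have h4 : (1 * Real.log t - id t * t⁻¹) / Real.log t ^ 2 =
        1 / Real.log t - 1 / Real.log t ^ 2 := by
      simp only [id]
      field_simp
    rwa [h4] at h3
  have h := intervalIntegral.integral_eq_sub_of_hasDerivAt hd (hi1.sub hi2)
  rw [intervalIntegral.integral_sub hi1 hi2] at h
  rw [li]
  linarith

theorem primePi_sub_li_eq {x : ℝ} (hx : 2 ≤ x) :
    (primePi x : ℝ) - li x = (Chebyshev.theta x - x) / Real.log x +
      (∫ t in (2 : ℝ)..x, (Chebyshev.theta t - t) / (t * Real.log t ^ 2)) + 2 / Real.log 2 := by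
  have hi1 : IntervalIntegrable (fun t => Chebyshev.theta t / (t * Real.log t ^ 2)) volume 2 x := by
    rw [intervalIntegrable_iff_integrableOn_Icc_of_le hx]
    exact Chebyshev.integrableOn_theta_div_id_mul_log_sq x
  have h1 : ∫ t in (2 : ℝ)..x, (Chebyshev.theta t - t) / (t * Real.log t ^ 2) =
      ∫ t in (2 : ℝ)..x, (Chebyshev.theta t / (t * Real.log t ^ 2) - 1 / Real.log t ^ 2) := by
    refine intervalIntegral.integral_congr fun t ht => ?_
    rw [Set.uIcc_of_le hx] at ht
    have h0 : t ≠ 0 := by linarith [ht.1]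
    rw [sub_div]
    congr 1
    rw [div_mul_eq_div_div, div_self h0]
  rw [primePi_eq_primeCounting (by linarith), Chebyshev.primeCounting_eq_theta_div_log_add_integral hx,
    li_eq hx, h1, intervalIntegral.integral_sub hi1 (intervalIntegrable_inv_log_sq hx)]
  ring

theorem abs_theta_sub_le {t : ℝ} (ht : 0 ≤ t) : |Chebyshev.theta t - t| ≤ t := by
  have h1 := Chebyshev.theta_nonneg t
  have h2 := Chebyshev.theta_le_log4_mul_x ht
  have h3 : Real.log 4 ≤ 2 := by
    rw [show (4 : ℝ) = 2 ^ 2 by norm_num, Real.log_pow]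
    have := Real.log_two_lt_d9
    push_cast
    linarith
  exact abs_le.2 ⟨by linarith, by nlinarith⟩

theorem abs_primePi_sub_li_le {x D : ℝ} (hx : Real.exp 1 ≤ x) (hD : 1 ≤ D)
    (h : ∀ t, 2 ≤ t → t ≤ x → |Chebyshev.theta t - t| ≤ D) :
    |(primePi x : ℝ) - li x| ≤ 7 * D * Real.log x := by
  have he := Real.exp_one_gt_d9
  have hx2 : 2 ≤ x := by linarith
  have hlog : 1 ≤ Real.log x := (Real.le_log_iff_exp_le (by linarith)).2 hx
  have hl2 := Real.log_two_gt_d9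
  have hintegrable : |∫ t in (2 : ℝ)..x, (Chebyshev.theta t - t) / (t * Real.log t ^ 2)| ≤
      3 * D * Real.log x := by
    have h1 : ∀ t ∈ Set.Ioc 2 x,
        ‖(Chebyshev.theta t - t) / (t * Real.log t ^ 2)‖ ≤ 3 * D * t⁻¹ := by
      intro t ht
      have ht0 : 0 < t := by linarith [ht.1]
      have h2 : Real.log 2 ≤ Real.log t := Real.log_le_log (by norm_num) ht.1.le
      have h3 : 1 ≤ 3 * Real.log t ^ 2 := by nlinarith
      have h4 : 0 < Real.log t := by linarith
      rw [Real.norm_eq_abs, abs_div, abs_of_pos (by positivity : 0 < t * Real.log t ^ 2),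
        div_le_iff₀ (by positivity)]
      calc |Chebyshev.theta t - t| ≤ D * 1 := by simpa using h t ht.1.le ht.2
        _ ≤ D * (3 * Real.log t ^ 2) := by gcongr
        _ = 3 * D * t⁻¹ * (t * Real.log t ^ 2) := by field_simp
    have h0 : IntervalIntegrable (fun t : ℝ => 3 * D * t⁻¹) volume 2 x := by
      refine IntervalIntegrable.const_mul ?_ _
      refine intervalIntegral.intervalIntegrable_inv (fun t ht => ?_) continuousOn_id
      rw [Set.uIcc_of_le hx2] at ht
      exact (by linarith [ht.1] : (0 : ℝ) < t).ne'
    have h4 := intervalIntegral.norm_integral_le_of_norm_le hx2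
      (Filter.Eventually.of_forall h1) h0
    rw [Real.norm_eq_abs, intervalIntegral.integral_const_mul,
      integral_inv_of_pos (by norm_num) (by linarith)] at h4
    refine h4.trans ?_
    gcongr
    linarith
  have hfirst : |(Chebyshev.theta x - x) / Real.log x| ≤ D * Real.log x := by
    rw [abs_div, abs_of_pos (by linarith : 0 < Real.log x)]
    refine (div_le_self (abs_nonneg _) hlog).trans ((h x hx2 le_rfl).trans ?_)
    nlinarith
  have hthird : |2 / Real.log 2| ≤ 3 * (D * Real.log x) := by
    rw [abs_of_pos (by positivity), div_le_iff₀ (by linarith)]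
    have : 1 ≤ D * Real.log x := by nlinarith
    nlinarith
  rw [primePi_sub_li_eq hx2]
  refine (abs_add_le _ _).trans ?_
  have := abs_add_le ((Chebyshev.theta x - x) / Real.log x)
    (∫ t in (2 : ℝ)..x, (Chebyshev.theta t - t) / (t * Real.log t ^ 2))
  linarith

theorem exists_abs_primePi_sub_li_le : ∃ c : ℝ, 0 < c ∧ c ≤ 1 ∧ ∀ᶠ x : ℝ in atTop,
    |(primePi x : ℝ) - li x| ≤ x * Real.exp (-c * errorExponent x) := by
  obtain ⟨c, hc0, hc1, H⟩ := exists_abs_theta_sub_le_exp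
  obtain ⟨X₁, hX₁⟩ := eventually_atTop.1 H
  refine ⟨c / 4, by positivity, by linarith, ?_⟩
  filter_upwards [eventually_mul_log_rpow_le_exp_errorExponent 14 1
      (show 0 < c / 4 by positivity), eventually_ge_atTop (Real.exp (2 * Real.exp 1)),
    Real.tendsto_sqrt_atTop.eventually_ge_atTop (max X₁ (Real.exp (Real.exp 1)))]
    with x h14 hxe hxs
  rw [Real.rpow_one] at h14
  have hx0 : 0 < x := (Real.exp_pos _).trans_le hxe
  have hxe' : Real.exp (Real.exp 1) ≤ x :=
    (Real.exp_le_exp.2 (by linarith [Real.exp_pos 1])).trans hxe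
  have hx1 : Real.exp 1 ≤ x := (Real.exp_le_exp.2 (Real.one_le_exp (by norm_num))).trans hxe'
  have hsqe : Real.exp (Real.exp 1) ≤ √x := (le_max_right _ _).trans hxs
  have hghalf := half_errorExponent_le_errorExponent_sqrt hxe
  have hgpos := errorExponent_pos hxe'
  have hglog := errorExponent_le_log hxe'
  have hsqrt : √x = Real.exp (Real.log x / 2) := by
    rw [Real.sqrt_eq_rpow, Real.rpow_def_of_pos hx0]
    congr 1
    ring
  set g := errorExponent x
  set E := Real.exp (-(c / 2) * g) with hE
  have hsqE : √x ≤ x * E := by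
    calc √x ≤ Real.exp (Real.log x) * E := by
          rw [hsqrt, ← Real.exp_add]
          refine Real.exp_le_exp.2 ?_
          nlinarith
      _ = _ := by rw [Real.exp_log hx0]
  have hsq1 : 1 ≤ √x := (Real.one_le_exp (Real.exp_pos 1).le).trans hsqe
  have hD : ∀ t, 2 ≤ t → t ≤ x → |Chebyshev.theta t - t| ≤ x * E := by
    intro t ht htx
    rcases le_total t (√x) with h | h
    · exact (abs_theta_sub_le (by linarith)).trans (h.trans hsqE)
    · refine (hX₁ t ((le_max_left _ _).trans (hxs.trans h))).trans ?_
      have h1 := errorExponent_mono hsqe h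
      have h2 : -c * errorExponent t ≤ -(c / 2) * g := by nlinarith
      rw [hE]
      gcongr
  have hEE : E = Real.exp (-(c / 4) * g) * (Real.exp (c / 4 * g))⁻¹ := by
    rw [hE, ← Real.exp_neg, ← Real.exp_add]
    congr 1
    ring
  calc |(primePi x : ℝ) - li x| ≤ 7 * (x * E) * Real.log x :=
        abs_primePi_sub_li_le hx1 (hsq1.trans hsqE) hD
    _ = x * E * (7 * Real.log x) := by ring
    _ ≤ x * E * Real.exp (c / 4 * g) := by
      gcongr
      have : 0 ≤ Real.log x := by linarith
      linarith
    _ = _ := by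
      rw [hEE]
      field_simp

theorem abs_primePi_sub_li_le_mul {x : ℝ} (hx : Real.exp 1 ≤ x) :
    |(primePi x : ℝ) - li x| ≤ 7 * x * Real.log x := by
  have he := Real.exp_one_gt_d9
  exact abs_primePi_sub_li_le hx (by linarith) fun t ht htx =>
    (abs_theta_sub_le (by linarith)).trans htx

end PrimeCounting

end VinogradovKorobov

open VinogradovKorobov in
theorem prime_number_theorem_vinogradov_korobov :
    ∃ c : ℝ, 0 < c ∧ ∃ C : ℝ, 0 < C ∧ ∀ x : ℝ, 16 ≤ x →
      |(primePi x : ℝ) - li x| ≤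
        C * x * Real.exp (-c * (Real.log x) ^ ((3:ℝ)/5) *
          (Real.log (Real.log x)) ^ (-(1:ℝ)/5)) := by
  obtain ⟨c, hc0, hc1, H⟩ := exists_abs_primePi_sub_li_le
  obtain ⟨X₀, hX₀⟩ := Filter.eventually_atTop.1 H
  refine ⟨c, hc0, max 1 (7 * Real.log X₀ * Real.exp (Real.log X₀)), by positivity, fun x hx => ?_⟩
  have hee : Real.exp (Real.exp 1) ≤ x := by
    refine le_trans ?_ hx
    rw [← Real.le_log_iff_exp_le (by norm_num), show (16 : ℝ) = 2 ^ 4 by norm_num, Real.log_pow]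
    have h1 := Real.exp_one_lt_d9
    have h2 := Real.log_two_gt_d9
    push_cast
    linarith
  have hx1 : Real.exp 1 ≤ x := (Real.exp_le_exp.2 (Real.one_le_exp (by norm_num))).trans hee
  have hx0 : 0 < x := by linarith
  have hlog : 1 ≤ Real.log x := (Real.le_log_iff_exp_le hx0).2 hx1
  rw [mul_assoc (-c)]
  change _ ≤ _ * x * Real.exp (-c * errorExponent x)
  rcases le_total X₀ x with h | h
  · refine (hX₀ x h).trans ?_
    gcongr
    nlinarith [le_max_left 1 (7 * Real.log X₀ * Real.exp (Real.log X₀))]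
  · refine (abs_primePi_sub_li_le_mul hx1).trans ?_
    have h1 : Real.log x ≤ Real.log X₀ := Real.log_le_log hx0 h
    have h2 := errorExponent_le_log hee
    have h3 := errorExponent_pos hee
    have h4 : 1 ≤ Real.exp (Real.log X₀) * Real.exp (-c * errorExponent x) := by
      rw [← Real.exp_add]
      refine Real.one_le_exp ?_
      nlinarith
    have h5 : 0 ≤ 7 * x * Real.log X₀ := by
      have : 0 ≤ Real.log X₀ := by linarith
      positivity
    calc 7 * x * Real.log x ≤ 7 * x * Real.log X₀ * 1 := by
          rw [mul_one]
          gcongr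
      _ ≤ 7 * x * Real.log X₀ * (Real.exp (Real.log X₀) * Real.exp (-c * errorExponent x)) := by
          gcongr
      _ = 7 * Real.log X₀ * Real.exp (Real.log X₀) * x * Real.exp (-c * errorExponent x) := by ring
      _ ≤ _ := by
          gcongr
          exact le_max_right _ _
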